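/- For every real number c, the total variation distance between the ⌈(n−3/2)·log n + c·n⌉-fold self-convolution of the transpose top-2 with random shuffle measure P on the alternating group A_n and the uniform measure on A_n converges, as n → ∞, to d_TV(Poi(1+e^{−c}), Poi(1)), the total variation distance between Poisson distributions with parameters 1+e^{−c} and 1. -/

import Mathlib

open scoped Classical
open Filter

noncomputable def convolve {G : Type*} [Group G] [Fintype G] (α β : G → ℝ) : G → ℝ :=
  fun x => ∑ g : G, α g * β (g⁻¹ * x)

noncomputable def convPow {G : Type*} [Group G] [Fintype G] (γ : G → ℝ) : ℕ → G → ℝ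
  | 0 => fun x => if x = 1 then 1 else 0
  | k + 1 => convolve (convPow γ k) γ

noncomputable def tvDist {Ω : Type*} [Fintype Ω] (p q : Ω → ℝ) : ℝ :=
  (∑ ω : Ω, |p ω - q ω|) / 2

noncomputable def unif (Ω : Type*) [Fintype Ω] : Ω → ℝ := fun _ => 1 / (Fintype.card Ω)

noncomputable def poissonTV (l m : ℝ) : ℝ :=
  (∑' k : ℕ, |Real.exp (-l) * l ^ k / (Nat.factorial k) - Real.exp (-m) * m ^ k / (Nat.factorial k)|) / 2

noncomputable def Pmeas (n : ℕ) : alternatingGroup (Fin n) → ℝ := fun π =>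
  if (π : Equiv.Perm (Fin n)) = 1 then 1 / (2 * (n : ℝ) - 3)
  else if (π : Equiv.Perm (Fin n)).IsThreeCycle ∧
      (∀ x : Fin n, n - 2 ≤ (x : ℕ) → x ∈ (π : Equiv.Perm (Fin n)).support) then
    1 / (2 * (n : ℝ) - 3)
  else 0

namespace TT
open Equiv Finset

noncomputable def N {α : Type*} [DecidableEq α] (b : α) : ℕ → Finset α → Perm α → ℝ
  | 0, T, π => if T = ∅ ∧ π = 1 then 1 else 0
  | r + 1, T, π => ∑ i ∈ T, (N b r T (π * swap i b) + N b r (T.erase i) (π * swap i b))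

noncomputable def sj : ℕ → ℕ → ℝ
  | 0, m => if m = 0 then 1 else 0
  | r + 1, m => m * (sj r m + sj r (m - 1))

lemma N_nonneg {α : Type*} [DecidableEq α] (b : α) (r : ℕ) :
    ∀ (T : Finset α) (π : Perm α), 0 ≤ N b r T π := by
  induction r with
  | zero => intro T π; simp only [N]; split_ifs <;> norm_num
  | succ r ih => intro T π; simp only [N]; exact sum_nonneg fun i _ => add_nonneg (ih _ _) (ih _ _)

lemma sj_nonneg (r : ℕ) : ∀ m, 0 ≤ sj r m := by
  induction r with
  | zero => intro m; simp only [sj]; split_ifs <;> norm_num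
  | succ r ih => intro m; simp only [sj]; have := ih m; have := ih (m-1); positivity

lemma sum_N {α : Type*} [Fintype α] [DecidableEq α] (b : α) (r : ℕ) :
    ∀ (T : Finset α), ∑ π : Perm α, N b r T π = sj r T.card := by
  induction r with
  | zero =>
    intro T
    simp only [N, sj, card_eq_zero]
    by_cases h : T = ∅ <;> simp [h]
  | succ r ih =>
    intro T
    simp only [N, sj]
    rw [sum_comm]
    have : ∀ i ∈ T, ∑ π : Perm α, (N b r T (π * swap i b) + N b r (T.erase i) (π * swap i b))
        = sj r T.card + sj r (T.card - 1) := by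
      intro i hi
      have key : ∀ f : Perm α → ℝ, ∑ π, f (π * swap i b) = ∑ π, f π :=
        fun f => Equiv.sum_comp (Equiv.mulRight (swap i b)) f
      rw [sum_add_distrib, key (N b r T), key (N b r (T.erase i)), ih, ih, card_erase_of_mem hi]
    rw [sum_congr rfl this, sum_const, nsmul_eq_mul]

lemma sum_powerset_aux {α : Type*} [DecidableEq α] (X : Finset α) (f : Finset α → α → ℝ) :
    ∑ T ∈ X.powerset, ∑ i ∈ T, (f T i + f (T.erase i) i) = ∑ i ∈ X, ∑ T ∈ X.powerset, f T i := by
  have h1 : ∀ T ∈ X.powerset, ∑ i ∈ T, (f T i + f (T.erase i) i)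
      = ∑ i ∈ X, if i ∈ T then (f T i + f (T.erase i) i) else 0 := by
    intro T hT
    rw [← sum_filter, filter_mem_eq_inter, inter_eq_right.2 (mem_powerset.1 hT)]
  rw [sum_congr rfl h1, sum_comm]
  refine sum_congr rfl fun i hi => ?_
  obtain ⟨Y, hY, rfl⟩ : ∃ Y, i ∉ Y ∧ X = insert i Y := ⟨X.erase i, notMem_erase _ _, (insert_erase hi).symm⟩
  rw [sum_powerset_insert hY, sum_powerset_insert hY]
  have h2 : ∀ T ∈ Y.powerset, (if i ∈ T then (f T i + f (T.erase i) i) else 0) = 0 := by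
    intro T hT
    rw [if_neg fun h => hY (mem_powerset.1 hT h)]
  rw [sum_congr rfl h2, sum_const_zero, zero_add, ← sum_add_distrib]
  refine sum_congr rfl fun T hT => ?_
  have : i ∉ T := fun h => hY (mem_powerset.1 hT h)
  rw [if_pos (mem_insert_self _ _), erase_insert this, add_comm]

lemma sum_powerset_sj {α : Type*} [DecidableEq α] (X : Finset α) (r : ℕ) :
    ∑ T ∈ X.powerset, sj r T.card = (X.card : ℝ) ^ r := by
  induction r with
  | zero =>
    simp only [sj, card_eq_zero, pow_zero]
    rw [sum_ite_eq' ]; simp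
  | succ r ih =>
    have : ∀ T ∈ X.powerset, sj (r+1) T.card = ∑ i ∈ T, (sj r T.card + sj r (T.erase i).card) := by
      intro T _
      rw [sum_congr rfl (g := fun _ => sj r T.card + sj r (T.card - 1))
        (fun i hi => by rw [card_erase_of_mem hi]), sum_const, nsmul_eq_mul, sj]
    rw [sum_congr rfl this, sum_powerset_aux X (fun T _ => sj r T.card), sum_congr rfl (fun _ _ => ih),
      sum_const, nsmul_eq_mul, pow_succ]; ring

noncomputable def J {α : Type*} [DecidableEq α] (b : α) (X : Finset α) : MonoidAlgebra ℝ (Perm α) :=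
  ∑ i ∈ X, MonoidAlgebra.single (swap i b) 1

lemma coeff_J_pow {α : Type*} [DecidableEq α] (b : α) (X : Finset α) (r : ℕ) :
    ∀ π, (J b X ^ r).coeff π = ∑ T ∈ X.powerset, N b r T π := by
  induction r with
  | zero =>
    intro π
    simp only [pow_zero, N, ite_and, MonoidAlgebra.one_def]
    rw [sum_ite_eq']
    simp [Finsupp.single_apply, eq_comm]
  | succ r ih =>
    intro π
    simp only [N]
    rw [sum_powerset_aux X (fun T i => N b r T (π * swap i b)), pow_succ]
    conv_lhs => rw [J, mul_sum]
    simp only [MonoidAlgebra.coeff_sum, Finsupp.finsetSum_apply, MonoidAlgebra.coeff_mul_single_apply, mul_one, swap_inv]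
    exact sum_congr rfl fun i _ => ih _

/-- support condition -/
lemma N_eq_zero {α : Type*} [DecidableEq α] (b : α) (r : ℕ) :
    ∀ (T : Finset α) (π : Perm α) (x : α), x ∉ insert b T → π x ≠ x → N b r T π = 0 := by
  induction r with
  | zero =>
    intro T π x hx hp
    simp only [N]
    rw [if_neg]; rintro ⟨-, rfl⟩; exact hp rfl
  | succ r ih =>
    intro T π x hx hp
    simp only [N]
    refine sum_eq_zero fun i hi => ?_
    have hxi : x ≠ i := by rintro rfl; exact hx (mem_insert_of_mem hi)
    have hxb : x ≠ b := by rintro rfl; exact hx (mem_insert_self _ _)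
    have h : (π * swap i b) x ≠ x := by rw [Perm.mul_apply, swap_apply_of_ne_of_ne hxi hxb]; exact hp
    rw [ih T _ x hx h, ih (T.erase i) _ x (fun h => hx (by
      rw [mem_insert] at h ⊢; exact h.imp id (mem_of_mem_erase))) h, add_zero]

end TT

namespace TT
open Equiv Finset Polynomial

section
variable {α : Type*} [Fintype α] [DecidableEq α]

noncomputable def K (s : Finset α) (π : Perm α) : Matrix α α ℝ :=
  Matrix.of fun i j => if i ∈ s ∧ π i = j then 1 else 0

noncomputable def D (s : Finset α) (π : Perm α) : ℝ[X] :=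
  (1 + (X : ℝ[X]) • (-(K s π)).map C).det

lemma eval_D (s : Finset α) (π : Perm α) (q : ℝ) : (D s π).eval q = (1 - q • K s π).det := by
  rw [D, ← Polynomial.coe_evalRingHom, RingHom.map_det]
  congr 1
  ext i j
  simp [Matrix.one_apply, sub_eq_add_neg]
  split_ifs <;> simp [mul_comm]

lemma K_mul_apply (s : Finset α) (π : Perm α) (M : Matrix α α ℝ) (i j : α) :
    (K s π * M) i j = if i ∈ s then M (π i) j else 0 := by
  rw [Matrix.mul_apply]
  simp only [K, Matrix.of_apply, ite_and, ite_mul, one_mul, zero_mul]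
  split_ifs with h
  · simp
  · simp

lemma mul_K_apply (s : Finset α) (π : Perm α) (M : Matrix α α ℝ) (i j : α) (hj : j ∈ s) :
    (M * K s π) i (π j) = M i j := by
  rw [Matrix.mul_apply, Finset.sum_eq_single j]
  · simp [K, hj]
  · intro k _ hk
    simp [K, hk]
  · simp

lemma K_swap (s : Finset α) (π : Perm α) {i b : α} (hi : i ∈ s) (hb : b ∈ s) :
    K s (π * swap i b) = K s π - Matrix.replicateCol Unit (Pi.single i 1 - Pi.single b 1 : α → ℝ) *
      Matrix.replicateRow Unit (fun y => K s π i y - K s π b y) := by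
  ext x y
  rw [Matrix.sub_apply, Matrix.mul_apply]
  simp only [univ_unique, sum_singleton, Matrix.replicateCol_apply, Matrix.replicateRow_apply, Pi.sub_apply]
  by_cases hxi : x = i
  · subst hxi
    by_cases hxb : x = b
    · subst hxb; simp [K]
    · simp [K, hi, hb, Pi.single_apply, hxb]
  · by_cases hxb : x = b
    · subst hxb
      simp [K, hi, hb, Pi.single_apply, hxi]
    · simp [K, Pi.single_apply, hxi, hxb, swap_apply_of_ne_of_ne hxi hxb]

/-- the resolvent facts -/
lemma det_swap (s : Finset α) (π : Perm α) {i b : α} (hi : i ∈ s) (hb : b ∈ s) (q : ℝ)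
    (h : IsUnit (1 - q • K s π).det) (R : Matrix α α ℝ) (hR : R = K s π * (1 - q • K s π)⁻¹) :
    (1 - q • K s (π * swap i b)).det
      = (1 - q • K s π).det * (1 + q * (R i i + R b b - R i b - R b i)) := by
  have e : 1 - q • K s (π * swap i b) = (1 - q • K s π) +
      Matrix.replicateCol Unit (q • (Pi.single i 1 - Pi.single b 1 : α → ℝ)) *
      Matrix.replicateRow Unit (fun y => K s π i y - K s π b y) := by
    rw [K_swap s π hi hb]
    ext x y
    simp only [Matrix.add_apply, Matrix.sub_apply, Matrix.smul_apply, Matrix.mul_apply, univ_unique, sum_singleton,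
      Matrix.replicateCol_apply, Matrix.replicateRow_apply, Pi.sub_apply, Pi.smul_apply, smul_eq_mul]
    ring
  rw [e, Matrix.det_add_replicateCol_mul_replicateRow h]
  congr 1
  rw [Matrix.det_unique]
  have hrow : Matrix.replicateRow Unit (fun y => K s π i y - K s π b y) * (1 - q • K s π)⁻¹
      = Matrix.replicateRow Unit (fun y => R i y - R b y) := by
    ext u x
    rw [hR, Matrix.mul_apply]
    simp only [Matrix.replicateRow_apply, Pi.sub_apply, Matrix.mul_apply, sub_mul, sum_sub_distrib]
  rw [hrow, Matrix.add_apply, Matrix.one_apply_eq, Matrix.mul_apply]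
  congr 1
  simp only [Matrix.replicateRow_apply, Matrix.replicateCol_apply, Pi.sub_apply, Pi.smul_apply, smul_eq_mul,
    Pi.single_apply]
  have : ∀ x, (R i x - R b x) * (q * ((if x = i then (1:ℝ) else 0) - if x = b then 1 else 0))
     = q * ((if x = i then (R i x - R b x) else 0) - (if x = b then (R i x - R b x) else 0)) := by
    intro x; split_ifs <;> ring
  simp only [this]
  rw [← mul_sum, sum_sub_distrib]
  simp
  left; ring

lemma deriv_D (s : Finset α) (π : Perm α) (q : ℝ)
    (h : IsUnit (1 - q • K s π).det) (R : Matrix α α ℝ) (hR : R = K s π * (1 - q • K s π)⁻¹) :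
    (D s π).derivative.eval q = - (D s π).eval q * R.trace := by
  have key : (D s π).comp (X + C q) = C ((D s π).eval q) * (1 + (X : ℝ[X]) • (-R).map C).det := by
    apply Polynomial.funext
    intro x
    have e2 : ((1 + (X : ℝ[X]) • (-R).map C).det).eval x = (1 - x • R).det := by
      rw [← Polynomial.coe_evalRingHom, RingHom.map_det]
      congr 1
      ext i j
      simp [Matrix.one_apply, sub_eq_add_neg]
      split_ifs <;> simp [mul_comm]
    rw [eval_comp, eval_mul, eval_C, e2, eval_D, eval_D, mul_comm, ← Matrix.det_mul]
    congr 1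
    rw [sub_mul, one_mul, smul_mul_assoc, hR, mul_assoc, Matrix.nonsing_inv_mul _ h]
    simp [add_smul]; abel
  have := congrArg (fun p => (derivative p).eval 0) key
  simp only [derivative_comp, derivative_mul, derivative_C, zero_mul, zero_add, eval_mul, eval_C,
    Matrix.derivative_det_one_add_X_smul, eval_comp] at this
  simp only [derivative_add, derivative_X, derivative_C, eval_add, eval_X, eval_C, add_zero, zero_add, eval_one, one_mul, mul_one] at this
  rw [this, Matrix.trace_neg]; ring
end
end TT

namespace TT
open Equiv Finset Polynomial

section
variable {α : Type*} [Fintype α] [DecidableEq α]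

lemma resolvent (s : Finset α) (π : Perm α) {b : α} (hb : b ∈ s) (hπ : ∀ x, x ∉ s → π x = x) (q : ℝ)
    (h : IsUnit (1 - q • K s π).det) (R : Matrix α α ℝ) (hR : R = K s π * (1 - q • K s π)⁻¹) :
    (1 - q) * ∑ i ∈ s, R b i = 1 ∧ (1 - q) * ∑ i ∈ s, R i b = 1 ∧ R.trace = ∑ i ∈ s, R i i ∧
    (π b ≠ b → 1 + q * (R (π b) (π b) + R b b - R (π b) b - R b (π b)) = (1 - q) * (1 - (1 - q) * R b b)) ∧
    (π b = b → (1 - q) * R b b = 1) := by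
  have hs : ∀ x, π x ∈ s ↔ x ∈ s := by
    intro x
    constructor
    · intro hx
      by_contra hc
      rw [hπ x hc] at hx; exact hc hx
    · intro hx
      by_contra hc
      have := hπ _ hc
      rw [π.injective this] at hc; exact hc hx
  set S := (1 - q • K s π)⁻¹ with hS
  have h1 : (1 - q • K s π) * S = 1 := Matrix.mul_nonsing_inv _ h
  have h2 : S * (1 - q • K s π) = 1 := Matrix.nonsing_inv_mul _ h
  have hSR : S = 1 + q • R := by
    rw [sub_mul, one_mul, smul_mul_assoc, ← hR] at h1
    rw [← h1]; abel
  have hcomm : K s π * S = S * K s π := by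
    calc K s π * S = S * (1 - q • K s π) * (K s π * S) := by rw [h2, one_mul]
      _ = S * K s π * ((1 - q • K s π) * S) := by
        simp only [mul_sub, sub_mul, mul_one, one_mul, smul_mul_assoc, mul_smul_comm, mul_assoc]
      _ = _ := by rw [h1, mul_one]
  have hR' : R = S * K s π := by rw [hR, hcomm]
  have r1 : ∀ i ∈ s, ∀ x, R i x = S (π i) x := by
    intro i hi x; rw [hR, K_mul_apply, if_pos hi]
  have r2 : ∀ i ∈ s, ∀ x, R x (π i) = S x i := by
    intro i hi x; rw [hR', mul_K_apply s π S x i hi]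
  have r3 : ∀ i, i ∉ s → ∀ x, R i x = 0 := by
    intro i hi x; rw [hR, K_mul_apply, if_neg hi]
  have hSe : ∀ x y, S x y = (if x = y then 1 else 0) + q * R x y := by
    intro x y; rw [hSR]; simp [Matrix.one_apply]
  have perm : ∀ f : α → ℝ, ∑ i ∈ s, f (π i) = ∑ i ∈ s, f i := by
    intro f
    apply Finset.sum_equiv π
    · intro i; exact (hs i).symm
    · intros; rfl
  refine ⟨?_, ?_, ?_, ?_, ?_⟩
  · have : ∑ i ∈ s, R b i = 1 + q * ∑ i ∈ s, R b i := by
      calc ∑ i ∈ s, R b i = ∑ i ∈ s, R b (π i) := (perm (fun i => R b i)).symm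
        _ = ∑ i ∈ s, ((if b = i then 1 else 0) + q * R b i) :=
            sum_congr rfl fun i hi => by rw [r2 i hi, hSe]
        _ = _ := by rw [sum_add_distrib, sum_ite_eq, if_pos hb, mul_sum]
    linarith
  · have : ∑ i ∈ s, R i b = 1 + q * ∑ i ∈ s, R i b := by
      calc ∑ i ∈ s, R i b = ∑ i ∈ s, ((if π i = b then 1 else 0) + q * R (π i) b) :=
            sum_congr rfl fun i hi => by rw [r1 i hi, hSe]
        _ = ∑ i ∈ s, ((if i = b then 1 else 0) + q * R i b) :=
            perm (fun i => ((if i = b then 1 else 0) + q * R i b))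
        _ = _ := by rw [sum_add_distrib, sum_ite_eq', if_pos hb, mul_sum]
    linarith
  · rw [Matrix.trace]
    symm
    apply sum_subset (subset_univ _)
    intro x _ hx
    exact r3 x hx x
  · intro hne
    have a1 := r2 b hb b
    have a2 := r2 b hb (π b)
    have a3 := r1 b hb b
    rw [hSe] at a1 a2 a3
    rw [if_pos rfl] at a1
    rw [if_neg hne] at a2 a3
    rw [a1, a2]
    linear_combination (1 - q) * a3
  · intro he
    have a1 := r2 b hb b
    rw [hSe, he, if_pos rfl] at a1
    linarith

lemma D_erase (s : Finset α) (σ : Perm α) {i : α} (hi : i ∈ s) (hσ : σ i = i) (q : ℝ) :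
    (D s σ).eval q = (1 - q) * (D (s.erase i) σ).eval q := by
  rw [eval_D, eval_D]
  set M := 1 - q • K (s.erase i) σ with hM
  have hMi : ∀ j, M i j = if i = j then 1 else 0 := by
    intro j; simp [hM, K, Matrix.one_apply]
  have : 1 - q • K s σ = M.updateRow i ((1 - q) • M.row i) := by
    ext x y
    rw [Matrix.updateRow_apply]
    split_ifs with hx
    · subst hx
      simp only [Pi.smul_apply, Matrix.row, hMi, smul_eq_mul]
      simp [K, hi, hσ, Matrix.one_apply]
      split_ifs <;> simp
    · simp [hM, K, hx]
  rw [this, Matrix.det_updateRow_smul]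
  congr 2
  ext x y
  rw [Matrix.updateRow_apply]
  split_ifs with hx
  · subst hx; rfl
  · rfl

noncomputable def F (b : α) (T : Finset α) (π : Perm α) : ℝ[X] :=
  if T = ∅ then 1 else (1 - X) ^ (T.card - 1) * D (insert b T) π

lemma D_ne_zero (s : Finset α) (π : Perm α) : D s π ≠ 0 := by
  intro h
  have := eval_D s π 0
  rw [h] at this; simp at this

lemma F_eval (b : α) (T : Finset α) (π : Perm α) (hπ : ∀ x, x ∉ insert b T → π x = x) (q : ℝ) (hq : q ≠ 1) :
    (F b T π).eval q = (1 - q) ^ T.card * (D (insert b T) π).eval q / (1 - q) := by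
  have hq' : 1 - q ≠ 0 := sub_ne_zero.2 hq.symm
  rw [F]
  split_ifs with h
  · subst h
    have : π b = b := by
      have hs : ∀ x, x ≠ b → π x = x := fun x hx => hπ x (by simpa using hx)
      by_contra hc
      have h2 := hs _ hc
      exact hc (π.injective h2)
    rw [D_erase _ π (mem_insert_self b ∅) this, eval_D]
    have : K ((insert b (∅ : Finset α)).erase b) π = 0 := by
      ext x y; simp [K]
    rw [this]; simp; field_simp
  · obtain ⟨m, hm⟩ := Nat.exists_eq_succ_of_ne_zero (card_ne_zero.2 (nonempty_iff_ne_empty.2 h))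
    rw [hm]; simp; field_simp; ring

lemma F_identity (b : α) (T : Finset α) (π : Perm α) (hbT : b ∉ T) (hT : T ≠ ∅)
    (hπ : ∀ x, x ∉ insert b T → π x = x) :
    C (T.card : ℝ) * F b T π - X * derivative (F b T π) =
      ∑ i ∈ T, F b T (π * swap i b) + C ((T.card : ℝ) + 1) * X *
        (if π b = b then 0 else F b (T.erase (π b)) (π * swap (π b) b)) := by
  apply Polynomial.eq_of_infinite_eval_eq
  have hfin : ({1} ∪ {q | (D (insert b T) π).eval q = 0} : Set ℝ).Finite :=
    (Set.finite_singleton _).union (Polynomial.finite_setOfPred_isRoot (D_ne_zero _ _))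
  refine (hfin.infinite_compl).mono ?_
  intro q hq
  simp only [Set.mem_compl_iff, Set.mem_union, Set.mem_singleton_iff, Set.mem_ofPred_eq, not_or] at hq
  obtain ⟨hq1, hD⟩ := hq
  have hq' : 1 - q ≠ 0 := sub_ne_zero.2 (Ne.symm hq1)
  have hu : IsUnit (1 - q • K (insert b T) π).det := by
    rw [← eval_D]; exact isUnit_iff_ne_zero.2 hD
  set s := insert b T with hs
  have hb : b ∈ s := mem_insert_self _ _
  obtain ⟨h1, h2, h3, h4, h5⟩ := resolvent s π hb hπ q hu _ rfl
  have hdet := fun i (hi : i ∈ s) => det_swap s π hi hb q hu _ rfl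
  have hder := deriv_D s π q hu _ rfl
  set R := K s π * (1 - q • K s π)⁻¹ with hR
  set d := (D s π).eval q with hd
  simp only [← eval_D] at hdet
  rw [← hd] at hdet
  obtain ⟨m, hm⟩ := Nat.exists_eq_succ_of_ne_zero (card_ne_zero.2 (nonempty_iff_ne_empty.2 hT))
  have hsw : ∀ i ∈ T, ∀ x, x ∉ s → (π * swap i b) x = x := by
    intro i hi x hx
    have hxi : x ≠ i := by rintro rfl; exact hx (mem_insert_of_mem hi)
    have hxb : x ≠ b := by rintro rfl; exact hx hb
    rw [Perm.mul_apply, swap_apply_of_ne_of_ne hxi hxb, hπ x hx]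
  -- first sum
  have hsum : ∑ i ∈ T, (1 + q * (R i i + R b b - R i b - R b i))
      = T.card + q * (R.trace + (T.card + 1) * R b b - 2 / (1 - q)) := by
    rw [hs, sum_insert hbT] at h1 h2 h3
    have e1 : ∑ i ∈ T, R b i = 1 / (1 - q) - R b b := by field_simp; linarith
    have e2 : ∑ i ∈ T, R i b = 1 / (1 - q) - R b b := by field_simp; linarith
    rw [h3, sum_add_distrib, ← mul_sum, sum_sub_distrib, sum_sub_distrib, sum_add_distrib, e1, e2]
    simp; left; ring
  have hsumF : eval q (∑ i ∈ T, F b T (π * swap i b))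
      = (1 - q) ^ m * d * (T.card + q * (R.trace + (T.card + 1) * R b b - 2 / (1 - q))) := by
    rw [eval_finsetSum, ← hsum, mul_sum]
    refine sum_congr rfl fun i hi => ?_
    rw [F_eval b T _ (hsw i hi) q hq1, ← hs, hdet i (mem_insert_of_mem hi), hm]
    field_simp
    rw [pow_succ]; ring
  have hlast : (1 - q) * eval q (if π b = b then 0 else F b (T.erase (π b)) (π * swap (π b) b))
      = (1 - q) ^ m * d * (1 - (1 - q) * R b b) := by
    split_ifs with hpb
    · rw [h5 hpb]; simp
    · have hpT : π b ∈ T := by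
        have : π b ∈ s := by
          by_contra hc
          exact hpb (π.injective (hπ _ hc))
        rw [hs, mem_insert] at this; exact this.resolve_left hpb
      have hfix : (π * swap (π b) b) (π b) = π b := by simp
      have hers : insert b (T.erase (π b)) = s.erase (π b) := by
        rw [hs, erase_insert_of_ne (Ne.symm hpb)]
      rw [F_eval b _ _ _ q hq1, hers]
      · have e := D_erase s (π * swap (π b) b) (mem_insert_of_mem hpT) hfix q
        rw [hdet _ (mem_insert_of_mem hpT), h4 hpb] at e
        have e' : eval q (D (s.erase (π b)) (π * swap (π b) b)) = d * (1 - (1 - q) * R b b) := by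
          apply mul_left_cancel₀ hq'
          rw [← e]; ring
        rw [e', card_erase_of_mem hpT, hm]
        simp; field_simp
      · intro x hx
        rw [hers, mem_erase, not_and_or, not_not] at hx
        rcases hx with rfl | hx
        · exact hfix
        · exact hsw _ hpT x hx
  have hF : F b T π = (1 - X) ^ m * D s π := by
    rw [F, if_neg hT, hm]; simp [hs]
  have hlhs : eval q (C (T.card : ℝ) * F b T π - X * derivative (F b T π)) =
     (1 - q) ^ m * d * (T.card + m * q / (1 - q) + q * R.trace) := by
    rw [hF]
    simp only [eval_sub, eval_mul, eval_C, eval_X, derivative_mul, derivative_pow, eval_add, derivative_sub, derivative_one,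
      derivative_X, eval_pow, eval_one, zero_sub, eval_neg, hder, ← hd]
    rcases m with _ | k
    · simp; ring
    · simp; field_simp; ring
  have hlast' : eval q (if π b = b then 0 else F b (T.erase (π b)) (π * swap (π b) b))
      = (1 - q) ^ m * d * (1 - (1 - q) * R b b) / (1 - q) := by
    rw [eq_div_iff hq', ← hlast]; ring
  simp only [Set.mem_ofPred_eq]
  rw [hlhs, eval_add, hsumF, eval_mul, hlast']
  simp only [eval_mul, eval_C, eval_X]
  rw [hm]; push_cast
  field_simp
  ring
end
end TT

namespace TT
open Equiv Finset Polynomial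

noncomputable def th (m : ℝ) : Module.End ℝ ℝ[X] :=
  m • LinearMap.id - (LinearMap.mulLeft ℝ (X : ℝ[X])).comp derivative

lemma th_apply (m : ℝ) (f : ℝ[X]) : th m f = C m * f - X * derivative f := by
  simp [th, smul_eq_C_mul]

lemma th_X_mul (m : ℝ) (f : ℝ[X]) : th m (X * f) = X * th (m - 1) f := by
  simp only [th_apply, derivative_mul, derivative_X, map_sub, map_one]; ring

lemma th_pow_X_mul (m : ℝ) (r : ℕ) (f : ℝ[X]) : (th m ^ r) (X * f) = X * (th (m - 1) ^ r) f := by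
  induction r generalizing f with
  | zero => simp
  | succ r ih => rw [pow_succ, pow_succ, Module.End.mul_apply, th_X_mul, ih, Module.End.mul_apply]

lemma th_pow_one (m : ℝ) (r : ℕ) : (th m ^ r) 1 = C (m ^ r) := by
  have h1 : ∀ x : ℝ, th m (C x) = C (m * x) := by
    intro x; simp [th_apply]
  induction r with
  | zero => simp
  | succ r ih => rw [pow_succ', Module.End.mul_apply, ih, h1, pow_succ']

lemma th_pow_X_pow (k : ℕ) (r : ℕ) (m : ℝ) : (th m ^ r) (X ^ k) = C ((m - k) ^ r) * X ^ k := by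
  induction k generalizing m with
  | zero => simp [th_pow_one]
  | succ k ih =>
    rw [pow_succ', th_pow_X_mul, ih]
    push_cast
    rw [show m - 1 - (k : ℝ) = m - (k + 1) by ring]; ring

section
set_option linter.unusedSectionVars false
variable {α : Type*} [Fintype α] [DecidableEq α]

lemma det_one_sub_K (s : Finset α) (π : Perm α) (hs : s.Nonempty) (hπ : ∀ x, x ∉ s → π x = x) :
    (1 - K s π).det = 0 := by
  apply Matrix.exists_mulVec_eq_zero_iff.1
  refine ⟨fun x => if x ∈ s then 1 else 0, ?_, ?_⟩
  · intro h
    obtain ⟨x, hx⟩ := hs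
    have := congrFun h x
    simp [hx] at this
  · ext x
    rw [Matrix.sub_mulVec, Matrix.one_mulVec]
    by_cases hx : x ∈ s
    · have hpx : π x ∈ s := by
        by_contra hc
        have := hπ _ hc
        rw [π.injective this] at hc; exact hc hx
      simp [hx, Matrix.mulVec, dotProduct, K, hpx]
    · simp [hx, Matrix.mulVec, dotProduct, K]

theorem N_formula (b : α) (r : ℕ) : ∀ (T : Finset α) (π : Perm α), b ∉ T →
    (∀ x, x ∉ insert b T → π x = x) →
    ((T.card + 1).factorial : ℝ) * N b r T π = eval 1 ((th T.card ^ r) (F b T π)) := by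
  induction r with
  | zero =>
    intro T π hb hπ
    simp only [N, pow_zero, Module.End.one_apply]
    by_cases hT : T = ∅
    · subst hT
      have hs : ∀ x, x ≠ b → π x = x := fun x hx => hπ x (by simpa using hx)
      have hp1 : π = 1 := by
        ext x
        by_cases hx : x = b
        · subst hx
          by_contra hc
          have h2 := hs _ hc
          exact hc (π.injective h2)
        · simp [hs x hx]
      simp [F, hp1]
    · rw [if_neg (fun h => hT h.1), F, if_neg hT]
      simp only [eval_mul, eval_D, one_smul]
      rw [det_one_sub_K _ _ (insert_nonempty _ _) hπ]; simp
  | succ r ih =>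
    intro T π hb hπ
    by_cases hT : T = ∅
    · subst hT
      simp [N, F, pow_succ, th_apply]
    rw [pow_succ, Module.End.mul_apply, th_apply, F_identity b T π hb hT hπ, map_add, map_sum, eval_add, eval_finsetSum]
    have hsw : ∀ i ∈ T, ∀ x, x ∉ insert b T → (π * swap i b) x = x := by
      intro i hi x hx
      have hxi : x ≠ i := by rintro rfl; exact hx (mem_insert_of_mem hi)
      have hxb : x ≠ b := by rintro rfl; exact hx (mem_insert_self _ _)
      rw [Perm.mul_apply, swap_apply_of_ne_of_ne hxi hxb, hπ x hx]
    simp only [N]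
    rw [sum_add_distrib, mul_add, mul_sum]
    congr 1
    · exact sum_congr rfl fun i hi => ih T _ hb (hsw i hi)
    · rw [← smul_eq_C_mul, smul_mul_assoc, map_smul, th_pow_X_mul, eval_smul, eval_mul, eval_X, one_mul]
      have hz : ∀ i ∈ T, i ≠ π b → N b r (T.erase i) (π * swap i b) = 0 := by
        intro i hi hne
        apply N_eq_zero b r _ _ i
        · simp; rintro rfl; exact hb hi
        · simpa using hne.symm
      by_cases hpb : π b = b
      · rw [if_pos hpb, sum_eq_zero]
        · simp
        · intro i hi
          apply hz i hi
          rw [hpb]; rintro rfl; exact hb hi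
      · have hpT : π b ∈ T := by
          by_contra hc
          exact hpb (π.injective (hπ _ (by simp [hc, hpb])))
        rw [if_neg hpb, sum_eq_single_of_mem _ hpT (fun i hi hne => hz i hi hne)]
        have := ih (T.erase (π b)) (π * swap (π b) b) (fun h => hb (mem_of_mem_erase h)) (by
          intro x hx
          by_cases hx2 : x = π b
          · simp [hx2]
          · apply hsw _ hpT
            simp only [mem_insert, mem_erase, not_or, not_and] at hx ⊢
            exact ⟨hx.1, hx.2 hx2⟩)
        obtain ⟨m, hm⟩ := Nat.exists_eq_succ_of_ne_zero (card_ne_zero.2 (nonempty_iff_ne_empty.2 hT))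
        rw [card_erase_of_mem hpT, hm] at this
        rw [hm]
        simp only [Nat.succ_eq_add_one, Nat.add_sub_cancel] at this
        push_cast at this ⊢
        rw [show (m : ℝ) + 1 - 1 = m by ring, ← this, Nat.factorial_succ]
        push_cast; simp only [smul_eq_mul]; ring

noncomputable def mn (s : Finset α) (π : Perm α) (S : Finset α) : ℝ :=
  ((-(K s π)).submatrix (Subtype.val : S → α) (Subtype.val : S → α)).det

lemma D_eq (s : Finset α) (π : Perm α) : D s π = ∑ S : Finset α, C (mn s π S) * X ^ S.card := by
  ext k
  rw [D, Matrix.coeff_det_one_add_X_smul_eq_sum_minors, finsetSum_coeff]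
  simp only [coeff_C_mul, coeff_X_pow, mul_ite, mul_one, mul_zero]
  rw [← sum_filter]
  apply sum_congr
  · ext S; simp [mem_powersetCard, eq_comm]
  · intros; rfl

lemma mn_empty (s : Finset α) (π : Perm α) : mn s π ∅ = 1 := by
  simp [mn]

lemma mn_eq_zero (s : Finset α) (π : Perm α) (S : Finset α) (x : α) (hx : x ∈ S) (h : x ∉ s ∨ π x ∉ S) :
    mn s π S = 0 := by
  apply Matrix.det_eq_zero_of_row_eq_zero ⟨x, hx⟩
  intro j
  simp only [Matrix.submatrix_apply, Matrix.neg_apply, K, Matrix.of_apply]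
  rw [if_neg]; simp
  rintro ⟨h1, h2⟩
  rcases h with h | h
  · exact h h1
  · rw [h2] at h; exact h j.2

lemma mn_eq (s : Finset α) (π : Perm α) (S : Finset α) (hS : S ⊆ s) (h : ∀ x, x ∈ S ↔ π x ∈ S) :
    mn s π S = (-1) ^ S.card * (Perm.sign (π.subtypePerm (fun x => (h x).symm)) : ℤ) := by
  rw [mn]
  have : ((-(K s π)).submatrix (Subtype.val : S → α) (Subtype.val : S → α)) =
     - (π.subtypePerm (p := (· ∈ S)) (fun x => (h x).symm)).permMatrix ℝ := by
    ext i j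
    have hi := hS i.2
    simp [K, Equiv.Perm.permMatrix, hi, PEquiv.toMatrix_apply, Subtype.ext_iff, eq_comm]
  rw [this, Matrix.det_neg, Matrix.det_permutation]
  simp

lemma abs_mn_le (s : Finset α) (π : Perm α) (S : Finset α) :
    |mn s π S| ≤ if S ⊆ s ∧ ∀ x ∈ S, π x ∈ S then 1 else 0 := by
  split_ifs with h
  · have h2 : ∀ x, x ∈ S ↔ π x ∈ S := by
      intro x
      refine ⟨h.2 x, fun hx => ?_⟩
      have : S.image π = S := eq_of_subset_of_card_le (by
        intro y hy; obtain ⟨z, hz, rfl⟩ := mem_image.1 hy; exact h.2 z hz)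
        (by rw [card_image_of_injective _ π.injective])
      rw [← this] at hx
      obtain ⟨z, hz, hzx⟩ := mem_image.1 hx
      rw [← π.injective hzx]; exact hz
    rw [mn_eq s π S h.1 h2, abs_mul, abs_pow]
    simp only [abs_neg, abs_one, one_pow, one_mul]
    rcases Int.units_eq_one_or (Perm.sign (π.subtypePerm (p := (· ∈ S)) (fun x => (h2 x).symm))) with h3 | h3 <;> rw [h3] <;> simp
  · simp only [not_and_or, not_forall] at h
    have : mn s π S = 0 := by
      rcases h with h | ⟨x, hx, hx2⟩
      · obtain ⟨x, hx, hx2⟩ := not_subset.1 h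
        exact mn_eq_zero s π S x hx (Or.inl hx2)
      · exact mn_eq_zero s π S x hx (Or.inr hx2)
    simp [this]

lemma mn_self (s : Finset α) (π : Perm α) (hπ : ∀ x, x ∉ s → π x = x) :
    mn s π s = (-1) ^ s.card * (Perm.sign π : ℤ) := by
  have hs : ∀ x, x ∈ s ↔ π x ∈ s := by
    intro x
    constructor
    · intro hx
      by_contra hc
      have := hπ _ hc
      rw [π.injective this] at hc; exact hc hx
    · intro hx
      by_contra hc
      rw [hπ x hc] at hx; exact hc hx
  have key := Perm.sign_subtypePerm (p := (· ∈ s)) π (fun x => (hs x).symm) (by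
    intro x hx
    by_contra hc
    exact hx (hπ x hc))
  rw [mn_eq s π s subset_rfl hs, ← key]
  congr!

noncomputable def kap (r m k : ℕ) : ℝ :=
  ∑ j ∈ range m, (-1 : ℝ) ^ j * (m - 1).choose j * ((m : ℝ) - k - j) ^ r

lemma kap_eq (r m k : ℕ) (hm : 0 < m) : eval 1 ((th m ^ r) ((1 - X) ^ (m - 1) * X ^ k)) = kap r m k := by
  obtain ⟨M, rfl⟩ := Nat.exists_eq_succ_of_ne_zero hm.ne'
  have : ((1 : ℝ[X]) - X) ^ M * X ^ k = ∑ j ∈ range (M + 1), ((-1 : ℝ) ^ j * M.choose j) • (X : ℝ[X]) ^ (k + j) := by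
    rw [show (1 : ℝ[X]) - X = (-X) + 1 by ring, add_pow, sum_mul]
    refine sum_congr rfl fun j hj => ?_
    rw [smul_eq_C_mul, neg_pow, pow_add]; simp; ring
  rw [Nat.succ_eq_add_one, Nat.add_sub_cancel, this, map_sum, eval_finsetSum, kap]
  refine sum_congr rfl fun j hj => ?_
  rw [map_smul, th_pow_X_pow]
  simp
  left; congr 1; ring

lemma kap_refl (r m : ℕ) (hm : 0 < m) : (-1) ^ (m + 1) * kap r m (m + 1) = (-1) ^ r * kap r m 0 := by
  obtain ⟨M, rfl⟩ := Nat.exists_eq_succ_of_ne_zero hm.ne'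
  simp only [kap, Nat.succ_eq_add_one, Nat.add_sub_cancel]
  rw [← sum_range_reflect, mul_sum, mul_sum]
  refine sum_congr rfl fun j hj => ?_
  have hj' : j ≤ M := by simpa [Nat.lt_succ_iff] using hj
  have h1 : M + 1 - 1 - j = M - j := by omega
  rw [h1, Nat.choose_symm hj']
  push_cast [Nat.cast_sub hj']
  have h2 : (-1 : ℝ) ^ M = (-1) ^ (M - j) * (-1) ^ j := by rw [← pow_add]; congr 1; omega
  have h3 : ((M : ℝ) + 1 - (M + 1 + 1) - (M - j)) = (-1) * (M + 1 - 0 - j) := by ring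
  have h4 : ((-1 : ℝ) ^ j * (-1) ^ j) = 1 := by rw [← mul_pow]; simp
  have h5 : ((-1 : ℝ) ^ (M - j) * (-1) ^ (M - j)) = 1 := by rw [← mul_pow]; simp
  rw [h3, mul_pow, show M + 1 + 1 = M + 2 by ring, pow_add, h2]
  linear_combination (-1 : ℝ) ^ r * (M + 1 - 0 - j : ℝ) ^ r * (M.choose j : ℝ) * (-1) ^ j * h5

theorem N_sum (b : α) (r : ℕ) (T : Finset α) (π : Perm α) (hb : b ∉ T) (hT : T.Nonempty)
    (hπ : ∀ x, x ∉ insert b T → π x = x) :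
    ((T.card + 1).factorial : ℝ) * N b r T π = ∑ S : Finset α, mn (insert b T) π S * kap r T.card S.card := by
  rw [N_formula b r T π hb hπ, F, if_neg hT.ne_empty, D_eq, mul_sum, map_sum, eval_finsetSum]
  refine sum_congr rfl fun S _ => ?_
  rw [mul_left_comm, ← smul_eq_C_mul, map_smul, eval_smul, kap_eq r _ _ hT.card_pos, smul_eq_mul]
end
end TT

namespace TT
open Equiv Finset

section
set_option linter.unusedSectionVars false
variable {α : Type*} [Fintype α] [DecidableEq α]

noncomputable def Sy (s : Finset α) : Finset (Perm α) := univ.filter (fun π => ∀ x, x ∉ s → π x = x)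

lemma mem_Sy {s : Finset α} {π : Perm α} : π ∈ Sy s ↔ ∀ x, x ∉ s → π x = x := by simp [Sy]

lemma card_Sy (s : Finset α) : (Sy s).card = s.card.factorial := by
  have e := Fintype.card_congr (Equiv.Perm.subtypeEquivSubtypePerm (α := α) (fun x => x ∈ s))
  rw [Fintype.card_perm, Fintype.card_coe] at e
  rw [e, Fintype.card_subtype]; rfl

lemma Sy_mul {s : Finset α} {π σ : Perm α} (h1 : π ∈ Sy s) (h2 : σ ∈ Sy s) : π * σ ∈ Sy s := by
  rw [mem_Sy] at *
  intro x hx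
  rw [Perm.mul_apply, h2 x hx, h1 x hx]

lemma Sy_inv {s : Finset α} {π : Perm α} (h1 : π ∈ Sy s) : π⁻¹ ∈ Sy s := by
  rw [mem_Sy] at *
  intro x hx
  rw [Perm.inv_eq_iff_eq]; exact (h1 x hx).symm

lemma Sy_mono {s t : Finset α} (h : s ⊆ t) : Sy s ⊆ Sy t := by
  intro π hp
  rw [mem_Sy] at *
  exact fun x hx => hp x (fun h2 => hx (h h2))

lemma Sy_swap {s : Finset α} {x y : α} (hx : x ∈ s) (hy : y ∈ s) : swap x y ∈ Sy s := by
  rw [mem_Sy]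
  intro z hz
  apply swap_apply_of_ne_of_ne <;> (rintro rfl; contradiction)

lemma card_Sy_sign (s : Finset α) (hs : 2 ≤ s.card) (ε : ℤˣ) :
    2 * (((Sy s).filter (fun π => Perm.sign π = ε)).card : ℝ) = s.card.factorial := by
  obtain ⟨x, hx, y, hy, hxy⟩ := one_lt_card.1 hs
  have h1 : ((Sy s).filter (fun π => Perm.sign π = ε)).card = ((Sy s).filter (fun π => ¬ Perm.sign π = ε)).card := by
    apply card_bij (fun π _ => π * swap x y)
    · intro π hp
      rw [mem_filter] at *
      refine ⟨Sy_mul hp.1 (Sy_swap hx hy), ?_⟩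
      rw [map_mul, hp.2, Perm.sign_swap hxy]
      rcases Int.units_eq_one_or ε with h | h <;> rw [h] <;> decide
    · intro a _ b _ h; exact mul_right_cancel h
    · intro π hp
      rw [mem_filter] at hp
      refine ⟨π * swap x y, ?_, ?_⟩
      · rw [mem_filter]
        refine ⟨Sy_mul hp.1 (Sy_swap hx hy), ?_⟩
        rw [map_mul, Perm.sign_swap hxy]
        have := hp.2
        rcases Int.units_eq_one_or ε with h | h <;> rcases Int.units_eq_one_or (Perm.sign π) with h2 | h2 <;> rw [h, h2] at this <;> rw [h, h2] <;> first | rfl | exact absurd rfl this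
      · rw [mul_assoc, swap_mul_self, mul_one]
  have h2 := card_filter_add_card_filter_not (s := Sy s) (fun π => Perm.sign π = ε)
  rw [← h1, card_Sy] at h2
  rw [← h2]; push_cast; ring

noncomputable def Us (s : Finset α) (ε : ℤˣ) (π : Perm α) : ℝ :=
  if π ∈ Sy s ∧ Perm.sign π = ε then 2 / s.card.factorial else 0

lemma Us_nonneg (s : Finset α) (ε : ℤˣ) (π : Perm α) : 0 ≤ Us s ε π := by
  rw [Us]; split_ifs <;> positivity

lemma sum_Us (s : Finset α) (hs : 2 ≤ s.card) (ε : ℤˣ) : ∑ π, Us s ε π = 1 := by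
  simp only [Us]
  rw [← sum_filter, sum_const]
  have h := card_Sy_sign s hs ε
  have h2 : ((univ : Finset (Perm α)).filter (fun π => π ∈ Sy s ∧ Perm.sign π = ε)) = (Sy s).filter (fun π => Perm.sign π = ε) := by
    ext; simp
  have : (s.card.factorial : ℝ) ≠ 0 := by positivity
  rw [h2, nsmul_eq_mul, mul_div_assoc', mul_comm, h, div_self this]

lemma card_stab (s S : Finset α) (hS : S ⊆ s) :
    ((Sy s).filter (fun π => ∀ x ∈ S, π x ∈ S)).card ≤ S.card.factorial * (s.card - S.card).factorial := by
  rw [← card_Sy S, ← card_sdiff_of_subset hS, ← card_Sy (s \ S), ← card_product]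
  have : (Sy s).filter (fun π => ∀ x ∈ S, π x ∈ S) ⊆ (Sy S ×ˢ Sy (s \ S)).image (fun p => p.1 * p.2) := by
    intro π hp
    rw [mem_filter, mem_Sy] at hp
    obtain ⟨h0, h⟩ := hp
    have h2 : ∀ x, π x ∈ S ↔ x ∈ S := by
      intro x
      refine ⟨fun hx => ?_, h x⟩
      have : S.image π = S := eq_of_subset_of_card_le (by
        intro y hy; obtain ⟨z, hz, rfl⟩ := mem_image.1 hy; exact h z hz)
        (by rw [card_image_of_injective _ π.injective])
      rw [← this] at hx
      obtain ⟨z, hz, hzx⟩ := mem_image.1 hx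
      rw [← π.injective hzx]; exact hz
    set p1 := Perm.ofSubtype (π.subtypePerm (p := (· ∈ S)) h2) with hp1
    have h1a : ∀ x ∈ S, p1 x = π x := by
      intro x hx
      rw [hp1, Perm.ofSubtype_apply_of_mem _ hx]; rfl
    have h1b : ∀ x, x ∉ S → p1 x = x := by
      intro x hx
      rw [hp1, Perm.ofSubtype_apply_of_not_mem _ hx]
    rw [mem_image]
    refine ⟨(p1, p1⁻¹ * π), ?_, by simp⟩
    rw [mem_product, mem_Sy, mem_Sy]
    refine ⟨h1b, ?_⟩
    intro x hx
    simp only [Perm.mul_apply]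
    rw [Perm.inv_eq_iff_eq]
    by_cases hxS : x ∈ S
    · rw [h1a x hxS]
    · rw [h1b x hxS]
      apply h0
      simpa [hxS] using hx
  exact (card_le_card this).trans card_image_le

noncomputable def kerr (r m : ℕ) : ℝ := ∑ k ∈ Icc 1 m, |kap r m k|

lemma L1_aux (b : α) (r : ℕ) (T : Finset α) (hb : b ∉ T) (hT : T.Nonempty) :
    ∑ π, |N b r T π - kap r T.card 0 * Us (insert b T) ((-1) ^ r) π| ≤ kerr r T.card := by
  set s := insert b T with hs
  set m := T.card with hm
  have hsc : s.card = m + 1 := by rw [hs, card_insert_of_notMem hb]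
  have hmpos : 0 < m := hT.card_pos
  have hfac : (0 : ℝ) < (m + 1).factorial := by positivity
  set Q : Finset (Finset α) := s.powerset.filter (fun S => S ≠ ∅ ∧ S ≠ s) with hQ
  have h0 : ∀ π, π ∉ Sy s → N b r T π - kap r m 0 * Us s ((-1) ^ r) π = 0 := by
    intro π hp
    rw [Us, if_neg (fun h => hp h.1), mem_Sy] at *
    push Not at hp
    obtain ⟨x, hx, hx2⟩ := hp
    rw [N_eq_zero b r T π x hx hx2]; simp
  have h1 : ∀ π ∈ Sy s, ((m + 1).factorial : ℝ) * (N b r T π - kap r m 0 * Us s ((-1) ^ r) π)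
      = ∑ S ∈ Q, mn s π S * kap r m S.card := by
    intro π hp
    have hp' := mem_Sy.1 hp
    have e := N_sum b r T π hb hT hp'
    rw [← hs, ← hm] at e
    rw [mul_sub, e]
    have e2 : ∑ S : Finset α, mn s π S * kap r m S.card = ∑ S ∈ s.powerset, mn s π S * kap r m S.card := by
      symm
      apply sum_subset (subset_univ _)
      intro S _ hS
      rw [mem_powerset] at hS
      obtain ⟨x, hx, hx2⟩ := not_subset.1 hS
      rw [mn_eq_zero s π S x hx (Or.inl hx2), zero_mul]
    have e3 : s.powerset = insert ∅ (insert s Q) := by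
      ext S
      simp only [hQ, mem_insert, mem_filter, mem_powerset]
      constructor
      · intro h; by_cases h1 : S = ∅
        · exact Or.inl h1
        · by_cases h2 : S = s
          · exact Or.inr (Or.inl h2)
          · exact Or.inr (Or.inr ⟨h, h1, h2⟩)
      · rintro (rfl | rfl | h)
        · simp
        · exact subset_rfl
        · exact h.1
    have hsne : ∅ ≠ s := (insert_nonempty _ _).ne_empty.symm
    rw [e2, e3, sum_insert (by simp [hQ, hsne]), sum_insert (by simp [hQ]), mn_empty, mn_self s π hp', hsc, card_empty]
    have e4 := kap_refl r m hmpos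
    have e5 : ((m + 1).factorial : ℝ) * (kap r m 0 * Us s ((-1) ^ r) π) = kap r m 0 + (Perm.sign π : ℤ) * ((-1) ^ r * kap r m 0) := by
      rw [Us, hsc]
      rcases Int.units_eq_one_or (Perm.sign π) with h2 | h2 <;> rcases Nat.even_or_odd r with h3 | h3 <;>
        simp [h2, h3.neg_one_pow, hp] <;> field_simp <;> norm_num
    rw [e5, ← e4]; ring
  have h2 : ∀ π ∈ Sy s, |N b r T π - kap r m 0 * Us s ((-1) ^ r) π|
      ≤ (∑ S ∈ Q, (if ∀ x ∈ S, π x ∈ S then 1 else 0) * |kap r m S.card|) / (m + 1).factorial := by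
    intro π hp
    rw [le_div_iff₀ hfac, ← abs_of_pos hfac, ← abs_mul, mul_comm, h1 π hp]
    refine (abs_sum_le_sum_abs _ _).trans (sum_le_sum fun S hS => ?_)
    rw [abs_mul]
    refine mul_le_mul_of_nonneg_right ((abs_mn_le s π S).trans ?_) (abs_nonneg _)
    split_ifs with h3 h4 <;> first | (norm_num; done) | exact absurd h3.2 h4
  calc ∑ π, |N b r T π - kap r m 0 * Us s ((-1) ^ r) π|
      = ∑ π ∈ Sy s, |N b r T π - kap r m 0 * Us s ((-1) ^ r) π| := by
        symm
        apply sum_subset (subset_univ _)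
        intro π _ hp
        rw [h0 π hp, abs_zero]
    _ ≤ ∑ π ∈ Sy s, (∑ S ∈ Q, (if ∀ x ∈ S, π x ∈ S then 1 else 0) * |kap r m S.card|) / (m + 1).factorial := sum_le_sum h2
    _ = (∑ S ∈ Q, (((Sy s).filter (fun π => ∀ x ∈ S, π x ∈ S)).card : ℝ) * |kap r m S.card|) / (m + 1).factorial := by
        rw [← sum_div, sum_comm]
        congr 1
        refine sum_congr rfl fun S _ => ?_
        rw [← sum_mul, sum_boole]
    _ ≤ (∑ S ∈ Q, ((S.card.factorial * (m + 1 - S.card).factorial : ℕ) : ℝ) * |kap r m S.card|) / (m + 1).factorial := by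
        gcongr with S hS
        rw [← hsc]
        apply card_stab
        exact mem_powerset.1 (mem_filter.1 hS).1
    _ = (∑ S ∈ s.powerset, (fun k => if k ∈ Icc 1 m then ((k.factorial * (m + 1 - k).factorial : ℕ) : ℝ) * |kap r m k| else 0) S.card) / (m + 1).factorial := by
        congr 1
        rw [hQ, sum_filter]
        refine sum_congr rfl fun S hS => ?_
        have hS' := mem_powerset.1 hS
        have : (S ≠ ∅ ∧ S ≠ s) ↔ S.card ∈ Icc 1 m := by
          rw [mem_Icc]
          constructor
          · rintro ⟨h1, h2⟩
            have := card_lt_card (ssubset_of_subset_of_ne hS' h2)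
            have := card_pos.2 (nonempty_iff_ne_empty.2 h1)
            omega
          · rintro ⟨h1, h2⟩
            constructor
            · rintro rfl; simp at h1
            · rintro rfl; omega
        by_cases h : (S ≠ ∅ ∧ S ≠ s)
        · rw [if_pos h]; simp only; rw [if_pos (this.1 h)]
        · rw [if_neg h]; simp only; rw [if_neg (fun h3 => h (this.2 h3))]
    _ = kerr r m := by
        rw [sum_powerset_apply_card (fun k => if k ∈ Icc 1 m then ((k.factorial * (m + 1 - k).factorial : ℕ) : ℝ) * |kap r m k| else 0), hsc, kerr]
        simp only [smul_ite, smul_zero, nsmul_eq_mul]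
        rw [← sum_filter]
        have : (range (m + 1 + 1)).filter (fun k => k ∈ Icc 1 m) = Icc 1 m := by
          ext k; simp; omega
        rw [this, sum_div]
        refine sum_congr rfl fun k hk => ?_
        have hk' : k ≤ m + 1 := by have := (mem_Icc.1 hk).2; omega
        have := Nat.choose_mul_factorial_mul_factorial hk'
        rw [← mul_assoc, mul_div_right_comm]
        have h5 : (((m + 1).choose k : ℝ) * ((k.factorial * (m + 1 - k).factorial : ℕ) : ℝ)) = (m + 1).factorial := by
          rw [← this]; push_cast; ring
        rw [h5, div_self hfac.ne', one_mul]

lemma kap_sj (b : α) (r : ℕ) (T : Finset α) (hb : b ∉ T) (hT : T.Nonempty) :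
    |sj r T.card - kap r T.card 0| ≤ kerr r T.card := by
  refine le_trans ?_ (L1_aux b r T hb hT)
  refine le_trans ?_ (abs_sum_le_sum_abs _ _)
  rw [sum_sub_distrib, sum_N, ← mul_sum, sum_Us, mul_one]
  rw [card_insert_of_notMem hb]
  have := hT.card_pos
  omega

lemma L1_bound (b : α) (r : ℕ) (T : Finset α) (hb : b ∉ T) (hT : T.Nonempty) :
    ∑ π, |N b r T π - sj r T.card * Us (insert b T) ((-1) ^ r) π| ≤ 2 * kerr r T.card := by
  have h1 := L1_aux b r T hb hT
  have h2 := kap_sj b r T hb hT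
  have h3 : ∀ π, |N b r T π - sj r T.card * Us (insert b T) ((-1) ^ r) π| ≤
      |N b r T π - kap r T.card 0 * Us (insert b T) ((-1) ^ r) π| + |sj r T.card - kap r T.card 0| * Us (insert b T) ((-1) ^ r) π := by
    intro π
    have := Us_nonneg (insert b T) ((-1) ^ r) π
    rw [abs_sub_comm (sj r T.card)]
    nth_rewrite 3 [← abs_of_nonneg this]
    rw [← abs_mul]
    refine le_trans (le_of_eq ?_) (abs_add_le _ _)
    congr 1; ring
  refine (sum_le_sum fun π _ => h3 π).trans ?_
  rw [sum_add_distrib, ← mul_sum, sum_Us, mul_one]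
  · linarith
  · rw [card_insert_of_notMem hb]
    have := hT.card_pos
    omega
end
end TT

namespace TT
open Finset

lemma pascal_alt (M : ℕ) (g : ℕ → ℝ) :
    ∑ j ∈ range (M + 2), (-1 : ℝ) ^ j * (M + 1).choose j * g j
      = ∑ j ∈ range (M + 1), (-1 : ℝ) ^ j * M.choose j * (g j - g (j + 1)) := by
  have h1 : ∑ j ∈ range (M + 1), (-1 : ℝ) ^ j * M.choose j * g j
      = ∑ j ∈ range (M + 1), (-1 : ℝ) ^ (j + 1) * M.choose (j + 1) * g (j + 1) + g 0 := by
    have e1 := sum_range_succ (fun j => (-1 : ℝ) ^ j * M.choose j * g j) (M + 1)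
    have e2 := sum_range_succ' (fun j => (-1 : ℝ) ^ j * M.choose j * g j) (M + 1)
    rw [e2] at e1
    simp only [Nat.choose_succ_self, Nat.choose_zero_right, pow_zero, Nat.cast_one, one_mul, Nat.cast_zero, mul_zero, zero_mul, add_zero] at e1
    linarith
  rw [sum_range_succ']
  simp only [Nat.choose_succ_succ, Nat.cast_add, mul_sub, sum_sub_distrib, h1]
  simp only [Nat.choose_zero_right, pow_zero, Nat.cast_one, one_mul, mul_add, add_mul, sum_add_distrib, pow_succ]
  simp only [mul_neg, neg_mul, mul_one, sum_neg_distrib]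
  ring

noncomputable def E (M : ℕ) (f : ℝ → ℝ) : ℝ := ∑ j ∈ range (M + 1), (-1 : ℝ) ^ j * M.choose j * f ((M : ℝ) / 2 - j)

lemma E_succ (M : ℕ) (f : ℝ → ℝ) : E (M + 1) f = E M (fun x => f (x + 1 / 2) - f (x - 1 / 2)) := by
  rw [E, pascal_alt M (fun j => f (((M + 1 : ℕ) : ℝ) / 2 - j)), E]
  refine sum_congr rfl fun j _ => ?_
  push_cast
  congr 3 <;> ring

lemma E_sum (M : ℕ) {ι : Type*} (s : Finset ι) (c : ι → ℝ) (f : ι → ℝ → ℝ) :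
    E M (fun x => ∑ i ∈ s, c i * f i x) = ∑ i ∈ s, c i * E M (f i) := by
  simp only [E, mul_sum]
  rw [sum_comm]
  refine sum_congr rfl fun j _ => sum_congr rfl fun i _ => by ring

noncomputable def AA (s M : ℕ) : ℝ := E M (fun x => x ^ s)

lemma AA_nonneg (M : ℕ) : ∀ s, 0 ≤ AA s M := by
  induction M with
  | zero => intro s; simp [AA, E]
  | succ M ih =>
    intro s
    rw [AA, E_succ]
    have : (fun x : ℝ => (x + 1 / 2) ^ s - (x - 1 / 2) ^ s) = fun x => ∑ l ∈ range (s + 1),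
        (((1 / 2 : ℝ) ^ (s - l) - (-1 / 2) ^ (s - l)) * s.choose l) * (fun x => x ^ l) x := by
      ext x
      rw [sub_eq_add_neg x, add_pow, add_pow, ← sum_sub_distrib]
      refine sum_congr rfl fun l _ => ?_
      rw [show -(1 / 2 : ℝ) = -1 / 2 by ring]
      ring
    rw [this, E_sum]
    refine sum_nonneg fun l _ => mul_nonneg (mul_nonneg ?_ (Nat.cast_nonneg _)) (ih l)
    rw [sub_nonneg, show (-1 / 2 : ℝ) = -(1 / 2) by ring, neg_pow]
    have : (0 : ℝ) ≤ (1 / 2) ^ (s - l) := by positivity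
    rcases neg_one_pow_eq_or ℝ (s - l) with h | h <;> rw [h] <;> linarith

lemma AA_le (s M : ℕ) : AA s M ≤ 2 ^ M * ((M : ℝ) / 2) ^ s := by
  have : (2 : ℝ) ^ M = ∑ j ∈ range (M + 1), (M.choose j : ℝ) := by
    rw [← Nat.cast_sum, Nat.sum_range_choose]; simp
  rw [AA, E, this, sum_mul]
  refine sum_le_sum fun j hj => ?_
  have hj' : (j : ℝ) ≤ M := by exact_mod_cast Nat.lt_succ_iff.1 (mem_range.1 hj)
  refine (le_abs_self _).trans ?_
  rw [abs_mul, abs_mul, abs_pow, abs_pow, abs_neg, abs_one, one_pow, one_mul, Nat.abs_cast]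
  gcongr
  rw [abs_le]
  constructor <;> linarith [(Nat.cast_nonneg j : (0 : ℝ) ≤ j)]

noncomputable def nu (m k : ℕ) : ℝ := ((m : ℝ) + 1) / 2 - k

lemma kap_expand (r m k : ℕ) (hm : 0 < m) :
    kap r m k = ∑ l ∈ range (r + 1), ((r.choose l : ℝ) * nu m k ^ l) * AA (r - l) (m - 1) := by
  simp only [AA]
  rw [← E_sum, E, kap]
  have : m - 1 + 1 = m := by omega
  rw [this]
  refine sum_congr rfl fun j _ => ?_
  congr 1
  have e : (m : ℝ) - k - j = nu m k + (((m - 1 : ℕ) : ℝ) / 2 - j) := by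
    rw [nu, Nat.cast_sub (by omega)]; push_cast; ring
  rw [e, add_pow]
  refine sum_congr rfl fun l _ => by ring

lemma kap0_nonneg (r m : ℕ) (hm : 0 < m) : 0 ≤ kap r m 0 := by
  rw [kap_expand r m 0 hm]
  refine sum_nonneg fun l _ => ?_
  have := AA_nonneg (m - 1) (r - l)
  have : 0 ≤ nu m 0 := by rw [nu]; push_cast; rw [sub_zero]; positivity
  positivity

lemma kap0_rec (r M : ℕ) : kap (r + 1) (M + 2) 0 = (M + 2) * kap r (M + 2) 0 + (M + 1) * kap r (M + 1) 0 := by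
  have h : ∀ j ∈ range (M + 2), (-1 : ℝ) ^ j * (M + 1).choose j * ((M + 2 : ℕ) - (0 : ℕ) - j) ^ (r + 1)
     = (M + 2) * ((-1 : ℝ) ^ j * (M + 1).choose j * ((M + 2 : ℕ) - (0 : ℕ) - j) ^ r)
       - (-1 : ℝ) ^ j * ((M + 1).choose j * j) * ((M + 2 : ℕ) - (0 : ℕ) - j) ^ r := by
    intro j _; rw [pow_succ]; push_cast; ring
  have e1 : M + 2 - 1 = M + 1 := rfl
  have e2 : M + 1 - 1 = M := rfl
  simp only [kap, e1, e2]
  rw [sum_congr rfl h, sum_sub_distrib, ← mul_sum, sub_eq_add_neg]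
  congr 1
  rw [sum_range_succ']
  simp only [Nat.cast_zero, mul_zero, zero_mul, add_zero]
  rw [← sum_neg_distrib, mul_sum]
  refine sum_congr rfl fun j _ => ?_
  have : ((M + 1).choose (j + 1) : ℝ) * ((j + 1 : ℕ) : ℝ) = (M + 1) * M.choose j := by
    exact_mod_cast (Nat.add_one_mul_choose_eq M j).symm
  rw [this, pow_succ]; push_cast
  rw [show (M : ℝ) + 2 - 0 - (j + 1) = M + 1 - 0 - j by ring]; ring

lemma kap0_one (r : ℕ) : kap r 1 0 = 1 := by simp [kap]

lemma kap0_ge_fac (M : ℕ) : (M.factorial : ℝ) ≤ kap M (M + 1) 0 := by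
  induction M with
  | zero => simp [kap0_one]
  | succ M ih =>
    rw [kap0_rec, Nat.factorial_succ]
    have := kap0_nonneg M (M + 2) (by omega)
    push_cast
    have h2 : ((M : ℝ) + 1) * M.factorial ≤ (M + 1) * kap M (M + 1) 0 := by gcongr
    have h3 : (0 : ℝ) ≤ (M + 2) * kap M (M + 2) 0 := by positivity
    linarith

lemma kap0_ge (M e : ℕ) : ((M : ℝ) + 1) ^ e * M.factorial ≤ kap (M + e) (M + 1) 0 := by
  induction e with
  | zero => simpa using kap0_ge_fac M
  | succ e ih =>
    rcases M with _ | M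
    · simp [kap0_one]
    · rw [← add_assoc, kap0_rec]
      have := kap0_nonneg (M + 1 + e) (M + 1) (by omega)
      have h3 : (0 : ℝ) ≤ (M + 1) * kap (M + 1 + e) (M + 1) 0 := by positivity
      have h2 : ((M : ℝ) + 2) * ((((M + 1 : ℕ) : ℝ) + 1) ^ e * (M + 1).factorial) ≤ (M + 2) * kap (M + 1 + e) (M + 2) 0 := by gcongr
      refine le_trans (le_of_eq ?_) (h2.trans (by linarith))
      push_cast; ring

lemma kap0_ge' (r m : ℕ) (hm : 0 < m) (hr : m - 1 ≤ r) : (m : ℝ) ^ r * Real.exp (-m) ≤ kap r m 0 := by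
  obtain ⟨M, rfl⟩ := Nat.exists_eq_succ_of_ne_zero hm.ne'
  obtain ⟨e, rfl⟩ := Nat.exists_eq_add_of_le hr
  simp only [Nat.succ_eq_add_one, Nat.add_sub_cancel] at *
  refine le_trans ?_ (kap0_ge M e)
  have h1 := Real.pow_div_factorial_le_exp ((M + 1 : ℕ) : ℝ) (by positivity) (M + 1)
  rw [div_le_iff₀ (by positivity), Nat.factorial_succ, pow_succ] at h1
  rw [Real.exp_neg, ← div_eq_mul_inv, div_le_iff₀ (Real.exp_pos _), pow_add]
  push_cast at *
  have h2 : ((M : ℝ) + 1) ^ M ≤ Real.exp (M + 1) * M.factorial := by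
    have : (0 : ℝ) < M + 1 := by positivity
    nlinarith
  calc ((M : ℝ) + 1) ^ M * (M + 1) ^ e ≤ (Real.exp (M + 1) * M.factorial) * (M + 1) ^ e := by gcongr
    _ = _ := by ring

lemma binom_tail (r J : ℕ) : ∑ l ∈ (range (r + 1)).filter (· < J), (r.choose l : ℝ) ≤ 10 ^ J * (11 / 10) ^ r := by
  have : ((11 : ℝ) / 10) ^ r = ∑ l ∈ range (r + 1), (1 / 10 : ℝ) ^ l * r.choose l := by
    rw [show (11 / 10 : ℝ) = 1 / 10 + 1 by norm_num, add_pow]; simp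
  rw [this, mul_sum]
  refine (sum_le_sum fun l hl => ?_).trans (sum_le_sum_of_subset_of_nonneg (filter_subset _ _) (fun l _ _ => by positivity))
  have hl' := (mem_filter.1 hl).2
  have h1 : (1 : ℝ) ≤ 10 ^ J * (1 / 10) ^ l := by
    rw [one_div, inv_pow, ← div_eq_mul_inv, one_le_div (by positivity)]
    exact pow_le_pow_right₀ (by norm_num) hl'.le
  calc (r.choose l : ℝ) = 1 * r.choose l := by ring
    _ ≤ (10 ^ J * (1 / 10) ^ l) * r.choose l := by gcongr
    _ = _ := by ring

lemma abs_kap_le (r m k J : ℕ) (hm : 0 < m) (q : ℝ) (hq0 : 0 ≤ q) (hq1 : q ≤ 1) (hq : |nu m k| ≤ q * nu m 0) :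
    |kap r m k| ≤ q ^ J * kap r m 0 + 2 ^ m * (((m : ℝ) + 1) / 2) ^ r * (10 ^ J * (11 / 10) ^ r) := by
  have hn0 : nu m 0 = ((m : ℝ) + 1) / 2 := by simp [nu]
  have hn0' : 0 ≤ nu m 0 := by rw [hn0]; positivity
  have h1 : |kap r m k| ≤ ∑ l ∈ range (r + 1), ((r.choose l : ℝ) * |nu m k| ^ l) * AA (r - l) (m - 1) := by
    rw [kap_expand r m k hm]
    refine (abs_sum_le_sum_abs _ _).trans (le_of_eq (sum_congr rfl fun l _ => ?_))
    rw [abs_mul, abs_mul, abs_pow, Nat.abs_cast, abs_of_nonneg (AA_nonneg _ _)]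
  refine h1.trans ?_
  rw [← sum_filter_add_sum_filter_not (range (r + 1)) (· < J), add_comm]
  apply add_le_add
  · rw [kap_expand r m 0 hm, mul_sum]
    refine (sum_le_sum fun l hl => ?_).trans (sum_le_sum_of_subset_of_nonneg (filter_subset _ _) (fun l _ _ => ?_))
    · have hl' := not_lt.1 (mem_filter.1 hl).2
      have e : |nu m k| ^ l ≤ q ^ J * nu m 0 ^ l := by
        calc |nu m k| ^ l ≤ (q * nu m 0) ^ l := by gcongr
          _ = q ^ l * nu m 0 ^ l := mul_pow _ _ _
          _ ≤ _ := by
            gcongr ?_ * _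
            exact pow_le_pow_of_le_one hq0 hq1 hl'
      have := AA_nonneg (m - 1) (r - l)
      calc ((r.choose l : ℝ) * |nu m k| ^ l) * AA (r - l) (m - 1) ≤ ((r.choose l : ℝ) * (q ^ J * nu m 0 ^ l)) * AA (r - l) (m - 1) := by gcongr
        _ = _ := by ring
    · have := AA_nonneg (m - 1) (r - l)
      positivity
  · refine le_trans ?_ (mul_le_mul_of_nonneg_left (binom_tail r J) (by positivity))
    rw [mul_sum]
    refine sum_le_sum fun l hl => ?_
    have hl' : l ≤ r := Nat.lt_succ_iff.1 (mem_range.1 (mem_filter.1 hl).1)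
    have hA := AA_le (r - l) (m - 1)
    have hAn := AA_nonneg (m - 1) (r - l)
    have h2 : |nu m k| ≤ ((m : ℝ) + 1) / 2 := by
      rw [← hn0]; exact hq.trans (mul_le_of_le_one_left hn0' hq1)
    have h3 : (((m - 1 : ℕ) : ℝ) / 2) ≤ ((m : ℝ) + 1) / 2 := by
      rw [Nat.cast_sub (by omega)]; push_cast; linarith
    have h4 : (2 : ℝ) ^ (m - 1) ≤ 2 ^ m := pow_le_pow_right₀ (by norm_num) (by omega)
    calc ((r.choose l : ℝ) * |nu m k| ^ l) * AA (r - l) (m - 1)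
        ≤ ((r.choose l : ℝ) * (((m : ℝ) + 1) / 2) ^ l) * (2 ^ m * (((m : ℝ) + 1) / 2) ^ (r - l)) := by
          gcongr
          exact hA.trans (by gcongr)
      _ = 2 ^ m * ((((m : ℝ) + 1) / 2) ^ l * (((m : ℝ) + 1) / 2) ^ (r - l)) * r.choose l := by ring
      _ = _ := by rw [← pow_add, Nat.add_sub_cancel' hl']

lemma sum_pow_le (y : ℝ) (h0 : 0 ≤ y) (h1 : y ≤ 1 / 2) (m : ℕ) : ∑ k ∈ Icc 1 m, y ^ k ≤ 2 * y := by
  have : ∀ m : ℕ, ∑ k ∈ Icc 1 m, y ^ k ≤ 2 * y - 2 * y ^ (m + 1) := by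
    intro m
    induction m with
    | zero => simp
    | succ m ih =>
      rw [sum_Icc_succ_top (by omega)]
      have h2 : y ^ (m + 1 + 1) ≤ 1 / 2 * y ^ (m + 1) := by rw [pow_succ']; gcongr
      linarith
  have h2 := this m
  have : 0 ≤ y ^ (m + 1) := by positivity
  linarith

lemma sum_pow_le' (y : ℝ) (h0 : 0 ≤ y) (h1 : y ≤ 1 / 2) (m : ℕ) : ∑ k ∈ Icc 1 m, (y ^ k + y ^ (m + 1 - k)) ≤ 4 * y := by
  rw [sum_add_distrib]
  have h2 : ∑ k ∈ Icc 1 m, y ^ (m + 1 - k) = ∑ k ∈ Icc 1 m, y ^ k := by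
    apply sum_nbij' (fun k => m + 1 - k) (fun k => m + 1 - k)
    · intro k hk; simp at *; omega
    · intro k hk; simp at *; omega
    · intro k hk; simp at *; omega
    · intro k hk; simp at *; omega
    · intro k hk; rfl
  rw [h2]
  linarith [sum_pow_le y h0 h1 m]

lemma kerr_le (r m c : ℕ) (hm : 0 < m) (hc : 1 ≤ c) :
    kerr r m ≤ 4 * Real.exp (-(2 * c)) * kap r m 0 +
      m * (2 ^ m * (((m : ℝ) + 1) / 2) ^ r * (10 ^ (c * (m + 1)) * (11 / 10) ^ r)) := by
  set y := Real.exp (-(2 * (c : ℝ))) with hy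
  have hc' : (1 : ℝ) ≤ c := by exact_mod_cast hc
  have hy0 : 0 ≤ y := (Real.exp_pos _).le
  have hy1 : y ≤ 1 / 2 := by
    have h1 : y ≤ Real.exp (-1) := Real.exp_le_exp.2 (by linarith)
    have h2 := Real.exp_neg_one_lt_d9
    linarith
  set B := (2 ^ m * (((m : ℝ) + 1) / 2) ^ r * (10 ^ (c * (m + 1)) * (11 / 10) ^ r)) with hB
  have key : ∀ k ∈ Icc 1 m, |kap r m k| ≤ (y ^ k + y ^ (m + 1 - k)) * kap r m 0 + B := by
    intro k hk
    have hk1 := (mem_Icc.1 hk).1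
    have hk2 := (mem_Icc.1 hk).2
    have hk1' : (1 : ℝ) ≤ k := by exact_mod_cast hk1
    have hk2' : (k : ℝ) ≤ m := by exact_mod_cast hk2
    have hm' : (0 : ℝ) < (m : ℝ) + 1 := by positivity
    have hn0 : nu m 0 = ((m : ℝ) + 1) / 2 := by simp [nu]
    have gen : ∀ i : ℕ, 2 * i ≤ m + 1 → |nu m k| ≤ (1 - 2 * i / ((m : ℝ) + 1)) * nu m 0 → |kap r m k| ≤ y ^ i * kap r m 0 + B := by
      intro i hi h
      have hi' : 2 * (i : ℝ) ≤ m + 1 := by exact_mod_cast hi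
      have hq0 : 0 ≤ 1 - 2 * i / ((m : ℝ) + 1) := by
        rw [sub_nonneg, div_le_one hm']; exact hi'
      have hq1 : 1 - 2 * i / ((m : ℝ) + 1) ≤ 1 := by
        have : 0 ≤ 2 * i / ((m : ℝ) + 1) := by positivity
        linarith
      refine (abs_kap_le r m k (c * (m + 1)) hm _ hq0 hq1 h).trans ?_
      have hkn := kap0_nonneg r m hm
      rw [hB]
      gcongr
      have e1 : 1 - 2 * i / ((m : ℝ) + 1) ≤ Real.exp (-(2 * i / ((m : ℝ) + 1))) := by
        have := Real.add_one_le_exp (-(2 * i / ((m : ℝ) + 1))); linarith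
      calc (1 - 2 * i / ((m : ℝ) + 1)) ^ (c * (m + 1)) ≤ (Real.exp (-(2 * i / ((m : ℝ) + 1)))) ^ (c * (m + 1)) := by gcongr
        _ = y ^ i := by
          rw [← Real.exp_nat_mul, hy, ← Real.exp_nat_mul]
          congr 1; push_cast; field_simp
    have hkn := kap0_nonneg r m hm
    have hya : 0 ≤ y ^ k * kap r m 0 := by positivity
    have hyb : 0 ≤ y ^ (m + 1 - k) * kap r m 0 := by positivity
    rw [add_mul]
    rcases le_total (2 * k) (m + 1) with h | h
    · have := gen k h (by
        have h' : 2 * (k : ℝ) ≤ m + 1 := by exact_mod_cast h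
        rw [hn0, nu, abs_of_nonneg (by linarith)]
        apply le_of_eq; field_simp)
      linarith
    · have h' : (m : ℝ) + 1 ≤ 2 * k := by exact_mod_cast h
      have := gen (m + 1 - k) (by omega) (by
        rw [hn0, nu, abs_of_nonpos (by linarith), Nat.cast_sub (by omega)]
        push_cast
        apply le_of_eq; field_simp; ring)
      linarith
  rw [kerr]
  refine (sum_le_sum key).trans ?_
  rw [sum_add_distrib, ← sum_mul, sum_const, Nat.card_Icc, nsmul_eq_mul, Nat.add_sub_cancel]
  gcongr
  · exact kap0_nonneg r m hm
  · exact sum_pow_le' y hy0 hy1 m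

theorem kerr_small (ε δ : ℝ) (hε : 0 < ε) (hδ : 0 < δ) :
    ∃ m0 : ℕ, ∀ m ≥ m0, ∀ r : ℕ, δ * m * Real.log m ≤ r → 0 < m ∧ kerr r m ≤ ε * kap r m 0 := by
  obtain ⟨c, hc1, hc⟩ : ∃ c : ℕ, 1 ≤ c ∧ 4 * Real.exp (-(2 * c)) ≤ ε / 2 := by
    have h : Tendsto (fun c : ℕ => 4 * Real.exp (-(2 * (c : ℝ)))) atTop (nhds (4 * 0)) := by
      apply Tendsto.const_mul
      apply Real.tendsto_exp_neg_atTop_nhds_zero.comp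
      exact (tendsto_natCast_atTop_atTop).const_mul_atTop (by norm_num)
    rw [mul_zero] at h
    obtain ⟨c, h1, h2⟩ := ((h.eventually (ge_mem_nhds (show (0 : ℝ) < ε / 2 by positivity))).and (eventually_ge_atTop 1)).exists
    exact ⟨c, h2, h1⟩
  set B : ℝ := 3 + 6 * c with hB
  have hlog : Tendsto (fun m : ℕ => Real.log m) atTop atTop := Real.tendsto_log_atTop.comp tendsto_natCast_atTop_atTop
  have hcast : Tendsto (fun m : ℕ => (m : ℝ)) atTop atTop := tendsto_natCast_atTop_atTop
  obtain ⟨m0, hm0⟩ := eventually_atTop.1 ((hlog.eventually_ge_atTop (2 * (B + 1) / δ)).and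
    ((hcast.eventually_ge_atTop (Real.log (2 / ε))).and ((hlog.eventually_ge_atTop (1 / δ)).and (eventually_ge_atTop 11))))
  refine ⟨m0, fun m hm r hr => ?_⟩
  obtain ⟨h1, h2, h3, h4⟩ := hm0 m hm
  have hmpos : 0 < m := by omega
  refine ⟨hmpos, (kerr_le r m c hmpos hc1).trans ?_⟩
  have hk0 := kap0_nonneg r m hmpos
  have hm' : (0 : ℝ) < m := by exact_mod_cast hmpos
  have hm11 : (11 : ℝ) ≤ m := by exact_mod_cast h4
  rw [div_le_iff₀ hδ] at h1 h3
  have hrm : (m : ℝ) ≤ r := by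
    refine le_trans ?_ hr
    nlinarith
  have hrm' : m ≤ r := by exact_mod_cast hrm
  have hkge := kap0_ge' r m hmpos (by omega)
  have hr2 : (m : ℝ) * (2 * (B + 1)) ≤ r := by
    refine le_trans ?_ hr
    nlinarith
  have second : m * (2 ^ m * (((m : ℝ) + 1) / 2) ^ r * (10 ^ (c * (m + 1)) * (11 / 10) ^ r)) ≤ ε / 2 * kap r m 0 := by
    have a1 : (m : ℝ) ≤ Real.exp m := by have := Real.add_one_le_exp (m : ℝ); linarith
    have a2 : (2 : ℝ) ^ m ≤ Real.exp m := by
      rw [← mul_one (m : ℝ), Real.exp_nat_mul]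
      gcongr
      have := Real.add_one_le_exp (1 : ℝ); linarith
    have a3 : (10 : ℝ) ^ (c * (m + 1)) ≤ Real.exp (6 * c * m) := by
      have : (10 : ℝ) ≤ Real.exp 3 := by
        have e3 : Real.exp 3 = Real.exp 1 ^ 3 := by rw [← Real.exp_nat_mul]; norm_num
        have := Real.exp_one_gt_d9
        rw [e3]
        calc (10 : ℝ) ≤ 2.7 ^ 3 := by norm_num
          _ ≤ _ := by gcongr; linarith
      calc (10 : ℝ) ^ (c * (m + 1)) ≤ (Real.exp 3) ^ (c * (m + 1)) := by gcongr
        _ = Real.exp ((c * (m + 1) : ℕ) * 3) := by rw [← Real.exp_nat_mul]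
        _ ≤ _ := by
          apply Real.exp_le_exp.2
          push_cast
          have : (0 : ℝ) ≤ c := Nat.cast_nonneg c
          nlinarith [mul_nonneg this (by linarith : (0 : ℝ) ≤ (m : ℝ) - 1)]
    have a4 : (((m : ℝ) + 1) / 2) ^ r * (11 / 10) ^ r ≤ m ^ r * Real.exp (- (r / 2)) := by
      have : Real.exp (-(1 / 2)) ≥ 6 / 10 := by
        have h5 : Real.exp (-(1 / 2)) ^ 2 = Real.exp (-1) := by rw [← Real.exp_nat_mul]; norm_num
        have h6 := Real.exp_neg_one_gt_d9
        have h7 := Real.exp_pos (-(1 / 2))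
        nlinarith
      have e5 : Real.exp (-((r : ℝ) / 2)) = Real.exp (-(1 / 2)) ^ r := by rw [← Real.exp_nat_mul]; congr 1; ring
      rw [e5, ← mul_pow, ← mul_pow]
      refine pow_le_pow_left₀ (by positivity) ?_ r
      calc ((m : ℝ) + 1) / 2 * (11 / 10) ≤ m * (6 / 10) := by linarith
        _ ≤ _ := by gcongr
    have a5 : Real.exp (-m) ≤ ε / 2 := by
      rw [Real.exp_neg, inv_le_comm₀ (Real.exp_pos _) (by positivity), inv_div, ← Real.log_le_iff_le_exp (by positivity)]
      exact h2
    calc m * (2 ^ m * (((m : ℝ) + 1) / 2) ^ r * (10 ^ (c * (m + 1)) * (11 / 10) ^ r))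
        = m * 2 ^ m * 10 ^ (c * (m + 1)) * ((((m : ℝ) + 1) / 2) ^ r * (11 / 10) ^ r) := by ring
      _ ≤ Real.exp m * Real.exp m * Real.exp (6 * c * m) * (m ^ r * Real.exp (- (r / 2))) := by gcongr
      _ = m ^ r * Real.exp (-m) * Real.exp (B * m - r / 2) := by
          have : Real.exp (B * m - r / 2) = Real.exp m * Real.exp m * Real.exp m * Real.exp (6 * c * m) * Real.exp (- (r / 2)) := by
            rw [← Real.exp_add, ← Real.exp_add, ← Real.exp_add, ← Real.exp_add]; congr 1; rw [hB]; ring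
          have h9 : Real.exp m * Real.exp (-m) = 1 := by rw [← Real.exp_add]; simp
          rw [this]
          linear_combination -(Real.exp m * Real.exp m * Real.exp (6 * c * m) * (m ^ r * Real.exp (- (r / 2)))) * h9
      _ ≤ kap r m 0 * Real.exp (-m) := by
          gcongr
          linarith
      _ ≤ kap r m 0 * (ε / 2) := by gcongr
      _ = _ := by ring
  have first : 4 * Real.exp (-(2 * c)) * kap r m 0 ≤ ε / 2 * kap r m 0 := by gcongr
  linarith

theorem kerr_sj (ε δ : ℝ) (hε : 0 < ε) (hδ : 0 < δ) :
    ∃ m0 : ℕ, ∀ m ≥ m0, ∀ r : ℕ, δ * m * Real.log m ≤ r → 0 < m ∧ 2 * kerr r m ≤ ε * sj r m := by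
  have hε' : 0 < min (ε / 4) (1 / 2) := by positivity
  obtain ⟨m0, h⟩ := kerr_small (min (ε / 4) (1 / 2)) δ hε' hδ
  refine ⟨m0, fun m hm r hr => ?_⟩
  obtain ⟨h1, h2⟩ := h m hm r hr
  refine ⟨h1, ?_⟩
  have h0 := kap0_nonneg r m h1
  have h3 := kap_sj (0 : Fin (m + 1)) r (univ.erase 0) (by simp) (by
    rw [← card_pos]; simp; exact h1)
  simp at h3
  have h4 := (abs_le.1 h3).1
  have h5 : min (ε / 4) (1 / 2) * kap r m 0 ≤ ε / 4 * kap r m 0 := by gcongr; exact min_le_left _ _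
  have h6 : min (ε / 4) (1 / 2) * kap r m 0 ≤ 1 / 2 * kap r m 0 := by gcongr; exact min_le_right _ _
  have h7 : kap r m 0 ≤ 2 * sj r m := by linarith
  calc 2 * kerr r m ≤ 2 * (ε / 4 * kap r m 0) := by linarith
    _ ≤ 2 * (ε / 4 * (2 * sj r m)) := by gcongr
    _ = _ := by ring
end TT

namespace TT
open Equiv Finset

section
set_option linter.unusedSectionVars false
variable {α : Type*} [Fintype α] [DecidableEq α]

def Xb (b : α) : Finset α := univ.erase b
def X0 (a b : α) : Finset α := (univ.erase b).erase a

lemma mem_Xb {b i : α} : i ∈ Xb b ↔ i ≠ b := by simp [Xb]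
lemma mem_X0 {a b i : α} : i ∈ X0 a b ↔ i ≠ a ∧ i ≠ b := by simp [X0]

lemma coeff_mul_sum (x y : MonoidAlgebra ℝ (Perm α)) (σ : Perm α) :
    (x * y).coeff σ = ∑ g, x.coeff g * y.coeff (g⁻¹ * σ) := by
  rw [MonoidAlgebra.coeff_mul_apply_left, Finsupp.sum_fintype]
  intro i; simp

noncomputable def HH (a b : α) (t : ℕ) (σ : Perm α) : ℝ :=
  ∑ r ∈ range (t + 1), ∑ A ∈ (X0 a b).powerset, ∑ B ∈ (Xb b).powerset,
    (t.choose r : ℝ) * ∑ g, N a r A g * N b (t - r) B (g⁻¹ * σ)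

lemma swap_conj (g : Perm α) (i b : α) : g * swap i b = swap (g i) (g b) * g := by
  rw [mul_swap_eq_swap_mul]

lemma comm_J (a b : α) (hab : a ≠ b) : Commute (J a (X0 a b)) (J b (Xb b)) := by
  rw [J]
  apply Commute.sum_left
  intro i hi
  rw [mem_X0] at hi
  rw [J, commute_iff_eq, mul_sum, sum_mul]
  simp only [MonoidAlgebra.single_mul_single, mul_one]
  apply sum_equiv (swap i a)
  · intro j
    rw [mem_Xb, mem_Xb]
    constructor
    · intro h h2
      apply h
      have := congrArg (swap i a) h2
      rw [swap_apply_self, swap_apply_of_ne_of_ne hi.2.symm hab.symm] at this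
      exact this
    · intro h h2
      apply h
      rw [h2, swap_apply_of_ne_of_ne hi.2.symm hab.symm]
  · intro j _
    rw [swap_conj, swap_apply_of_ne_of_ne hi.2.symm hab.symm]

lemma Xb_eq (a b : α) (hab : a ≠ b) : Xb b = insert a (X0 a b) := by
  ext i
  simp only [mem_Xb, mem_insert, mem_X0]
  by_cases h : i = a
  · simp [h, hab]
  · simp [h]

lemma comm_s (a b : α) (hab : a ≠ b) :
    Commute (J a (X0 a b) + J b (Xb b)) (MonoidAlgebra.single (swap a b) (1 : ℝ)) := by
  have h : J b (Xb b) = MonoidAlgebra.single (swap a b) 1 + J b (X0 a b) := by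
    rw [J, Xb_eq a b hab, sum_insert (by simp [mem_X0])]; rfl
  have h1 : MonoidAlgebra.single (swap a b) 1 * J a (X0 a b) = J b (X0 a b) * MonoidAlgebra.single (swap a b) 1 := by
    rw [J, J, mul_sum, sum_mul]
    refine sum_congr rfl fun i hi => ?_
    rw [mem_X0] at hi
    rw [MonoidAlgebra.single_mul_single, MonoidAlgebra.single_mul_single, swap_conj, swap_apply_of_ne_of_ne hi.1 hi.2, swap_apply_left]
  have h2 : MonoidAlgebra.single (swap a b) 1 * J b (X0 a b) = J a (X0 a b) * MonoidAlgebra.single (swap a b) 1 := by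
    rw [J, J, mul_sum, sum_mul]
    refine sum_congr rfl fun i hi => ?_
    rw [mem_X0] at hi
    rw [MonoidAlgebra.single_mul_single, MonoidAlgebra.single_mul_single, swap_conj, swap_apply_of_ne_of_ne hi.1 hi.2, swap_apply_right]
  rw [h, commute_iff_eq, mul_add, mul_add, add_mul, add_mul, h1, h2]
  abel

lemma coeff_JJ (a b : α) (hab : a ≠ b) (t : ℕ) (σ : Perm α) :
    ((J a (X0 a b) + J b (Xb b)) ^ t).coeff σ = HH a b t σ := by
  rw [(comm_J a b hab).add_pow, HH, MonoidAlgebra.coeff_sum, Finsupp.finsetSum_apply]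
  refine sum_congr rfl fun r _ => ?_
  rw [← nsmul_eq_mul', MonoidAlgebra.coeff_smul_apply, coeff_mul_sum, nsmul_eq_mul]
  simp only [coeff_J_pow]
  simp only [← mul_sum]
  congr 1
  rw [sum_congr rfl fun A _ => sum_comm]
  rw [sum_comm]
  refine sum_congr rfl fun g _ => ?_
  rw [sum_mul]
  refine sum_congr rfl fun A _ => ?_
  rw [mul_sum]

lemma threeCycle_iff (a b : α) (hab : a ≠ b) (π : Perm α) :
    (π.IsThreeCycle ∧ a ∈ π.support ∧ b ∈ π.support) ↔
      ∃ i ∈ X0 a b, π * swap a b = swap i a ∨ π * swap a b = swap i b := by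
  constructor
  · rintro ⟨h, ha, hb⟩
    have h1 := h.eq_swap_mul_swap_iff_mem_support.2 ha
    have h2 := h.support_eq_iff_mem_support.2 ha
    have h3 := h.nodup_iff_mem_support.2 ha
    rw [h2] at hb
    simp only [mem_insert, mem_singleton] at hb
    rcases hb with hb | hb | hb
    · exact absurd hb.symm hab
    · refine ⟨π (π a), mem_X0.2 ⟨by grind, by grind⟩, Or.inl ?_⟩
      rw [← mul_left_inj (swap a b), mul_assoc, swap_mul_self, mul_one]
      rw [← hb] at h1 h3 ⊢
      generalize π b = i at *
      rw [h1]
      ext x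
      simp only [Perm.mul_apply, swap_apply_def]
      grind
    · refine ⟨π a, mem_X0.2 ⟨by grind, by grind⟩, Or.inr ?_⟩
      rw [← mul_left_inj (swap a b), mul_assoc, swap_mul_self, mul_one]
      rw [← hb] at h1 h3
      generalize π a = i at *
      rw [h1]
      ext x
      simp only [Perm.mul_apply, swap_apply_def]
      grind
  · rintro ⟨i, hi, h⟩
    rw [mem_X0] at hi
    have h' : π = swap i a * swap a b ∨ π = swap i b * swap a b := by
      rcases h with h | h <;> [left; right] <;> rw [← h, mul_assoc, swap_mul_self, mul_one]
    rcases h' with rfl | rfl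
    · refine ⟨?_, ?_, ?_⟩
      · rw [swap_comm i a]; exact Perm.isThreeCycle_swap_mul_swap_same hi.1.symm hab hi.2
      · rw [Perm.mem_support]; simp only [Perm.mul_apply, swap_apply_def]; grind
      · rw [Perm.mem_support]; simp only [Perm.mul_apply, swap_apply_def]; grind
    · refine ⟨?_, ?_, ?_⟩
      · rw [swap_comm i b, swap_comm a b]; exact Perm.isThreeCycle_swap_mul_swap_same hi.2.symm hab.symm hi.1
      · rw [Perm.mem_support]; simp only [Perm.mul_apply, swap_apply_def]; grind
      · rw [Perm.mem_support]; simp only [Perm.mul_apply, swap_apply_def]; grind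

lemma coeff_J (b : α) (X : Finset α) (ρ : Perm α) (hb : b ∉ X) :
    (J b X).coeff ρ = if ∃ i ∈ X, ρ = swap i b then 1 else 0 := by
  rw [J, MonoidAlgebra.coeff_sum, Finsupp.finsetSum_apply]
  simp only [MonoidAlgebra.coeff_single_apply]
  split_ifs with h
  · obtain ⟨i, hi, rfl⟩ := h
    rw [sum_eq_single_of_mem i hi]
    · simp
    · intro j hj hne
      rw [if_neg]
      intro h2
      have := congrArg (fun p => p b) h2
      simp at this
      exact hne this
  · apply sum_eq_zero
    intro i hi
    rw [if_neg]
    intro h2; exact h ⟨i, hi, h2.symm⟩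

lemma coeff_sumJ (a b : α) (hab : a ≠ b) (π : Perm α) :
    ((J a (X0 a b) + J b (Xb b)) * MonoidAlgebra.single (swap a b) 1).coeff π =
      if π = 1 then 1 else if π.IsThreeCycle ∧ a ∈ π.support ∧ b ∈ π.support then 1 else 0 := by
  rw [MonoidAlgebra.coeff_mul_single_apply, swap_inv, MonoidAlgebra.coeff_add, Finsupp.add_apply, coeff_J _ _ _ (by simp [mem_X0]),
    coeff_J _ _ _ (by simp [mem_Xb]), mul_one]
  simp only [threeCycle_iff a b hab]
  have hone : π * swap a b = swap a b ↔ π = 1 := mul_eq_right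
  have dis : ∀ i ∈ X0 a b, ∀ j ∈ Xb b, swap i a ≠ swap j b := by
    intro i hi j hj h
    rw [mem_X0] at hi; rw [mem_Xb] at hj
    have := congrArg (fun p => p b) h
    simp only [swap_apply_right, swap_apply_of_ne_of_ne hi.2.symm hab.symm] at this
    exact hj this.symm
  by_cases h1 : π = 1
  · subst h1
    rw [if_pos rfl, if_neg, if_pos]
    · simp
    · exact ⟨a, mem_Xb.2 hab, by simp⟩
    · rintro ⟨i, hi, h⟩
      exact dis i hi a (mem_Xb.2 hab) (by rw [← h]; simp)
  · rw [if_neg h1]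
    by_cases h2 : ∃ i ∈ X0 a b, π * swap a b = swap i a
    · obtain ⟨i, hi, h⟩ := h2
      rw [if_pos ⟨i, hi, h⟩, if_neg, if_pos ⟨i, hi, Or.inl h⟩]
      · simp
      · rintro ⟨j, hj, h3⟩
        exact dis i hi j hj (h.symm.trans h3)
    · rw [if_neg h2, zero_add]
      congr 1
      apply propext
      constructor
      · rintro ⟨i, hi, h⟩
        refine ⟨i, mem_X0.2 ⟨?_, mem_Xb.1 hi⟩, Or.inr h⟩
        rintro rfl
        exact h1 (hone.1 h)
      · rintro ⟨i, hi, h⟩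
        rcases h with h | h
        · exact absurd ⟨i, hi, h⟩ h2
        · exact ⟨i, mem_Xb.2 (mem_X0.1 hi).2, h⟩

noncomputable def xx (γ : alternatingGroup α → ℝ) : MonoidAlgebra ℝ (Perm α) :=
  ∑ g : alternatingGroup α, MonoidAlgebra.single (g : Perm α) (γ g)

lemma coeff_xx (γ : alternatingGroup α → ℝ) (g : alternatingGroup α) : (xx γ).coeff g = γ g := by
  rw [xx, MonoidAlgebra.coeff_sum, Finsupp.finsetSum_apply, sum_eq_single g]
  · simp
  · intro h _ hne
    rw [MonoidAlgebra.coeff_single_apply, if_neg]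
    intro h2; exact hne (Subtype.ext h2)
  · simp

lemma coeff_xx_odd (γ : alternatingGroup α → ℝ) (g : Perm α) (hg : g ∉ alternatingGroup α) : (xx γ).coeff g = 0 := by
  rw [xx, MonoidAlgebra.coeff_sum, Finsupp.finsetSum_apply, sum_eq_zero]
  intro h _
  rw [MonoidAlgebra.coeff_single_apply, if_neg]
  rintro rfl; exact hg h.2

lemma xx_convolve (γ η : alternatingGroup α → ℝ) : xx (convolve γ η) = xx γ * xx η := by
  simp only [xx, convolve]
  rw [sum_mul]
  simp only [mul_sum, MonoidAlgebra.single_mul_single]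
  have h : ∀ g : alternatingGroup α, ∑ h : alternatingGroup α, MonoidAlgebra.single ((g : Perm α) * (h : Perm α)) (γ g * η h)
      = ∑ k : alternatingGroup α, MonoidAlgebra.single (k : Perm α) (γ g * η (g⁻¹ * k)) := by
    intro g
    apply Fintype.sum_equiv (Equiv.mulLeft g)
    intro h; simp
  rw [sum_congr rfl fun g _ => h g, sum_comm]
  refine sum_congr rfl fun k _ => ?_
  ext ρ
  rw [MonoidAlgebra.coeff_sum, Finsupp.finsetSum_apply]
  simp only [MonoidAlgebra.coeff_single_apply]
  split_ifs <;> simp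

lemma xx_convPow (γ : alternatingGroup α → ℝ) (t : ℕ) : xx (convPow γ t) = xx γ ^ t := by
  induction t with
  | zero =>
    rw [pow_zero]
    ext ρ
    rw [MonoidAlgebra.one_def, MonoidAlgebra.coeff_single_apply]
    by_cases h : ρ ∈ alternatingGroup α
    · rw [coeff_xx _ ⟨ρ, h⟩]
      simp [convPow, Subtype.ext_iff, eq_comm]
    · rw [coeff_xx_odd _ _ h, if_neg]
      rintro rfl
      exact h (one_mem _)
  | succ t ih =>
    rw [convPow, xx_convolve, ih, pow_succ]
end

theorem tv_formula (n : ℕ) (hn : 3 ≤ n) (t : ℕ) (a b : Fin n) (ha : (a : ℕ) = n - 2) (hb : (b : ℕ) = n - 1) :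
    tvDist (convPow (Pmeas n) t) (unif (alternatingGroup (Fin n))) =
      (∑ σ : Perm (Fin n), if Perm.sign σ = (-1) ^ t then |HH a b t σ / (2 * (n : ℝ) - 3) ^ t - 2 / n.factorial| else 0) / 2 := by
  have hab : a ≠ b := by intro h; rw [h] at ha; omega
  have hx : xx (Pmeas n) = (1 / (2 * (n : ℝ) - 3)) • ((J a (X0 a b) + J b (Xb b)) * MonoidAlgebra.single (swap a b) 1) := by
    ext π
    rw [MonoidAlgebra.coeff_smul_apply, coeff_sumJ a b hab]
    have hsup : (∀ x : Fin n, n - 2 ≤ (x : ℕ) → x ∈ π.support) ↔ (a ∈ π.support ∧ b ∈ π.support) := by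
      constructor
      · intro h; exact ⟨h a (by omega), h b (by omega)⟩
      · rintro ⟨h1, h2⟩ x hx
        have : x = a ∨ x = b := by
          rw [Fin.ext_iff, Fin.ext_iff]; omega
        rcases this with rfl | rfl
        · exact h1
        · exact h2
    by_cases h : π ∈ alternatingGroup (Fin n)
    · rw [coeff_xx _ ⟨π, h⟩]
      simp only [Pmeas, hsup]
      split_ifs <;> simp
    · rw [coeff_xx_odd _ _ h, if_neg, if_neg]
      · simp
      · rintro ⟨h2, -⟩; exact h (Perm.mem_alternatingGroup.2 h2.sign)
      · rintro rfl; exact h (one_mem _)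
  have hpow : xx (convPow (Pmeas n) t) = (1 / (2 * (n : ℝ) - 3)) ^ t • ((J a (X0 a b) + J b (Xb b)) ^ t * MonoidAlgebra.single (swap a b ^ t) 1) := by
    rw [xx_convPow, hx, smul_pow, (comm_s a b hab).mul_pow, MonoidAlgebra.single_pow, one_pow]
  have hval : ∀ g : alternatingGroup (Fin n), convPow (Pmeas n) t g = HH a b t (g * (swap a b ^ t)⁻¹) / (2 * (n : ℝ) - 3) ^ t := by
    intro g
    rw [← coeff_xx (convPow (Pmeas n) t) g, hpow, MonoidAlgebra.coeff_smul_apply, MonoidAlgebra.coeff_mul_single_apply, coeff_JJ a b hab]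
    simp; ring
  rw [tvDist]
  congr 1
  have hcard : (Fintype.card (alternatingGroup (Fin n)) : ℝ) = n.factorial / 2 := by
    haveI : Nontrivial (Fin n) := ⟨a, b, hab⟩
    have := two_mul_card_alternatingGroup (α := Fin n)
    rw [Fintype.card_perm, Fintype.card_fin] at this
    have h2 : (2 : ℝ) * (Fintype.card (alternatingGroup (Fin n)) : ℝ) = n.factorial := by exact_mod_cast this
    linarith
  simp only [unif, hval, hcard, one_div_div]
  rw [← sum_filter]
  refine sum_bij (fun g _ => (g : Perm (Fin n)) * (swap a b ^ t)⁻¹) ?_ ?_ ?_ ?_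
  · intro g _
    rw [mem_filter]
    refine ⟨mem_univ _, ?_⟩
    have := Perm.mem_alternatingGroup.1 g.2
    rw [map_mul, this, map_inv, map_pow, Perm.sign_swap hab]; simp
  · intro g _ h _ e
    exact Subtype.ext (mul_right_cancel e)
  · intro σ hσ
    rw [mem_filter] at hσ
    refine ⟨⟨σ * swap a b ^ t, ?_⟩, mem_univ _, by simp⟩
    rw [Perm.mem_alternatingGroup, map_mul, hσ.2, map_pow, Perm.sign_swap hab, ← mul_pow]; simp
  · intro g _; rfl
end TT

namespace TT
open Equiv Finset

section
set_option linter.unusedSectionVars false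
variable {α : Type*} [Fintype α] [DecidableEq α]

lemma exists_split (s s' : Finset α) (σ : Perm α)
    (hC : ∀ x, x ∉ s → (x ∉ s' ∨ σ⁻¹ x ∉ s') → σ x = x) :
    ∃ g ∈ Sy s, g⁻¹ * σ ∈ Sy s' := by
  have hinj : Set.InjOn (fun x => if x ∈ s then σ x else x) ((s ∩ s')ᶜ : Finset α) := by
    intro x hx y hy h
    simp only [coe_compl, Set.mem_compl_iff, mem_coe, mem_inter, not_and] at hx hy
    simp only at h
    split_ifs at h with h1 h2 h2
    · exact σ.injective h
    · have h3 : σ⁻¹ y = x := by rw [← h]; simp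
      have h4 := hC y h2 (Or.inr (by rw [h3]; exact hx h1))
      rw [← h4] at h
      exact σ.injective h
    · have h3 : σ⁻¹ x = y := by rw [h]; simp
      have h4 := hC x h1 (Or.inr (by rw [h3]; exact hy h2))
      rw [← h4] at h
      exact σ.injective h
    · exact h
  obtain ⟨g, hg⟩ := Finset.exists_equiv_extend_of_card_eq (α := α) (t := univ) (by simp) (subset_univ _) hinj
  let g' : Perm α := g.trans (Equiv.subtypeUnivEquiv (fun x => mem_univ x))
  have hg' : ∀ x, x ∉ s ∩ s' → g' x = if x ∈ s then σ x else x := by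
    intro x hx
    exact hg x (mem_compl.2 hx)
  refine ⟨g', ?_, ?_⟩
  · rw [mem_Sy]
    intro x hx
    rw [hg' x (fun h => hx (mem_inter.1 h).1), if_neg hx]
  · rw [mem_Sy]
    intro x hx
    rw [Perm.mul_apply, Perm.inv_eq_iff_eq, hg' x (fun h => hx (mem_inter.1 h).2)]
    split_ifs with h
    · rfl
    · exact hC x h (Or.inl hx)

lemma dens_lb (s s' : Finset α) (e1 e2 : ℤˣ) (σ : Perm α) (hσ : Perm.sign σ = e1 * e2)
    (hC : ∀ x, x ∉ s → (x ∉ s' ∨ σ⁻¹ x ∉ s') → σ x = x) (h2 : 2 ≤ (s ∩ s').card) :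
    2 * ((s ∩ s').card.factorial : ℝ) / (s.card.factorial * s'.card.factorial) ≤
      ∑ g, Us s e1 g * Us s' e2 (g⁻¹ * σ) := by
  obtain ⟨g0, hg0, hg1⟩ := exists_split s s' σ hC
  have hc := card_Sy_sign (s ∩ s') h2 (Perm.sign g0 * e1)
  set T := (Sy (s ∩ s')).filter (fun π => Perm.sign π = Perm.sign g0 * e1)
  have h3 : ∑ g ∈ T.image (fun x => g0 * x), Us s e1 g * Us s' e2 (g⁻¹ * σ) ≤
      ∑ g, Us s e1 g * Us s' e2 (g⁻¹ * σ) :=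
    sum_le_sum_of_subset_of_nonneg (subset_univ _) (fun _ _ _ => mul_nonneg (Us_nonneg _ _ _) (Us_nonneg _ _ _))
  refine le_trans (le_of_eq ?_) h3
  rw [sum_image (fun x _ y _ h => mul_left_cancel h)]
  have h4 : ∀ x ∈ T, Us s e1 (g0 * x) * Us s' e2 ((g0 * x)⁻¹ * σ) = 4 / (s.card.factorial * s'.card.factorial) := by
    intro x hx
    rw [mem_filter] at hx
    have hs : Perm.sign (g0 * x) = e1 := by
      rw [map_mul, hx.2, ← mul_assoc, Int.units_mul_self, one_mul]
    rw [Us, if_pos, Us, if_pos]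
    · rw [div_mul_div_comm]; norm_num
    · refine ⟨?_, ?_⟩
      · rw [mul_inv_rev, mul_assoc]
        exact Sy_mul (Sy_inv (Sy_mono inter_subset_right hx.1)) hg1
      · rw [map_mul, map_inv, hs, hσ, inv_mul_cancel_left]
    · exact ⟨Sy_mul hg0 (Sy_mono inter_subset_left hx.1), hs⟩
  rw [sum_congr rfl h4, sum_const, nsmul_eq_mul, ← hc]
  ring

lemma sum_powersetCard_compl (X : Finset α) (u : ℕ) (hu : u ≤ X.card) (f : Finset α → ℝ) :
    ∑ A ∈ powersetCard (X.card - u) X, f A = ∑ U ∈ powersetCard u X, f (X \ U) := by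
  apply sum_nbij' (fun A => X \ A) (fun A => X \ A)
  · intro A hA
    rw [mem_powersetCard] at *
    refine ⟨sdiff_subset, ?_⟩
    rw [card_sdiff_of_subset hA.1, hA.2]; omega
  · intro A hA
    rw [mem_powersetCard] at *
    refine ⟨sdiff_subset, ?_⟩
    rw [card_sdiff_of_subset hA.1, hA.2]
  · intro A hA
    rw [mem_powersetCard] at hA
    exact Finset.sdiff_sdiff_eq_self hA.1
  · intro A hA
    rw [mem_powersetCard] at hA
    exact Finset.sdiff_sdiff_eq_self hA.1
  · intro A hA
    rw [mem_powersetCard] at hA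
    simp only [Finset.sdiff_sdiff_eq_self hA.1]

noncomputable def Fx (a b : α) (σ : Perm α) : Finset α := (X0 a b).filter (fun x => σ x = x)

lemma card_Xb (b : α) : (Xb b).card = Fintype.card α - 1 := by
  rw [Xb, card_erase_of_mem (mem_univ _), card_univ]
lemma card_X0 (a b : α) (hab : a ≠ b) : (X0 a b).card = Fintype.card α - 2 := by
  rw [X0, card_erase_of_mem (by simp [hab]), card_erase_of_mem (mem_univ _), card_univ]; omega

/-- good pairs -/
noncomputable def GP (a b : α) (σ : Perm α) (u v j : ℕ) : Finset (Finset α × Finset α) :=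
  (powersetCard u (X0 a b) ×ˢ powersetCard v (Xb b)).filter (fun p =>
    (∀ x, x ∈ insert b p.1 → (x ∈ p.2 ∨ σ⁻¹ x ∈ p.2) → σ x = x) ∧ (p.1 ∩ p.2).card = j)

lemma card_GP (a b : α) (hab : a ≠ b) (σ : Perm α) (u v j : ℕ) (hju : j ≤ u) (hjv : j ≤ v) :
    (Fx a b σ).card.choose j * (Fintype.card α - 2 - j).choose (v - j) *
      (Fintype.card α - 2 - 2 * v).choose (u - j) ≤ (GP a b σ u v j).card := by
  let Y : Finset α := univ \ {b, σ⁻¹ b}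
  let T := (powersetCard j (Fx a b σ)).sigma (fun J => (powersetCard (v - j) (Y \ J)).sigma
    (fun V => powersetCard (u - j) (X0 a b \ ((J ∪ V) ∪ (J ∪ V).image σ))))
  have h1 : (Fx a b σ).card.choose j * (Fintype.card α - 2 - j).choose (v - j) *
      (Fintype.card α - 2 - 2 * v).choose (u - j) ≤ T.card := by
    rw [card_sigma, mul_assoc, ← card_powersetCard, ← smul_eq_mul]
    apply card_nsmul_le_sum
    intro J hJ
    rw [mem_powersetCard] at hJ
    rw [card_sigma]
    have hY : (Fintype.card α - 2 - j) ≤ (Y \ J).card := by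
      have h1 := le_card_sdiff J Y
      have h2 : (univ : Finset α).card - ({b, σ⁻¹ b} : Finset α).card ≤ Y.card := le_card_sdiff {b, σ⁻¹ b} (univ : Finset α)
      have h3 := card_le_two (a := b) (b := σ⁻¹ b)
      rw [card_univ] at h2
      omega
    refine le_trans (Nat.mul_le_mul_right _ (Nat.choose_le_choose _ hY)) ?_
    rw [← card_powersetCard (v - j), ← smul_eq_mul]
    apply card_nsmul_le_sum
    intro V hV
    rw [mem_powersetCard] at hV
    rw [card_powersetCard]
    apply Nat.choose_le_choose
    have h1 := le_card_sdiff ((J ∪ V) ∪ (J ∪ V).image σ) (X0 a b)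
    have h2 := card_union_le (J ∪ V) ((J ∪ V).image σ)
    have h3 := card_union_le J V
    have h4 := card_image_le (s := J ∪ V) (f := σ)
    rw [card_X0 a b hab] at h1
    omega
  refine h1.trans ?_
  apply card_le_card_of_injOn (fun p => (p.1 ∪ p.2.2, p.1 ∪ p.2.1))
  · rintro ⟨J, V, W⟩ h
    simp only [T, coe_sigma, Set.mem_sigma_iff, mem_coe, mem_powersetCard] at h
    obtain ⟨⟨hJ1, hJ2⟩, ⟨hV1, hV2⟩, ⟨hW1, hW2⟩⟩ := h
    have hJF : ∀ x ∈ J, x ∈ X0 a b ∧ σ x = x := fun x hx => by simpa [Fx] using hJ1 hx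
    have hVV : ∀ x ∈ V, (x ≠ b ∧ x ≠ σ⁻¹ b) ∧ x ∉ J := by
      intro x hx
      have := hV1 hx
      simpa [Y] using this
    have hWW : ∀ x ∈ W, x ∈ X0 a b ∧ x ∉ J ∪ V ∧ σ⁻¹ x ∉ J ∪ V := by
      intro x hx
      have := hW1 hx
      rw [Finset.mem_sdiff, mem_union, not_or] at this
      refine ⟨this.1, this.2.1, fun h => this.2.2 (mem_image.2 ⟨_, h, by simp⟩)⟩
    have d1 : Disjoint J V := disjoint_right.2 fun x hx => (hVV x hx).2
    have d2 : Disjoint J W := disjoint_right.2 fun x hx h => (hWW x hx).2.1 (mem_union_left _ h)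
    have d3 : Disjoint V W := disjoint_right.2 fun x hx h => (hWW x hx).2.1 (mem_union_right _ h)
    rw [mem_coe, GP, mem_filter, mem_product, mem_powersetCard, mem_powersetCard]
    refine ⟨⟨⟨?_, ?_⟩, ⟨?_, ?_⟩⟩, ?_, ?_⟩
    · exact union_subset (fun x hx => (hJF x hx).1) (fun x hx => (hWW x hx).1)
    · simp only []
      rw [card_union_of_disjoint d2]; omega
    · refine union_subset (fun x hx => mem_Xb.2 (mem_X0.1 (hJF x hx).1).2) (fun x hx => mem_Xb.2 (hVV x hx).1.1)
    · simp only []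
      rw [card_union_of_disjoint d1]; omega
    · intro x hx h
      simp only [mem_insert] at hx
      rcases hx with rfl | hx
      · exfalso
        rcases h with h | h
        · rcases mem_union.1 h with h | h
          · exact (mem_X0.1 (hJF _ h).1).2 rfl
          · exact (hVV _ h).1.1 rfl
        · rcases mem_union.1 h with h | h
          · have h2 := hJF _ h
            rw [show σ (σ⁻¹ x) = x by simp] at h2
            exact (mem_X0.1 h2.1).2 h2.2.symm
          · exact (hVV _ h).1.2 rfl
      · rcases mem_union.1 hx with hx | hx
        · exact (hJF x hx).2
        · exfalso
          rcases h with h | h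
          · exact (hWW x hx).2.1 h
          · exact (hWW x hx).2.2 h
    · simp only []
      rw [← union_inter_distrib_left, disjoint_iff_inter_eq_empty.1 d3.symm, union_empty, hJ2]
  · rintro ⟨J, V, W⟩ h ⟨J', V', W'⟩ h' he
    have key : ∀ J V W, (⟨J, V, W⟩ : (_ : Finset α) × (_ : Finset α) × Finset α) ∈ T →
        Disjoint J V ∧ Disjoint J W ∧ Disjoint V W := by
      intro J V W h
      simp only [T, mem_sigma, mem_powersetCard] at h
      obtain ⟨⟨hJ1, hJ2⟩, ⟨hV1, hV2⟩, ⟨hW1, hW2⟩⟩ := h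
      refine ⟨disjoint_right.2 fun x hx => (Finset.mem_sdiff.1 (hV1 hx)).2, disjoint_right.2 fun x hx h => ?_,
        disjoint_right.2 fun x hx h => ?_⟩
      · exact (Finset.mem_sdiff.1 (hW1 hx)).2 (mem_union_left _ (mem_union_left _ h))
      · exact (Finset.mem_sdiff.1 (hW1 hx)).2 (mem_union_left _ (mem_union_right _ h))
    obtain ⟨d1, d2, d3⟩ := key _ _ _ (mem_coe.1 h)
    obtain ⟨d1', d2', d3'⟩ := key _ _ _ (mem_coe.1 h')
    simp only [Prod.mk.injEq] at he
    have eJ : J = J' := by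
      have e : (J ∪ W) ∩ (J ∪ V) = (J' ∪ W') ∩ (J' ∪ V') := by rw [he.1, he.2]
      rw [← union_inter_distrib_left, disjoint_iff_inter_eq_empty.1 d3.symm, union_empty,
        ← union_inter_distrib_left, disjoint_iff_inter_eq_empty.1 d3'.symm, union_empty] at e
      exact e
    subst eJ
    have eV : V = V' := by
      rw [← union_sdiff_cancel_left d1, he.2, union_sdiff_cancel_left d1']
    have eW : W = W' := by
      rw [← union_sdiff_cancel_left d2, he.1, union_sdiff_cancel_left d2']
    subst eV eW
    rfl

noncomputable def cv (s s' : Finset α) (e1 e2 : ℤˣ) (σ : Perm α) : ℝ := ∑ g, Us s e1 g * Us s' e2 (g⁻¹ * σ)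

lemma cv_nonneg (s s' : Finset α) (e1 e2 : ℤˣ) (σ : Perm α) : 0 ≤ cv s s' e1 e2 σ :=
  sum_nonneg fun _ _ => mul_nonneg (Us_nonneg _ _ _) (Us_nonneg _ _ _)

lemma cv_lb (a b : α) (hab : a ≠ b) (σ : Perm α) (e1 e2 : ℤˣ) (hσ : Perm.sign σ = e1 * e2) (u v j : ℕ)
    (huv : u + v + 3 ≤ Fintype.card α) (p : Finset α × Finset α) (hp : p ∈ GP a b σ u v j) :
    2 * ((Fintype.card α - 1 - u - v + j).factorial : ℝ) / ((Fintype.card α - 1 - u).factorial * (Fintype.card α - v).factorial) ≤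
      cv (insert a (X0 a b \ p.1)) (insert b (Xb b \ p.2)) e1 e2 σ := by
  obtain ⟨U, V⟩ := p
  rw [GP, mem_filter, mem_product, mem_powersetCard, mem_powersetCard] at hp
  obtain ⟨⟨⟨hU1, hU2⟩, hV1, hV2⟩, hC, hj⟩ := hp
  simp only at hU1 hU2 hV1 hV2 hC hj ⊢
  have haU : a ∉ U := fun h => (mem_X0.1 (hU1 h)).1 rfl
  have hbU : b ∉ U := fun h => (mem_X0.1 (hU1 h)).2 rfl
  have hbV : b ∉ V := fun h => (mem_Xb.1 (hV1 h)) rfl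
  have e1' : insert a (X0 a b \ U) = (insert b U)ᶜ := by
    ext x
    simp only [mem_insert, Finset.mem_sdiff, mem_X0, mem_compl]
    by_cases hx : x = a
    · subst hx; simp [hab, haU]
    · simp [hx]
  have e2' : insert b (Xb b \ V) = Vᶜ := by
    ext x
    simp only [mem_insert, Finset.mem_sdiff, mem_Xb, mem_compl]
    by_cases hx : x = b
    · subst hx; simp [hbV]
    · simp [hx]
  rw [e1', e2']
  have hcU : (insert b U).card = u + 1 := by rw [card_insert_of_notMem hbU, hU2]
  have hI : ((insert b U)ᶜ ∩ Vᶜ).card = Fintype.card α - 1 - u - v + j := by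
    rw [← compl_union, card_compl]
    have := card_union_add_card_inter (insert b U) V
    rw [insert_inter_of_notMem hbV, hj, hcU, hV2] at this
    have hj2 : j ≤ u := by rw [← hj, ← hU2]; exact card_le_card inter_subset_left
    omega
  have h := dens_lb (insert b U)ᶜ Vᶜ e1 e2 σ hσ (by
    intro x hx h
    simp only [mem_compl, not_not] at hx h
    exact hC x hx h) (by rw [hI]; omega)
  rw [hI, card_compl, card_compl, hcU, hV2] at h
  rw [show Fintype.card α - 1 - u = Fintype.card α - (u + 1) by omega] at h ⊢
  exact h

lemma avg_lb (a b : α) (hab : a ≠ b) (σ : Perm α) (e1 e2 : ℤˣ) (hσ : Perm.sign σ = e1 * e2) (u v k : ℕ)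
    (huv : u + v + 3 ≤ Fintype.card α) (hk : (Fx a b σ).card = k) (hku : k ≤ u) (hkv : k ≤ v) :
    ∑ j ∈ range (k + 1), (k.choose j : ℝ) * ((Fintype.card α - 2 - j).choose (v - j) : ℝ) *
      ((Fintype.card α - 2 - 2 * v).choose (u - j) : ℝ) *
      (2 * ((Fintype.card α - 1 - u - v + j).factorial : ℝ) / ((Fintype.card α - 1 - u).factorial * (Fintype.card α - v).factorial))
    ≤ ∑ A ∈ powersetCard (Fintype.card α - 2 - u) (X0 a b), ∑ B ∈ powersetCard (Fintype.card α - 1 - v) (Xb b),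
      cv (insert a A) (insert b B) e1 e2 σ := by
  rw [← card_X0 a b hab, sum_powersetCard_compl _ _ (by rw [card_X0 a b hab]; omega), card_X0 a b hab]
  have : ∀ U ∈ powersetCard u (X0 a b), ∑ B ∈ powersetCard (Fintype.card α - 1 - v) (Xb b),
      cv (insert a (X0 a b \ U)) (insert b B) e1 e2 σ = ∑ V ∈ powersetCard v (Xb b),
      cv (insert a (X0 a b \ U)) (insert b (Xb b \ V)) e1 e2 σ := by
    intro U _
    rw [← card_Xb b, sum_powersetCard_compl _ _ (by rw [card_Xb b]; omega)]
  rw [sum_congr rfl this, ← sum_product']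
  have h2 : ∑ j ∈ range (k + 1), ∑ p ∈ GP a b σ u v j, cv (insert a (X0 a b \ p.1)) (insert b (Xb b \ p.2)) e1 e2 σ
      ≤ ∑ p ∈ powersetCard u (X0 a b) ×ˢ powersetCard v (Xb b), cv (insert a (X0 a b \ p.1)) (insert b (Xb b \ p.2)) e1 e2 σ := by
    rw [← sum_biUnion]
    · apply sum_le_sum_of_subset_of_nonneg
      · intro p hp
        obtain ⟨j, _, hj⟩ := mem_biUnion.1 hp
        exact (mem_filter.1 hj).1
      · intro _ _ _; exact cv_nonneg _ _ _ _ _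
    · intro i _ j _ hij
      rw [Function.onFun, disjoint_left]
      intro p h1 h2
      exact hij ((mem_filter.1 h1).2.2.symm.trans (mem_filter.1 h2).2.2)
  refine le_trans ?_ h2
  apply sum_le_sum
  intro j hj
  rw [mem_range] at hj
  have h3 := card_GP a b hab σ u v j (by omega) (by omega)
  rw [hk] at h3
  have h4 := card_nsmul_le_sum (GP a b σ u v j) _ _ (cv_lb a b hab σ e1 e2 hσ u v j huv)
  refine le_trans ?_ h4
  rw [nsmul_eq_mul]
  apply mul_le_mul_of_nonneg_right _ (by positivity)
  exact_mod_cast h3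
end
end TT

namespace TT
open Equiv Finset

lemma sj_s0 (r N : ℕ) : ∑ p ∈ range (N + 1), (N.choose p : ℝ) * sj r p = (N : ℝ) ^ r := by
  have h := sum_powerset_sj (α := Fin N) univ r
  rw [sum_powerset_apply_card (fun p => sj r p)] at h
  simpa using h

lemma choose_step (M : ℕ) (f : ℕ → ℝ) :
    ∑ p ∈ range (M + 1 + 1), ((M + 1).choose p : ℝ) * (f p * ((M : ℝ) + 1 - p)) =
      ((M : ℝ) + 1) * ∑ p ∈ range (M + 1), (M.choose p : ℝ) * f p := by
  rw [sum_range_succ]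
  have : ((M : ℝ) + 1 - ((M + 1 : ℕ) : ℝ)) = 0 := by push_cast; ring
  rw [this, mul_zero, mul_zero, add_zero, mul_sum]
  refine sum_congr rfl fun p hp => ?_
  rw [mem_range] at hp
  have h := Nat.choose_mul_succ_eq M p
  have h2 : (M.choose p : ℝ) * ((M : ℝ) + 1) = ((M + 1).choose p : ℝ) * ((M : ℝ) + 1 - p) := by
    have : ((M.choose p * (M + 1) : ℕ) : ℝ) = (((M + 1).choose p * (M + 1 - p) : ℕ) : ℝ) := by rw [h]
    rw [Nat.cast_mul, Nat.cast_mul, Nat.cast_sub (by omega)] at this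
    push_cast at this
    exact this
  linear_combination (-f p) * h2

lemma sj_s1 (r N : ℕ) : ∑ p ∈ range (N + 1), (N.choose p : ℝ) * (sj r p * ((N : ℝ) - p)) = N * ((N : ℝ) - 1) ^ r := by
  cases N with
  | zero => simp
  | succ M =>
    have := choose_step M (sj r)
    rw [sj_s0] at this
    push_cast
    rw [this]; simp

lemma sj_s2 (r N : ℕ) : ∑ p ∈ range (N + 1), (N.choose p : ℝ) * (sj r p * (((N : ℝ) - p) * ((N : ℝ) - 1 - p))) =
    N * ((N : ℝ) - 1) * ((N : ℝ) - 2) ^ r := by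
  cases N with
  | zero => simp
  | succ M =>
    have := choose_step M (fun p => sj r p * ((M : ℝ) - p))
    rw [sj_s1] at this
    push_cast
    rw [show (M : ℝ) + 1 - 1 = M by ring, show (M : ℝ) + 1 - 2 = M - 1 by ring]
    rw [mul_assoc, ← this]
    refine sum_congr rfl fun p _ => by ring

noncomputable def wt (N t r p q : ℕ) : ℝ :=
  (t.choose r : ℝ) * ((N.choose p : ℝ) * sj r p) * (((N + 1).choose q : ℝ) * sj (t - r) q) / (2 * (N : ℝ) + 1) ^ t

noncomputable def EE (N t : ℕ) (φ : ℕ → ℕ → ℕ → ℝ) : ℝ :=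
  ∑ r ∈ range (t + 1), ∑ p ∈ range (N + 1), ∑ q ∈ range (N + 2), wt N t r p q * φ r p q

lemma wt_nonneg (N t r p q : ℕ) : 0 ≤ wt N t r p q := by
  have h1 := sj_nonneg r p
  have h2 := sj_nonneg (t - r) q
  unfold wt; positivity

lemma EE_mono (N t : ℕ) (φ ψ : ℕ → ℕ → ℕ → ℝ) (h : ∀ r ≤ t, ∀ p ≤ N, ∀ q ≤ N + 1, φ r p q ≤ ψ r p q) : EE N t φ ≤ EE N t ψ := by
  apply sum_le_sum; intro r hr
  apply sum_le_sum; intro p hp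
  apply sum_le_sum; intro q hq
  rw [mem_range] at *
  exact mul_le_mul_of_nonneg_left (h r (by omega) p (by omega) q (by omega)) (wt_nonneg _ _ _ _ _)

lemma EE_add (N t : ℕ) (φ ψ : ℕ → ℕ → ℕ → ℝ) : EE N t (fun r p q => φ r p q + ψ r p q) = EE N t φ + EE N t ψ := by
  simp only [EE, mul_add, sum_add_distrib]

lemma EE_smul (N t : ℕ) (c : ℝ) (φ : ℕ → ℕ → ℕ → ℝ) : EE N t (fun r p q => c * φ r p q) = c * EE N t φ := by
  simp only [EE, mul_sum]
  refine sum_congr rfl fun r _ => sum_congr rfl fun p _ => sum_congr rfl fun q _ => by ring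

lemma EE_prod (N t : ℕ) (h : ℕ → ℝ) (f g : ℕ → ℝ) : EE N t (fun r p q => h r * f p * g q) =
    (∑ r ∈ range (t + 1), h r * (∑ p ∈ range (N + 1), (N.choose p : ℝ) * (sj r p * f p)) *
      (∑ q ∈ range (N + 2), ((N + 1).choose q : ℝ) * (sj (t - r) q * g q)) * (t.choose r : ℝ)) / (2 * (N : ℝ) + 1) ^ t := by
  rw [EE, sum_div]
  refine sum_congr rfl fun r _ => ?_
  rw [mul_assoc (h r), sum_mul_sum, mul_sum, sum_mul, sum_div]
  refine sum_congr rfl fun p _ => ?_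
  rw [mul_sum, sum_mul, sum_div]
  refine sum_congr rfl fun q _ => ?_
  rw [wt]; ring

lemma EE_r (N t : ℕ) (x y : ℝ) : EE N t (fun r _ _ => x ^ r * y ^ (t - r)) = ((x * N + y * (N + 1)) / (2 * N + 1)) ^ t := by
  have := EE_prod N t (fun r => x ^ r * y ^ (t - r)) (fun _ => 1) (fun _ => 1)
  simp only [mul_one] at this
  rw [this]
  have h2 : ∀ r, ∑ q ∈ range (N + 2), ((N + 1).choose q : ℝ) * sj (t - r) q = ((N : ℝ) + 1) ^ (t - r) := by
    intro r; have := sj_s0 (t - r) (N + 1); push_cast at this; exact this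
  simp only [sj_s0, h2]
  rw [div_pow]
  congr 1
  rw [add_pow]
  refine sum_congr rfl fun r _ => ?_
  rw [mul_pow, mul_pow]; ring

lemma EE_one (N t : ℕ) : EE N t (fun _ _ _ => 1) = 1 := by
  have := EE_r N t 1 1
  simp only [one_pow, mul_one, one_mul] at this
  rw [this, show (N : ℝ) + (N + 1) = 2 * N + 1 by ring, div_self (by positivity), one_pow]

/-- moments of the number of missing points, first set -/
lemma EE_u1 (N t : ℕ) : EE N t (fun _ p _ => (N : ℝ) - p) = N * (2 * (N : ℝ) / (2 * N + 1)) ^ t := by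
  have := EE_prod N t (fun r => 1) (fun p => (N : ℝ) - p) (fun _ => 1)
  simp only [mul_one, one_mul] at this
  rw [this]
  have h2 : ∀ r, ∑ q ∈ range (N + 2), ((N + 1).choose q : ℝ) * sj (t - r) q = ((N : ℝ) + 1) ^ (t - r) := by
    intro r; have := sj_s0 (t - r) (N + 1); push_cast at this; exact this
  simp only [sj_s1, h2]
  rw [div_pow, mul_div_assoc']
  congr 1
  rw [show 2 * (N : ℝ) = (N - 1) + (N + 1) by ring, add_pow, mul_sum]
  refine sum_congr rfl fun r _ => by ring

lemma EE_u2 (N t : ℕ) : EE N t (fun _ p _ => ((N : ℝ) - p) * ((N : ℝ) - 1 - p)) = N * ((N : ℝ) - 1) * ((2 * (N : ℝ) - 1) / (2 * N + 1)) ^ t := by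
  have := EE_prod N t (fun r => 1) (fun p => ((N : ℝ) - p) * ((N : ℝ) - 1 - p)) (fun _ => 1)
  simp only [mul_one, one_mul] at this
  rw [this]
  have h2 : ∀ r, ∑ q ∈ range (N + 2), ((N + 1).choose q : ℝ) * sj (t - r) q = ((N : ℝ) + 1) ^ (t - r) := by
    intro r; have := sj_s0 (t - r) (N + 1); push_cast at this; exact this
  simp only [sj_s2, h2]
  rw [div_pow, mul_div_assoc']
  congr 1
  rw [show 2 * (N : ℝ) - 1 = (N - 2) + (N + 1) by ring, add_pow, mul_sum]
  refine sum_congr rfl fun r _ => by ring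

lemma EE_v1 (N t : ℕ) : EE N t (fun _ _ q => (N : ℝ) + 1 - q) = ((N : ℝ) + 1) * (2 * (N : ℝ) / (2 * N + 1)) ^ t := by
  have := EE_prod N t (fun r => 1) (fun _ => 1) (fun q => (N : ℝ) + 1 - q)
  simp only [mul_one, one_mul] at this
  rw [this]
  have h2 : ∀ r, ∑ q ∈ range (N + 2), ((N + 1).choose q : ℝ) * (sj (t - r) q * ((N : ℝ) + 1 - q)) = ((N : ℝ) + 1) * (N : ℝ) ^ (t - r) := by
    intro r; have := sj_s1 (t - r) (N + 1); push_cast at this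
    rw [show (N : ℝ) + 1 - 1 = N by ring] at this; exact this
  simp only [sj_s0, h2]
  rw [div_pow, mul_div_assoc']
  congr 1
  rw [two_mul, add_pow, mul_sum]
  refine sum_congr rfl fun r _ => by ring

lemma EE_v2 (N t : ℕ) : EE N t (fun _ _ q => ((N : ℝ) + 1 - q) * ((N : ℝ) - q)) = ((N : ℝ) + 1) * N * ((2 * (N : ℝ) - 1) / (2 * N + 1)) ^ t := by
  have := EE_prod N t (fun r => 1) (fun _ => 1) (fun q => ((N : ℝ) + 1 - q) * ((N : ℝ) - q))
  simp only [mul_one, one_mul] at this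
  rw [this]
  have h2 : ∀ r, ∑ q ∈ range (N + 2), ((N + 1).choose q : ℝ) * (sj (t - r) q * (((N : ℝ) + 1 - q) * ((N : ℝ) - q))) = ((N : ℝ) + 1) * N * ((N : ℝ) - 1) ^ (t - r) := by
    intro r; have := sj_s2 (t - r) (N + 1); push_cast at this
    rw [show (N : ℝ) + 1 - 1 = N by ring, show (N : ℝ) + 1 - 2 = N - 1 by ring] at this; exact this
  simp only [sj_s0, h2]
  rw [div_pow, mul_div_assoc']
  congr 1
  rw [show 2 * (N : ℝ) - 1 = N + (N - 1) by ring, add_pow, mul_sum]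
  refine sum_congr rfl fun r _ => by ring

lemma theta_le (N t : ℕ) (hN : 1 ≤ N) : ((2 * (N : ℝ) - 1) / (2 * N + 1)) ^ t ≤ ((2 * (N : ℝ) / (2 * N + 1)) ^ t) ^ 2 := by
  rw [← pow_mul, mul_comm t 2, pow_mul]
  have h1 : (1 : ℝ) ≤ N := by exact_mod_cast hN
  apply pow_le_pow_left₀
  · apply div_nonneg <;> linarith
  · rw [div_pow, div_le_div_iff₀ (by positivity) (by positivity)]; nlinarith

lemma EE_usq (N t : ℕ) (hN : 1 ≤ N) (x : ℝ) : EE N t (fun _ p _ => ((N : ℝ) - p - x) ^ 2) ≤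
    (N * (2 * (N : ℝ) / (2 * N + 1)) ^ t - x) ^ 2 + N * (2 * (N : ℝ) / (2 * N + 1)) ^ t := by
  have h1 : (1 : ℝ) ≤ N := by exact_mod_cast hN
  have e : (fun (_ p _ : ℕ) => ((N : ℝ) - p - x) ^ 2) = fun (_ p _ : ℕ) => ((N : ℝ) - p) * ((N : ℝ) - 1 - p) + ((1 - 2 * x) * ((N : ℝ) - p) + x ^ 2 * 1) := by
    funext _ p _; ring
  rw [e, EE_add, EE_add, EE_smul, EE_smul, EE_u1, EE_u2, EE_one]
  have h2 := theta_le N t hN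
  set θ := (2 * (N : ℝ) / (2 * N + 1)) ^ t
  have h3 : N * ((N : ℝ) - 1) * ((2 * (N : ℝ) - 1) / (2 * N + 1)) ^ t ≤ N * N * θ ^ 2 := by
    apply mul_le_mul _ h2 _ (by positivity)
    · nlinarith
    · apply pow_nonneg; apply div_nonneg <;> linarith
  nlinarith

lemma EE_vsq (N t : ℕ) (hN : 1 ≤ N) (x : ℝ) : EE N t (fun _ _ q => ((N : ℝ) + 1 - q - x) ^ 2) ≤
    (((N : ℝ) + 1) * (2 * (N : ℝ) / (2 * N + 1)) ^ t - x) ^ 2 + ((N : ℝ) + 1) * (2 * (N : ℝ) / (2 * N + 1)) ^ t := by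
  have h1 : (1 : ℝ) ≤ N := by exact_mod_cast hN
  have e : (fun (_ _ q : ℕ) => ((N : ℝ) + 1 - q - x) ^ 2) = fun (_ _ q : ℕ) => ((N : ℝ) + 1 - q) * ((N : ℝ) - q) + ((1 - 2 * x) * ((N : ℝ) + 1 - q) + x ^ 2 * 1) := by
    funext _ _ q; ring
  rw [e, EE_add, EE_add, EE_smul, EE_smul, EE_v1, EE_v2, EE_one]
  have h2 := theta_le N t hN
  set θ := (2 * (N : ℝ) / (2 * N + 1)) ^ t
  have h3 : ((N : ℝ) + 1) * N * ((2 * (N : ℝ) - 1) / (2 * N + 1)) ^ t ≤ ((N : ℝ) + 1) * (N + 1) * θ ^ 2 := by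
    apply mul_le_mul _ h2 _ (by positivity)
    · nlinarith
    · apply pow_nonneg; apply div_nonneg <;> linarith
  nlinarith

lemma EE_rlow (N t : ℕ) (hN : 2 ≤ N) : EE N t (fun r _ _ => if 6 * r < t then 1 else 0) ≤ (9 / 10 : ℝ) ^ t := by
  have h1 : (2 : ℝ) ≤ N := by exact_mod_cast hN
  have h := EE_r N t ((9 / 8) * (8 / 9) ^ 6) (9 / 8)
  refine (EE_mono N t _ (fun r _ _ => ((9 / 8 : ℝ) * (8 / 9) ^ 6) ^ r * (9 / 8) ^ (t - r)) ?_).trans (h.le.trans ?_)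
  · intro r hr p _ q _
    split_ifs with h2
    · rw [mul_pow, mul_right_comm, ← pow_add, Nat.add_sub_cancel' hr, ← pow_mul]
      obtain ⟨d, rfl⟩ := Nat.exists_eq_add_of_lt h2
      rw [add_assoc, pow_add, mul_right_comm, ← mul_pow]
      norm_num
      exact one_le_pow₀ (by norm_num)
    · positivity
  · apply pow_le_pow_left₀ (by positivity)
    rw [div_le_iff₀ (by positivity)]
    norm_num
    nlinarith

lemma EE_rhigh (N t : ℕ) (hN : 2 ≤ N) : EE N t (fun r _ _ => if 6 * (t - r) < t then 1 else 0) ≤ (9 / 10 : ℝ) ^ t := by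
  have h1 : (2 : ℝ) ≤ N := by exact_mod_cast hN
  have h := EE_r N t (9 / 8) ((9 / 8) * (8 / 9) ^ 6)
  refine (EE_mono N t _ (fun r _ _ => (9 / 8 : ℝ) ^ r * ((9 / 8) * (8 / 9) ^ 6) ^ (t - r)) ?_).trans (h.le.trans ?_)
  · intro r hr p _ q _
    split_ifs with h2
    · rw [mul_pow, ← mul_assoc, ← pow_add, Nat.add_sub_cancel' hr, ← pow_mul]
      generalize t - r = s at h2
      obtain ⟨d, rfl⟩ := Nat.exists_eq_add_of_lt h2
      rw [add_assoc, pow_add, mul_right_comm, ← mul_pow]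
      norm_num
      exact one_le_pow₀ (by norm_num)
    · positivity
  · apply pow_le_pow_left₀ (by positivity)
    rw [div_le_iff₀ (by positivity)]
    norm_num
    nlinarith
end TT

namespace TT
open Equiv Finset Topology

noncomputable def tt (c : ℝ) (n : ℕ) : ℕ := ⌈((n : ℝ) - 3 / 2) * Real.log n + c * n⌉₊

lemma logdiv_lim : Tendsto (fun N : ℕ => Real.log ((N + 2 : ℕ) : ℝ) / ((N + 2 : ℕ) : ℝ)) atTop (𝓝 0) := by
  have h := Real.isLittleO_log_id_atTop.tendsto_div_nhds_zero
  have h2 : Tendsto (fun N : ℕ => ((N + 2 : ℕ) : ℝ)) atTop atTop :=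
    tendsto_natCast_atTop_atTop.comp (tendsto_add_atTop_nat 2)
  exact h.comp h2

lemma n_inf : Tendsto (fun N : ℕ => ((N + 2 : ℕ) : ℝ)) atTop atTop :=
    tendsto_natCast_atTop_atTop.comp (tendsto_add_atTop_nat 2)

lemma ninv_lim : Tendsto (fun N : ℕ => 1 / ((N + 2 : ℕ) : ℝ)) atTop (𝓝 0) := by
  simp only [one_div]; exact tendsto_inv_atTop_zero.comp n_inf

lemma tt_big (c : ℝ) : ∀ᶠ N : ℕ in atTop, (1 / 2) * ((N + 2 : ℕ) : ℝ) * Real.log ((N + 2 : ℕ) : ℝ) ≤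
    ((((N + 2 : ℕ) : ℝ)) - 3 / 2) * Real.log ((N + 2 : ℕ) : ℝ) + c * ((N + 2 : ℕ) : ℝ) := by
  have hlog : Tendsto (fun N : ℕ => Real.log ((N + 2 : ℕ) : ℝ)) atTop atTop := Real.tendsto_log_atTop.comp n_inf
  filter_upwards [hlog.eventually_ge_atTop (4 * |c|), n_inf.eventually_ge_atTop 6] with N h1 h2
  have h3 := neg_abs_le c
  have h4 := abs_nonneg c
  nlinarith

lemma tt_lim_aux (c : ℝ) : Tendsto (fun N : ℕ => (tt c (N + 2) : ℝ) / (((N + 2 : ℕ) : ℝ)) ^ 2) atTop (𝓝 0) := by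
  have l1 := logdiv_lim
  have l2 := ninv_lim
  have : Tendsto (fun N : ℕ => Real.log ((N + 2 : ℕ) : ℝ) / ((N + 2 : ℕ) : ℝ) + |c| * (1 / ((N + 2 : ℕ) : ℝ)) + (1 / ((N + 2 : ℕ) : ℝ)) * (1 / ((N + 2 : ℕ) : ℝ))) atTop (𝓝 (0 + |c| * 0 + 0 * 0)) :=
    ((l1.add (l2.const_mul _)).add (l2.mul l2))
  simp only [mul_zero, add_zero] at this
  refine squeeze_zero' (Eventually.of_forall fun N => by positivity) ?_ this
  filter_upwards [tt_big c] with N hN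
  have hn : (0 : ℝ) < ((N + 2 : ℕ) : ℝ) := by positivity
  have hl : 0 ≤ Real.log ((N + 2 : ℕ) : ℝ) := Real.log_natCast_nonneg _
  have h0 : 0 ≤ (((N + 2 : ℕ) : ℝ) - 3 / 2) * Real.log ((N + 2 : ℕ) : ℝ) + c * ((N + 2 : ℕ) : ℝ) := le_trans (by positivity) hN
  have h1 := (Nat.ceil_lt_add_one h0).le
  rw [div_le_iff₀ (by positivity)]
  refine h1.trans ?_
  generalize Real.log ((N + 2 : ℕ) : ℝ) = l at *
  generalize ((N + 2 : ℕ) : ℝ) = x at *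
  have e : (l / x + |c| * (1 / x) + 1 / x * (1 / x)) * x ^ 2 = l * x + |c| * x + 1 := by field_simp
  rw [e]
  nlinarith [le_abs_self c]

lemma theta_lim (c : ℝ) : Tendsto (fun N : ℕ => Real.sqrt ((N + 2 : ℕ) : ℝ) * (2 * (N : ℝ) / (2 * N + 1)) ^ (tt c (N + 2))) atTop
    (𝓝 (Real.exp (-c / 2))) := by
  have l2 := ninv_lim
  have hfrac : Tendsto (fun N : ℕ => ((N + 2 : ℕ) : ℝ) / (2 * (N : ℝ) + 1)) atTop (𝓝 (1 / 2)) := by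
    have : Tendsto (fun N : ℕ => 1 / (2 - 3 * (1 / ((N + 2 : ℕ) : ℝ)))) atTop (𝓝 (1 / (2 - 3 * 0))) :=
      tendsto_const_nhds.div (tendsto_const_nhds.sub (l2.const_mul _)) (by norm_num)
    simp only [mul_zero, sub_zero] at this
    refine this.congr fun N => ?_
    have : (2 : ℝ) * N + 1 = 2 * ((N + 2 : ℕ) : ℝ) - 3 := by push_cast; ring
    rw [this]
    have hn : (0 : ℝ) < ((N + 2 : ℕ) : ℝ) := by positivity
    have : 2 * ((N + 2 : ℕ) : ℝ) - 3 ≠ 0 := by rw [← this]; positivity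
    field_simp
  have hinv : Tendsto (fun N : ℕ => 1 / (2 * (N : ℝ) + 1)) atTop (𝓝 0) := by
    have := hfrac.mul l2
    rw [mul_zero] at this
    refine this.congr fun N => ?_
    have hn : (0 : ℝ) < ((N + 2 : ℕ) : ℝ) := by positivity
    field_simp
  have key : Tendsto (fun N : ℕ => (tt c (N + 2) : ℝ) * Real.log (1 + 1 / (2 * (N : ℝ))) - (1 / 2) * Real.log ((N + 2 : ℕ) : ℝ)) atTop (𝓝 (c / 2)) := by
    have low : Tendsto (fun N : ℕ => c * (((N + 2 : ℕ) : ℝ) / (2 * (N : ℝ) + 1))) atTop (𝓝 (c / 2)) := by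
      have := hfrac.const_mul c
      rwa [mul_one_div] at this
    have up : Tendsto (fun N : ℕ => c * (((N + 2 : ℕ) : ℝ) / (2 * (N : ℝ) + 1)) + 1 / (2 * (N : ℝ) + 1) + (tt c (N + 2) : ℝ) / (((N + 2 : ℕ) : ℝ)) ^ 2) atTop (𝓝 (c / 2)) := by
      have := (low.add hinv).add (tt_lim_aux c)
      simpa using this
    refine tendsto_of_tendsto_of_tendsto_of_le_of_le' low up ?_ ?_
    · filter_upwards [eventually_ge_atTop 1] with N hN
      have hN' : (1 : ℝ) ≤ N := by exact_mod_cast hN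
      have h1 : 1 / (2 * (N : ℝ) + 1) ≤ Real.log (1 + 1 / (2 * (N : ℝ))) := by
        have := Real.one_sub_inv_le_log_of_pos (x := 1 + 1 / (2 * (N : ℝ))) (by positivity)
        refine le_trans (le_of_eq ?_) this
        field_simp; ring
      have h2 := Nat.le_ceil ((((N + 2 : ℕ) : ℝ) - 3 / 2) * Real.log ((N + 2 : ℕ) : ℝ) + c * ((N + 2 : ℕ) : ℝ))
      have h3 : (tt c (N + 2) : ℝ) * (1 / (2 * (N : ℝ) + 1)) ≤ (tt c (N + 2) : ℝ) * Real.log (1 + 1 / (2 * (N : ℝ))) :=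
        mul_le_mul_of_nonneg_left h1 (by positivity)
      have h4 : ((((N + 2 : ℕ) : ℝ) - 3 / 2) * Real.log ((N + 2 : ℕ) : ℝ) + c * ((N + 2 : ℕ) : ℝ)) * (1 / (2 * (N : ℝ) + 1)) ≤ (tt c (N + 2) : ℝ) * (1 / (2 * (N : ℝ) + 1)) :=
        mul_le_mul_of_nonneg_right h2 (by positivity)
      have e : ((((N + 2 : ℕ) : ℝ) - 3 / 2) * Real.log ((N + 2 : ℕ) : ℝ) + c * ((N + 2 : ℕ) : ℝ)) * (1 / (2 * (N : ℝ) + 1)) = (1 / 2) * Real.log ((N + 2 : ℕ) : ℝ) + c * (((N + 2 : ℕ) : ℝ) / (2 * (N : ℝ) + 1)) := by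
        rw [show ((N + 2 : ℕ) : ℝ) - 3 / 2 = (2 * N + 1) / 2 by push_cast; ring]
        field_simp
      linarith
    · filter_upwards [eventually_ge_atTop 4, tt_big c] with N hN hb
      have hN' : (4 : ℝ) ≤ N := by exact_mod_cast hN
      have h1 : Real.log (1 + 1 / (2 * (N : ℝ))) ≤ 1 / (2 * (N : ℝ) + 1) + 1 / (((N + 2 : ℕ) : ℝ)) ^ 2 := by
        have := Real.log_le_sub_one_of_pos (x := 1 + 1 / (2 * (N : ℝ))) (by positivity)
        refine this.trans ?_
        push_cast
        have e : 1 + 1 / (2 * (N : ℝ)) - 1 = 1 / (2 * (N : ℝ) + 1) + 1 / (2 * N * (2 * N + 1)) := by field_simp; ring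
        rw [e]
        gcongr
        nlinarith
      have hl : 0 ≤ Real.log ((N + 2 : ℕ) : ℝ) := Real.log_natCast_nonneg _
      have h0 : 0 ≤ (((N + 2 : ℕ) : ℝ) - 3 / 2) * Real.log ((N + 2 : ℕ) : ℝ) + c * ((N + 2 : ℕ) : ℝ) := le_trans (by positivity) hb
      have h2 := (Nat.ceil_lt_add_one h0).le
      have h3 : (tt c (N + 2) : ℝ) * Real.log (1 + 1 / (2 * (N : ℝ))) ≤ (tt c (N + 2) : ℝ) * (1 / (2 * (N : ℝ) + 1) + 1 / (((N + 2 : ℕ) : ℝ)) ^ 2) :=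
        mul_le_mul_of_nonneg_left h1 (by positivity)
      have h4 : (tt c (N + 2) : ℝ) * (1 / (2 * (N : ℝ) + 1)) ≤ ((((N + 2 : ℕ) : ℝ) - 3 / 2) * Real.log ((N + 2 : ℕ) : ℝ) + c * ((N + 2 : ℕ) : ℝ) + 1) * (1 / (2 * (N : ℝ) + 1)) :=
        mul_le_mul_of_nonneg_right h2 (by positivity)
      have e : ((((N + 2 : ℕ) : ℝ) - 3 / 2) * Real.log ((N + 2 : ℕ) : ℝ) + c * ((N + 2 : ℕ) : ℝ) + 1) * (1 / (2 * (N : ℝ) + 1)) = (1 / 2) * Real.log ((N + 2 : ℕ) : ℝ) + c * (((N + 2 : ℕ) : ℝ) / (2 * (N : ℝ) + 1)) + 1 / (2 * (N : ℝ) + 1) := by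
        rw [show ((N + 2 : ℕ) : ℝ) - 3 / 2 = (2 * N + 1) / 2 by push_cast; ring]
        field_simp
      rw [mul_add, mul_one_div _ ((((N + 2 : ℕ) : ℝ)) ^ 2)] at h3
      linarith
  have h5 := (Real.continuous_exp.tendsto _).comp key.neg
  rw [show -(c / 2) = -c / 2 by ring] at h5
  refine h5.congr' ?_
  filter_upwards [eventually_ge_atTop 1] with N hN
  have hN' : (1 : ℝ) ≤ N := by exact_mod_cast hN
  have hn : (0 : ℝ) < ((N + 2 : ℕ) : ℝ) := by positivity
  have e1 : Real.sqrt ((N + 2 : ℕ) : ℝ) = Real.exp ((1 / 2) * Real.log ((N + 2 : ℕ) : ℝ)) := by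
    rw [Real.sqrt_eq_rpow, Real.rpow_def_of_pos hn, mul_comm]
  have e2 : 2 * (N : ℝ) / (2 * N + 1) = Real.exp (-Real.log (1 + 1 / (2 * (N : ℝ)))) := by
    rw [Real.exp_neg, Real.exp_log (by positivity)]; field_simp
  rw [e1, e2, ← Real.exp_nat_mul, ← Real.exp_add, Function.comp]
  congr 1; ring

noncomputable def Good (N t : ℕ) (s η : ℝ) (r p q : ℕ) : Prop :=
  t ≤ 6 * r ∧ t ≤ 6 * (t - r) ∧ |(N : ℝ) - p - s * Real.sqrt ((N + 2 : ℕ) : ℝ)| < η * Real.sqrt ((N + 2 : ℕ) : ℝ) ∧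
    |(N : ℝ) + 1 - q - s * Real.sqrt ((N + 2 : ℕ) : ℝ)| < η * Real.sqrt ((N + 2 : ℕ) : ℝ)

lemma tt_inf (c : ℝ) : Tendsto (fun N : ℕ => tt c (N + 2)) atTop atTop := by
  rw [← tendsto_natCast_atTop_iff (R := ℝ)]
  have hlog : Tendsto (fun N : ℕ => Real.log ((N + 2 : ℕ) : ℝ)) atTop atTop := Real.tendsto_log_atTop.comp n_inf
  refine tendsto_atTop_mono' _ ?_ hlog
  filter_upwards [tt_big c] with N hN
  have hl : 0 ≤ Real.log ((N + 2 : ℕ) : ℝ) := Real.log_natCast_nonneg _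
  refine le_trans ?_ (hN.trans (Nat.le_ceil _))
  push_cast
  push_cast at hl
  nlinarith [(Nat.cast_nonneg N : (0 : ℝ) ≤ N), mul_nonneg (Nat.cast_nonneg N : (0 : ℝ) ≤ N) hl]

lemma gen_aux (η x θ s d : ℝ) (hη : 0 < η) (hx : 0 < x) :
    1 / η ^ 2 * (((1 - d * (1 / (x * x))) * (x * θ) - s) ^ 2 + (1 - d * (1 / (x * x))) * (x * θ) * (1 / x)) =
      (1 / (η ^ 2 * (x * x))) * (((x * x - d) * θ - s * x) ^ 2 + (x * x - d) * θ) := by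
  field_simp

lemma good_prob (c η : ℝ) (hη : 0 < η) :
    Tendsto (fun N : ℕ => EE N (tt c (N + 2)) (fun r p q => if Good N (tt c (N + 2)) (Real.exp (-c / 2)) η r p q then 1 else 0))
      atTop (𝓝 1) := by
  set s := Real.exp (-c / 2)
  have hth := theta_lim c
  have l2 := ninv_lim
  have h9 : Tendsto (fun N : ℕ => (9 / 10 : ℝ) ^ (tt c (N + 2))) atTop (𝓝 0) :=
    (tendsto_pow_atTop_nhds_zero_of_lt_one (by norm_num) (by norm_num)).comp (tt_inf c)
  set Y : ℕ → ℝ := fun N => Real.sqrt ((N + 2 : ℕ) : ℝ) * (2 * (N : ℝ) / (2 * N + 1)) ^ (tt c (N + 2)) with hY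
  -- variance terms over n
  have hsq : Tendsto (fun N : ℕ => 1 / Real.sqrt ((N + 2 : ℕ) : ℝ)) atTop (𝓝 0) := by
    simp only [one_div]
    exact tendsto_inv_atTop_zero.comp (Real.tendsto_sqrt_atTop.comp n_inf)
  have hu : Tendsto (fun N : ℕ => ((1 - 2 * (1 / ((N + 2 : ℕ) : ℝ))) * Y N - s) ^ 2 + (1 - 2 * (1 / ((N + 2 : ℕ) : ℝ))) * Y N * (1 / Real.sqrt ((N + 2 : ℕ) : ℝ)))
      atTop (𝓝 (((1 - 2 * 0) * s - s) ^ 2 + (1 - 2 * 0) * s * 0)) :=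
    ((((tendsto_const_nhds.sub (l2.const_mul 2)).mul hth).sub_const s).pow 2).add (((tendsto_const_nhds.sub (l2.const_mul 2)).mul hth).mul hsq)
  have hv : Tendsto (fun N : ℕ => ((1 - 1 * (1 / ((N + 2 : ℕ) : ℝ))) * Y N - s) ^ 2 + (1 - 1 * (1 / ((N + 2 : ℕ) : ℝ))) * Y N * (1 / Real.sqrt ((N + 2 : ℕ) : ℝ)))
      atTop (𝓝 (((1 - 1 * 0) * s - s) ^ 2 + (1 - 1 * 0) * s * 0)) :=
    ((((tendsto_const_nhds.sub (l2.const_mul 1)).mul hth).sub_const s).pow 2).add (((tendsto_const_nhds.sub (l2.const_mul 1)).mul hth).mul hsq)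
  have hbad := ((tendsto_const_nhds (x := (1 : ℝ))).sub (((h9.add h9).add (hu.const_mul (1 / η ^ 2))).add (hv.const_mul (1 / η ^ 2))))
  have e0 : (1 : ℝ) - (0 + 0 + 1 / η ^ 2 * (((1 - 2 * 0) * s - s) ^ 2 + (1 - 2 * 0) * s * 0) + 1 / η ^ 2 * (((1 - 1 * 0) * s - s) ^ 2 + (1 - 1 * 0) * s * 0)) = 1 := by ring
  rw [e0] at hbad
  refine tendsto_of_tendsto_of_tendsto_of_le_of_le' hbad tendsto_const_nhds ?_ ?_
  · filter_upwards [eventually_ge_atTop 2] with N hN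
    set t := tt c (N + 2)
    set n : ℝ := ((N + 2 : ℕ) : ℝ) with hn'
    have hn : 0 < n := by positivity
    have hsn : Real.sqrt n * Real.sqrt n = n := Real.mul_self_sqrt hn.le
    have hsp : 0 < Real.sqrt n := Real.sqrt_pos.2 hn
    set θ := (2 * (N : ℝ) / (2 * N + 1)) ^ t
    have hle : EE N t (fun _ _ _ => 1) ≤ EE N t (fun r p q => ((((if Good N t s η r p q then (1 : ℝ) else 0) + (if 6 * r < t then 1 else 0)) + (if 6 * (t - r) < t then 1 else 0)) + (1 / (η ^ 2 * n)) * ((N : ℝ) - p - s * Real.sqrt n) ^ 2) + (1 / (η ^ 2 * n)) * ((N : ℝ) + 1 - q - s * Real.sqrt n) ^ 2) := by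
      apply EE_mono
      intro r _ p _ q _
      have p1 : 0 ≤ (1 / (η ^ 2 * n)) * ((N : ℝ) - p - s * Real.sqrt n) ^ 2 := by positivity
      have p2 : 0 ≤ (1 / (η ^ 2 * n)) * ((N : ℝ) + 1 - q - s * Real.sqrt n) ^ 2 := by positivity
      have big : ∀ x : ℝ, η * Real.sqrt n ≤ |x| → 1 ≤ (1 / (η ^ 2 * n)) * x ^ 2 := by
        intro x hx
        rw [one_div, inv_mul_eq_div, one_le_div (by positivity)]
        have := mul_self_le_mul_self (by positivity) hx
        rw [abs_mul_abs_self] at this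
        calc η ^ 2 * n = η * Real.sqrt n * (η * Real.sqrt n) := by linear_combination (-η ^ 2) * hsn
          _ ≤ x ^ 2 := by rw [sq]; exact this
      by_cases g1 : 6 * r < t
      · rw [if_pos g1]; split_ifs <;> linarith
      by_cases g2 : 6 * (t - r) < t
      · rw [if_pos g2]; split_ifs <;> linarith
      by_cases g3 : η * Real.sqrt n ≤ |(N : ℝ) - p - s * Real.sqrt n|
      · have := big _ g3; split_ifs <;> linarith
      by_cases g4 : η * Real.sqrt n ≤ |(N : ℝ) + 1 - q - s * Real.sqrt n|
      · have := big _ g4; split_ifs <;> linarith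
      rw [if_pos (show Good N t s η r p q from ⟨by omega, by omega, lt_of_not_ge g3, lt_of_not_ge g4⟩)]
      split_ifs; linarith
    rw [EE_one, EE_add, EE_add, EE_add, EE_add, EE_smul, EE_smul] at hle
    have b1 := EE_rlow N t hN
    have b2 := EE_rhigh N t hN
    have b3 := EE_usq N t (by omega) (s * Real.sqrt n)
    have b4 := EE_vsq N t (by omega) (s * Real.sqrt n)
    have k1 : (N : ℝ) = n - 2 := by rw [hn']; push_cast; ring
    have hYN : Y N = Real.sqrt n * θ := rfl
    have gen : ∀ d : ℝ, 1 / η ^ 2 * (((1 - d * (1 / n)) * Y N - s) ^ 2 + (1 - d * (1 / n)) * Y N * (1 / Real.sqrt n)) =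
        (1 / (η ^ 2 * n)) * (((n - d) * θ - s * Real.sqrt n) ^ 2 + (n - d) * θ) := by
      intro d
      rw [hYN]
      have := gen_aux η (Real.sqrt n) θ s d hη hsp
      rw [hsn] at this
      exact this
    rw [gen, gen]
    have c3 := mul_le_mul_of_nonneg_left b3 (show 0 ≤ 1 / (η ^ 2 * n) by positivity)
    have c4 := mul_le_mul_of_nonneg_left b4 (show 0 ≤ 1 / (η ^ 2 * n) by positivity)
    change _ ≤ (1 / (η ^ 2 * n)) * ((N * θ - s * Real.sqrt n) ^ 2 + N * θ) at c3
    change _ ≤ (1 / (η ^ 2 * n)) * (((N + 1) * θ - s * Real.sqrt n) ^ 2 + (N + 1) * θ) at c4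
    rw [show (N : ℝ) * θ = (n - 2) * θ by rw [k1]] at c3
    rw [show ((N : ℝ) + 1) * θ = (n - 1) * θ by rw [k1]; ring] at c4
    linarith
  · refine Eventually.of_forall fun N => ?_
    refine (EE_mono N _ _ (fun _ _ _ => 1) ?_).trans (EE_one N _).le
    intro r _ p _ q _
    split_ifs <;> norm_num
end TT

namespace TT
open Equiv Finset Topology

lemma rl1 (M v j : ℕ) (hj : j ≤ v) (hv : v ≤ M) (x : ℝ) (hx : (M : ℝ) ≤ x) (hx0 : 0 < x) :
    (M.choose v : ℝ) * (((v : ℝ) - j) / x) ^ j ≤ ((M - j).choose (v - j) : ℝ) := by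
  have h1 := Nat.choose_mul (n := M) hj
  have h2 : (M.choose j : ℝ) * j.factorial ≤ x ^ j := by
    have := Nat.descFactorial_le_pow M j
    rw [Nat.descFactorial_eq_factorial_mul_choose] at this
    have h3 : ((j.factorial * M.choose j : ℕ) : ℝ) ≤ ((M ^ j : ℕ) : ℝ) := by exact_mod_cast this
    push_cast at h3
    calc _ = (j.factorial : ℝ) * M.choose j := mul_comm _ _
      _ ≤ (M : ℝ) ^ j := h3
      _ ≤ x ^ j := pow_le_pow_left₀ (by positivity) hx _
  have h4 : ((v : ℝ) - j) ^ j ≤ (v.choose j : ℝ) * j.factorial := by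
    have := Nat.pow_sub_le_descFactorial v j
    rw [Nat.descFactorial_eq_factorial_mul_choose] at this
    have h3 : (((v + 1 - j) ^ j : ℕ) : ℝ) ≤ ((j.factorial * v.choose j : ℕ) : ℝ) := by exact_mod_cast this
    rw [Nat.cast_pow, Nat.cast_sub (by omega)] at h3
    push_cast at h3
    have h5 : ((v : ℝ) - j) ^ j ≤ ((v : ℝ) + 1 - j) ^ j := by
      apply pow_le_pow_left₀
      · rw [sub_nonneg]; exact_mod_cast hj
      · linarith
    linarith
  have h1' : (M.choose v : ℝ) * (v.choose j : ℝ) = (M.choose j : ℝ) * ((M - j).choose (v - j) : ℝ) := by exact_mod_cast h1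
  rw [div_pow, mul_div_assoc', div_le_iff₀ (by positivity)]
  calc (M.choose v : ℝ) * ((v : ℝ) - j) ^ j ≤ (M.choose v : ℝ) * ((v.choose j : ℝ) * j.factorial) := by gcongr
    _ = ((M - j).choose (v - j) : ℝ) * ((M.choose j : ℝ) * j.factorial) := by rw [← mul_assoc, h1']; ring
    _ ≤ _ := by gcongr

lemma rl2 (N v j : ℕ) (hj : j ≤ v) (hv : v ≤ N) :
    ((N + 1 - j).choose (v - j) : ℝ) * (((N : ℝ) + 1 - v) / (N + 2)) ≤ ((N - j).choose (v - j) : ℝ) := by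
  have h := Nat.choose_mul_succ_eq (N - j) (v - j)
  rw [show N - j + 1 = N + 1 - j by omega, show N + 1 - j - (v - j) = N + 1 - v by omega] at h
  have h2 : ((N - j).choose (v - j) : ℝ) * ((N : ℝ) + 1 - j) = ((N + 1 - j).choose (v - j) : ℝ) * ((N : ℝ) + 1 - v) := by
    have : (((N - j).choose (v - j) * (N + 1 - j) : ℕ) : ℝ) = (((N + 1 - j).choose (v - j) * (N + 1 - v) : ℕ) : ℝ) := by rw [h]
    rw [Nat.cast_mul, Nat.cast_mul, Nat.cast_sub (by omega), Nat.cast_sub (by omega)] at this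
    push_cast at this; exact this
  rw [mul_div_assoc', div_le_iff₀ (by positivity), ← h2]
  gcongr
  have : (0 : ℝ) ≤ j := by positivity
  linarith

lemma rl3 (M M' Q q : ℕ) (hq : q ≤ Q) (hQ : Q < M) (hM : M ≤ M') :
    (M'.choose q : ℝ) * (((M : ℝ) - Q) / (M' - Q)) ^ q ≤ (M.choose q : ℝ) := by
  have hQ' : (Q : ℝ) < M := by exact_mod_cast hQ
  have hM' : (M : ℝ) ≤ M' := by exact_mod_cast hM
  have key : ∀ q ≤ Q, (M'.descFactorial q : ℝ) * ((M : ℝ) - Q) ^ q ≤ (M.descFactorial q : ℝ) * ((M' : ℝ) - Q) ^ q := by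
    intro q
    induction q with
    | zero => simp
    | succ q ih =>
      intro hq
      have := ih (by omega)
      rw [Nat.descFactorial_succ, Nat.descFactorial_succ, pow_succ, pow_succ]
      push_cast [Nat.cast_sub (show q ≤ M by omega), Nat.cast_sub (show q ≤ M' by omega)]
      have hqQ : (q : ℝ) ≤ Q := by exact_mod_cast (show q ≤ Q by omega)
      have h1 : ((M' : ℝ) - q) * ((M : ℝ) - Q) ≤ ((M : ℝ) - q) * ((M' : ℝ) - Q) := by nlinarith
      calc _ = ((M'.descFactorial q : ℝ) * ((M : ℝ) - Q) ^ q) * (((M' : ℝ) - q) * ((M : ℝ) - Q)) := by ring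
        _ ≤ ((M.descFactorial q : ℝ) * ((M' : ℝ) - Q) ^ q) * (((M : ℝ) - q) * ((M' : ℝ) - Q)) := by
          apply mul_le_mul this h1
          · apply mul_nonneg <;> linarith
          · have : 0 ≤ (M' : ℝ) - Q := by linarith
            positivity
        _ = _ := by ring
  have h := key q hq
  rw [Nat.descFactorial_eq_factorial_mul_choose, Nat.descFactorial_eq_factorial_mul_choose] at h
  push_cast at h
  have hp : (0 : ℝ) < (M' : ℝ) - Q := by linarith
  rw [div_pow, mul_div_assoc', div_le_iff₀ (by positivity)]
  have hf : (0 : ℝ) < q.factorial := by positivity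
  rw [mul_assoc, mul_assoc] at h
  exact le_of_mul_le_mul_left h hf

lemma rl4 (n u v j : ℕ) (hj : j ≤ v) (hn : u + v + 1 ≤ n) :
    ((n - 1 - u).factorial : ℝ) / ((n - 1 - u - v + j).factorial) * (((n : ℝ) + u) / n) ^ (v - j) * ((n : ℝ) - v) ^ j ≤
      (n.factorial : ℝ) / ((n - v).factorial) := by
  have hn0 : (0 : ℝ) < n := by exact_mod_cast (show 0 < n by omega)
  have key : ∀ q, q ≤ n - 1 - u → ((n - 1 - u).descFactorial q : ℝ) * ((n : ℝ) + u) ^ q ≤ (n.descFactorial q : ℝ) * (n : ℝ) ^ q := by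
    intro q
    induction q with
    | zero => simp
    | succ q ih =>
      intro hq
      have := ih (by omega)
      rw [Nat.descFactorial_succ, Nat.descFactorial_succ, pow_succ, pow_succ, show n - 1 - u - q = n - (1 + u + q) by omega]
      push_cast [Nat.cast_sub (show 1 + u + q ≤ n by omega), Nat.cast_sub (show q ≤ n by omega)]
      have h0 : (0 : ℝ) ≤ q := by positivity
      have h00 : (0 : ℝ) ≤ u := by positivity
      have h1 : ((n : ℝ) - (1 + u + q)) * ((n : ℝ) + u) ≤ ((n : ℝ) - q) * n := by nlinarith
      calc _ = (((n - 1 - u).descFactorial q : ℝ) * ((n : ℝ) + u) ^ q) * (((n : ℝ) - (1 + u + q)) * ((n : ℝ) + u)) := by ring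
        _ ≤ ((n.descFactorial q : ℝ) * (n : ℝ) ^ q) * (((n : ℝ) - q) * n) := by
          apply mul_le_mul this h1
          · apply mul_nonneg
            · rw [sub_nonneg]; exact_mod_cast (show 1 + u + q ≤ n by omega)
            · linarith
          · positivity
        _ = _ := by ring
  have h1 := key (v - j) (by omega)
  have e1 : ((n - 1 - u).factorial : ℝ) / ((n - 1 - u - v + j).factorial) = ((n - 1 - u).descFactorial (v - j) : ℝ) := by
    have := Nat.factorial_mul_descFactorial (n := n - 1 - u) (k := v - j) (by omega)
    rw [← this, show n - 1 - u - (v - j) = n - 1 - u - v + j by omega]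
    push_cast
    field_simp
  have e2 : (n.factorial : ℝ) / ((n - v).factorial) = (n.descFactorial v : ℝ) := by
    have := Nat.factorial_mul_descFactorial (n := n) (k := v) (by omega)
    rw [← this]
    push_cast
    field_simp
  have e3 : (n.descFactorial (v - j) : ℝ) * ((n : ℝ) - v) ^ j ≤ (n.descFactorial v : ℝ) := by
    have h5 := Nat.descFactorial_mul_descFactorial (n := n) (m := v) (k := v - j) (by omega)
    have h2 := Nat.pow_sub_le_descFactorial (n - (v - j)) (v - (v - j))
    rw [← h5]
    push_cast
    rw [mul_comm]
    refine mul_le_mul_of_nonneg_right ?_ (by positivity)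
    have h3 : (n - v) ^ j ≤ (n - (v - j)).descFactorial (v - (v - j)) := by
      refine le_trans ?_ h2
      rw [show v - (v - j) = j by omega]
      exact Nat.pow_le_pow_left (by omega) _
    have h4 : (((n - v) ^ j : ℕ) : ℝ) ≤ (((n - (v - j)).descFactorial (v - (v - j)) : ℕ) : ℝ) := by exact_mod_cast h3
    rw [Nat.cast_pow, Nat.cast_sub (by omega)] at h4
    exact h4
  have hnv : (0 : ℝ) ≤ (n : ℝ) - v := by rw [sub_nonneg]; exact_mod_cast (show v ≤ n by omega)
  rw [e1, e2]
  refine le_trans ?_ e3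
  gcongr
  rw [div_pow, mul_div_assoc', div_le_iff₀ (by positivity)]
  exact h1

lemma exp_lb1 (N u v q : ℝ) (hu : 0 ≤ u) (hv : 0 ≤ v) (hN : u + 2 * v < N) (k : ℕ) (hk : (k : ℝ) ≤ q) :
    Real.exp (-(q * (2 * v) / (N - u - 2 * v))) ≤ ((N - 2 * v - u) / (N - u)) ^ k := by
  have h1 : 0 < N - u - 2 * v := by linarith
  have h2 : 0 < N - u := by linarith
  have h3 : Real.exp (-(2 * v / (N - u - 2 * v))) ≤ (N - 2 * v - u) / (N - u) := by
    rw [Real.exp_neg, inv_le_comm₀ (Real.exp_pos _) (by apply div_pos <;> linarith), inv_div]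
    refine le_trans (le_of_eq ?_) (Real.add_one_le_exp _)
    rw [show N - 2 * v - u = N - u - 2 * v by ring]
    field_simp; ring
  calc _ ≤ Real.exp (k * (-(2 * v / (N - u - 2 * v)))) := by
        rw [Real.exp_le_exp, mul_neg, neg_le_neg_iff, mul_div_assoc q]
        exact mul_le_mul_of_nonneg_right hk (div_nonneg (by linarith) h1.le)
    _ = Real.exp (-(2 * v / (N - u - 2 * v))) ^ k := Real.exp_nat_mul _ _
    _ ≤ _ := by gcongr

lemma exp_lb2 (n u : ℝ) (hn : 0 < n) (hu : 0 ≤ u) (k : ℕ) :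
    Real.exp (k * u / (n + u)) ≤ ((n + u) / n) ^ k := by
  have h3 : Real.exp (u / (n + u)) ≤ (n + u) / n := by
    rw [← Real.le_log_iff_exp_le (by positivity)]
    have := Real.one_sub_inv_le_log_of_pos (x := (n + u) / n) (by positivity)
    refine le_trans (le_of_eq ?_) this
    field_simp; ring
  rw [mul_div_assoc, Real.exp_nat_mul]
  gcongr

noncomputable def Phi (j : ℕ) (i x y : ℝ) : ℝ :=
  ((y - j * i) * (x - j * i) * (1 - y * i)) ^ j * (1 - i ^ 2 - y * i) *
    Real.exp (-(2 * x * y / (1 - 2 * i ^ 2 - x * i - 2 * y * i)) + (y - j * i) * x / (1 + x * i))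

lemma Phi_eq (j : ℕ) (m u v : ℝ) (hm : 0 < m) : Phi j (1 / m) (u / m) (v / m) =
    ((v - j) / (m * m)) ^ j * (((m * m) - 1 - v) / (m * m)) * ((u - j) / (m * m)) ^ j * ((m * m) - v) ^ j *
      (Real.exp (-(u * (2 * v) / ((m * m) - 2 - u - 2 * v))) * Real.exp ((v - j) * u / ((m * m) + u))) := by
  rw [Phi, ← Real.exp_add]
  have e1 : 2 * (u / m) * (v / m) / (1 - 2 * (1 / m) ^ 2 - u / m * (1 / m) - 2 * (v / m) * (1 / m)) = u * (2 * v) / ((m * m) - 2 - u - 2 * v) := by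
    have : 1 - 2 * (1 / m) ^ 2 - u / m * (1 / m) - 2 * (v / m) * (1 / m) = ((m * m) - 2 - u - 2 * v) / (m * m) := by field_simp
    rw [this, div_div_eq_mul_div]
    congr 1
    field_simp
  have e2 : (v / m - j * (1 / m)) * (u / m) / (1 + u / m * (1 / m)) = (v - j) * u / ((m * m) + u) := by
    have : 1 + u / m * (1 / m) = (m * m + u) / (m * m) := by field_simp
    rw [this, div_div_eq_mul_div]
    congr 1
    field_simp
  rw [e1, e2]
  congr 1
  have e3 : (v / m - j * (1 / m)) * (u / m - j * (1 / m)) * (1 - v / m * (1 / m)) = ((v - j) / (m * m)) * ((u - j) / (m * m)) * (m * m - v) := by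
    field_simp
  have e4 : 1 - (1 / m) ^ 2 - v / m * (1 / m) = ((m * m) - 1 - v) / (m * m) := by field_simp
  rw [e3, e4, mul_pow, mul_pow]; ring

lemma rho_lb (N u v j : ℕ) (hju : j ≤ u) (hjv : j ≤ v) (hN : u + 2 * v + 3 ≤ N) :
    Phi j (1 / Real.sqrt ((N + 2 : ℕ) : ℝ)) (u / Real.sqrt ((N + 2 : ℕ) : ℝ)) (v / Real.sqrt ((N + 2 : ℕ) : ℝ)) *
      ((N.choose u : ℝ) * ((N + 1).choose v : ℝ) * (2 / (N + 2).factorial)) ≤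
    ((N - j).choose (v - j) : ℝ) * ((N - 2 * v).choose (u - j) : ℝ) *
      (2 * ((N + 1 - u - v + j).factorial : ℝ) / ((N + 1 - u).factorial * (N + 2 - v).factorial)) := by
  have hn : (0 : ℝ) < ((N + 2 : ℕ) : ℝ) := by positivity
  rw [Phi_eq j _ _ _ (Real.sqrt_pos.2 hn), Real.mul_self_sqrt hn.le]
  have hc : (u : ℝ) + 2 * v + 3 ≤ N := by exact_mod_cast hN
  have huj : (j : ℝ) ≤ u := by exact_mod_cast hju
  have hvj : (j : ℝ) ≤ v := by exact_mod_cast hjv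
  have hj0 : (0 : ℝ) ≤ j := by positivity
  have a1 := rl1 (N + 1) v j hjv (by omega) ((N + 2 : ℕ) : ℝ) (by push_cast; linarith) hn
  have a2 := rl2 N v j hjv (by omega)
  have a3 := rl1 N u j hju (by omega) ((N + 2 : ℕ) : ℝ) (by push_cast; linarith) hn
  have a3' : ((N - j).choose (u - j) : ℝ) ≤ (N.choose (u - j) : ℝ) := by
    exact_mod_cast Nat.choose_le_choose (u - j) (Nat.sub_le N j)
  have a4 := rl3 (N - 2 * v) N u (u - j) (by omega) (by omega) (by omega)
  have a5 := rl4 (N + 2) u v j hjv (by omega)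
  have b1 := exp_lb1 (N : ℝ) u v u (by positivity) (by positivity) (by linarith) (u - j) (by rw [Nat.cast_sub hju]; linarith)
  have b2 := exp_lb2 ((N + 2 : ℕ) : ℝ) u hn (by positivity) (v - j)
  rw [Nat.cast_sub hjv] at b2
  rw [Nat.cast_sub (show 2 * v ≤ N by omega), Nat.cast_mul, Nat.cast_ofNat] at a4
  rw [show N + 2 - 1 = N + 1 by omega] at a5
  have k1 : ((N + 2 : ℕ) : ℝ) - 2 - u - 2 * v = N - u - 2 * v := by push_cast; ring
  have k2 : ((N + 2 : ℕ) : ℝ) - 1 - v = N + 1 - v := by push_cast; ring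
  have k3 : (N : ℝ) + 2 = ((N + 2 : ℕ) : ℝ) := by push_cast; ring
  rw [k3] at a2
  rw [k1, k2]
  set n : ℝ := ((N + 2 : ℕ) : ℝ)
  have p1 : 0 ≤ ((v : ℝ) - j) / n := div_nonneg (by linarith) hn.le
  have p2 : 0 ≤ ((u : ℝ) - j) / n := div_nonneg (by linarith) hn.le
  have p3 : 0 ≤ ((N : ℝ) + 1 - v) / n := div_nonneg (by linarith) hn.le
  have p4 : 0 ≤ n - v := by rw [← k3]; linarith
  have s1 : ((N + 1).choose v : ℝ) * (((v : ℝ) - j) / n) ^ j * (((N : ℝ) + 1 - v) / n) ≤ ((N - j).choose (v - j) : ℝ) :=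
    (mul_le_mul_of_nonneg_right a1 p3).trans a2
  have s2 : (N.choose u : ℝ) * (((u : ℝ) - j) / n) ^ j * Real.exp (-((u : ℝ) * (2 * v) / (N - u - 2 * v))) ≤ ((N - 2 * v).choose (u - j) : ℝ) := by
    refine le_trans ?_ a4
    exact mul_le_mul (a3.trans a3') b1 (Real.exp_pos _).le (by positivity)
  have s3 : ((N + 1 - u).factorial : ℝ) / ((N + 1 - u - v + j).factorial) * Real.exp (((v : ℝ) - j) * u / (n + u)) * (n - v) ^ j ≤ ((N + 2).factorial : ℝ) / ((N + 2 - v).factorial) := by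
    refine le_trans ?_ a5
    gcongr
  have s12 := mul_le_mul s1 s2 (by positivity) (by positivity)
  have s123 := mul_le_mul s12 s3 (by positivity) (by positivity)
  have f1 : (0 : ℝ) < (N + 1 - u).factorial := by positivity
  have f2 : (0 : ℝ) < (N + 1 - u - v + j).factorial := by positivity
  have f3 : (0 : ℝ) < (N + 2).factorial := by positivity
  have f4 : (0 : ℝ) < (N + 2 - v).factorial := by positivity
  have s := mul_le_mul_of_nonneg_right s123 (show 0 ≤ 2 * ((N + 1 - u - v + j).factorial : ℝ) / ((N + 1 - u).factorial * (N + 2).factorial) by positivity)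
  generalize ((N + 1 - u - v + j).factorial : ℝ) = g1 at *
  generalize ((N + 1 - u).factorial : ℝ) = g2 at *
  generalize ((N + 2).factorial : ℝ) = g3 at *
  generalize ((N + 2 - v).factorial : ℝ) = g4 at *
  refine le_trans (le_of_eq ?_) (s.trans (le_of_eq ?_))
  · generalize Real.exp (-((u : ℝ) * (2 * v) / (N - u - 2 * v))) = E1
    generalize Real.exp (((v : ℝ) - j) * u / (n + u)) = E2
    generalize (((v : ℝ) - j) / n) ^ j = E3
    generalize (((u : ℝ) - j) / n) ^ j = E4
    generalize ((N : ℝ) + 1 - v) / n = E5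
    field_simp
  · field_simp

lemma phi_lb (s : ℝ) (k : ℕ) (ε : ℝ) (hε : 0 < ε) : ∃ δ > 0, ∀ i x y : ℝ, |i| < δ → |x - s| < δ → |y - s| < δ →
    Real.exp (-s ^ 2) * (1 + s ^ 2) ^ k - ε ≤ ∑ j ∈ range (k + 1), (k.choose j : ℝ) * Phi j i x y := by
  have hc : ContinuousAt (fun p : ℝ × ℝ × ℝ => ∑ j ∈ range (k + 1), (k.choose j : ℝ) * Phi j p.1 p.2.1 p.2.2) (0, s, s) := by
    apply tendsto_finsetSum
    intro j _
    apply ContinuousAt.mul continuousAt_const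
    unfold Phi
    apply ContinuousAt.mul (by fun_prop)
    apply ContinuousAt.rexp
    apply ContinuousAt.add
    · apply ContinuousAt.neg
      apply ContinuousAt.div (by fun_prop) (by fun_prop)
      norm_num
    · apply ContinuousAt.div (by fun_prop) (by fun_prop)
      norm_num
  have hv : (∑ j ∈ range (k + 1), (k.choose j : ℝ) * Phi j 0 s s) = Real.exp (-s ^ 2) * (1 + s ^ 2) ^ k := by
    rw [add_comm (1 : ℝ), add_pow, mul_sum]
    refine sum_congr rfl fun j _ => ?_
    rw [Phi]
    simp only [mul_zero, sub_zero, mul_one, one_pow, add_zero, div_one, ne_eq, OfNat.ofNat_ne_zero, not_false_eq_true, zero_pow]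
    rw [show -(2 * s * s) + s * s = -s ^ 2 by ring, ← sq]; ring
  rw [Metric.continuousAt_iff] at hc
  obtain ⟨δ, hδ, h⟩ := hc ε hε
  refine ⟨δ, hδ, fun i x y hi hx hy => ?_⟩
  have h2 := h (x := (i, x, y)) (by
    rw [Prod.dist_eq, Prod.dist_eq, Real.dist_eq, Real.dist_eq, Real.dist_eq]
    simp only [sub_zero]
    exact max_lt hi (max_lt hx hy))
  rw [Real.dist_eq] at h2
  simp only [hv] at h2
  have := (abs_lt.1 h2).1
  linarith
end TT

namespace TT
open Equiv Finset Topology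

lemma phi_lbK (s ε : ℝ) (hε : 0 < ε) (K : ℕ) : ∃ δ > 0, ∀ k ≤ K, ∀ i x y : ℝ, |i| < δ → |x - s| < δ → |y - s| < δ →
    Real.exp (-s ^ 2) * (1 + s ^ 2) ^ k - ε ≤ ∑ j ∈ range (k + 1), (k.choose j : ℝ) * Phi j i x y := by
  induction K with
  | zero =>
    obtain ⟨δ, h1, h2⟩ := phi_lb s 0 ε hε
    refine ⟨δ, h1, fun k hk => ?_⟩
    obtain rfl : k = 0 := by omega
    exact h2
  | succ K ih =>
    obtain ⟨δ, h1, h2⟩ := phi_lb s (K + 1) ε hε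
    obtain ⟨δ', h1', h2'⟩ := ih
    refine ⟨min δ δ', lt_min h1 h1', fun k hk i x y hi hx hy => ?_⟩
    rw [lt_min_iff] at hi hx hy
    rcases Nat.lt_or_ge K k with h | h
    · obtain rfl : k = K + 1 := by omega
      exact h2 i x y hi.1 hx.1 hy.1
    · exact h2' k h i x y hi.2 hx.2 hy.2

lemma sqrt_inf : Tendsto (fun M : ℕ => Real.sqrt ((M + 2 : ℕ) : ℝ)) atTop atTop :=
  Real.tendsto_sqrt_atTop.comp n_inf

section
set_option linter.unusedSectionVars false
variable {α : Type*} [Fintype α] [DecidableEq α]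

lemma size_lb (a b : α) (hab : a ≠ b) (M : ℕ) (hα : Fintype.card α = M + 2) (σ : Perm α) (e1 e2 : ℤˣ)
    (hσ : Perm.sign σ = e1 * e2) (u v k : ℕ) (hk : (Fx a b σ).card = k) (hku : k ≤ u) (hkv : k ≤ v)
    (huv : u + 2 * v + 3 ≤ M) :
    (∑ j ∈ range (k + 1), (k.choose j : ℝ) * Phi j (1 / Real.sqrt ((M + 2 : ℕ) : ℝ)) (u / Real.sqrt ((M + 2 : ℕ) : ℝ)) (v / Real.sqrt ((M + 2 : ℕ) : ℝ))) *
      ((M.choose u : ℝ) * ((M + 1).choose v : ℝ) * (2 / (M + 2).factorial)) ≤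
    ∑ A ∈ powersetCard (M - u) (X0 a b), ∑ B ∈ powersetCard (M + 1 - v) (Xb b), cv (insert a A) (insert b B) e1 e2 σ := by
  have h := avg_lb a b hab σ e1 e2 hσ u v k (by omega) hk hku hkv
  rw [hα, show M + 2 - 2 = M by omega, show M + 2 - 1 = M + 1 by omega] at h
  refine le_trans ?_ h
  rw [sum_mul]
  refine sum_le_sum fun j hj => ?_
  have hj' : j ≤ k := by rw [mem_range] at hj; omega
  have := rho_lb M u v j (by omega) (by omega) huv
  have h2 := mul_le_mul_of_nonneg_left this (show (0 : ℝ) ≤ k.choose j by positivity)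
  refine le_trans (le_of_eq ?_) (h2.trans (le_of_eq ?_))
  · ring
  · ring

lemma sum_convo (f h : Perm α → ℝ) : ∑ σ, ∑ g, f g * h (g⁻¹ * σ) = (∑ g, f g) * ∑ g, h g := by
  rw [sum_comm, sum_mul]
  refine sum_congr rfl fun g _ => ?_
  rw [← mul_sum]
  congr 1
  exact Equiv.sum_comp (Equiv.mulLeft g⁻¹) h

lemma convo_L1 (f1 f2 g1 g2 : Perm α → ℝ) :
    ∑ σ, |∑ g, f1 g * f2 (g⁻¹ * σ) - ∑ g, g1 g * g2 (g⁻¹ * σ)| ≤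
      (∑ g, |f1 g - g1 g|) * (∑ g, |f2 g|) + (∑ g, |g1 g|) * ∑ g, |f2 g - g2 g| := by
  rw [← sum_convo (fun g => |f1 g - g1 g|) (fun g => |f2 g|), ← sum_convo (fun g => |g1 g|) (fun g => |f2 g - g2 g|), ← sum_add_distrib]
  refine sum_le_sum fun σ _ => ?_
  rw [← sum_sub_distrib, ← sum_add_distrib]
  refine (abs_sum_le_sum_abs _ _).trans (sum_le_sum fun g _ => ?_)
  rw [← abs_mul, ← abs_mul]
  refine le_trans (le_of_eq ?_) (abs_add_le _ _)
  congr 1; ring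

lemma pair_L1 (a b : α) (r r' : ℕ) (A B : Finset α) (ha : a ∉ A) (hb : b ∉ B) (hA : A.Nonempty) (hB : B.Nonempty) (ε : ℝ)
    (h1 : 2 * kerr r A.card ≤ ε * sj r A.card) (h2 : 2 * kerr r' B.card ≤ ε * sj r' B.card) :
    ∑ σ, |∑ g, N a r A g * N b r' B (g⁻¹ * σ) - sj r A.card * sj r' B.card * cv (insert a A) (insert b B) ((-1) ^ r) ((-1) ^ r') σ| ≤
      2 * ε * (sj r A.card * sj r' B.card) := by
  have h := convo_L1 (N a r A) (N b r' B) (fun g => sj r A.card * Us (insert a A) ((-1) ^ r) g) (fun g => sj r' B.card * Us (insert b B) ((-1) ^ r') g)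
  have e1 : ∀ σ : Perm α, ∑ g, sj r A.card * Us (insert a A) ((-1) ^ r) g * (sj r' B.card * Us (insert b B) ((-1) ^ r') (g⁻¹ * σ)) = sj r A.card * sj r' B.card * cv (insert a A) (insert b B) ((-1) ^ r) ((-1) ^ r') σ := by
    intro σ
    rw [cv, mul_sum]
    refine sum_congr rfl fun g _ => by ring
  have hAc : 2 ≤ (insert a A).card := by
    rw [card_insert_of_notMem ha]; have := hA.card_pos; omega
  have e2 : ∑ g, |N b r' B g| = sj r' B.card := by
    rw [← sum_N b r' B]; exact sum_congr rfl fun g _ => abs_of_nonneg (N_nonneg _ _ _ _)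
  have e3 : ∑ g, |sj r A.card * Us (insert a A) ((-1) ^ r) g| = sj r A.card := by
    rw [sum_congr rfl fun g _ => abs_of_nonneg (mul_nonneg (sj_nonneg r A.card) (Us_nonneg (insert a A) ((-1) ^ r) g)), ← mul_sum, sum_Us _ hAc, mul_one]
  simp only [e1] at h
  rw [e2, e3] at h
  have k1 := (L1_bound a r A ha hA).trans h1
  have k2 := (L1_bound b r' B hb hB).trans h2
  have := mul_le_mul_of_nonneg_right k1 (sj_nonneg r' B.card)
  have := mul_le_mul_of_nonneg_left k2 (sj_nonneg r A.card)
  linarith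

lemma grp (a b : α) (hab : a ≠ b) (M : ℕ) (hα : Fintype.card α = M + 2) (F : Finset α → Finset α → ℝ) :
    ∑ A ∈ (X0 a b).powerset, ∑ B ∈ (Xb b).powerset, F A B =
    ∑ p ∈ range (M + 1), ∑ q ∈ range (M + 2), ∑ A ∈ powersetCard p (X0 a b), ∑ B ∈ powersetCard q (Xb b), F A B := by
  rw [sum_powerset, card_X0 a b hab, hα, show M + 2 - 2 = M by omega]
  refine sum_congr rfl fun p _ => ?_
  rw [sum_comm, sum_powerset, card_Xb, hα, show M + 2 - 1 + 1 = M + 2 by omega]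
  refine sum_congr rfl fun q _ => sum_comm

lemma grpE (a b : α) (hab : a ≠ b) (M : ℕ) (hα : Fintype.card α = M + 2) (t : ℕ) (φ : ℕ → ℕ → ℕ → ℝ) :
    (∑ r ∈ range (t + 1), ∑ A ∈ (X0 a b).powerset, ∑ B ∈ (Xb b).powerset,
      (t.choose r : ℝ) * (sj r A.card * sj (t - r) B.card * φ r A.card B.card)) = (2 * (M : ℝ) + 1) ^ t * EE M t φ := by
  rw [EE, mul_sum]
  refine sum_congr rfl fun r _ => ?_
  rw [grp a b hab M hα, mul_sum]
  refine sum_congr rfl fun p _ => ?_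
  rw [mul_sum]
  refine sum_congr rfl fun q _ => ?_
  have : ∀ A ∈ powersetCard p (X0 a b), ∀ B ∈ powersetCard q (Xb b), (t.choose r : ℝ) * (sj r A.card * sj (t - r) B.card * φ r A.card B.card) = (t.choose r : ℝ) * (sj r p * sj (t - r) q * φ r p q) := by
    intro A hA B hB
    rw [(mem_powersetCard.1 hA).2, (mem_powersetCard.1 hB).2]
  rw [sum_congr rfl fun A hA => sum_congr rfl fun B hB => this A hA B hB]
  rw [sum_const, sum_const, card_powersetCard, card_powersetCard, card_X0 a b hab, card_Xb, hα, wt]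
  have hZ : (2 * (M : ℝ) + 1) ^ t ≠ 0 := by positivity
  simp only [nsmul_eq_mul, show M + 2 - 2 = M by omega, show M + 2 - 1 = M + 1 by omega]
  field_simp

lemma sum_HH (a b : α) (hab : a ≠ b) (M : ℕ) (hα : Fintype.card α = M + 2) (t : ℕ) :
    ∑ σ, HH a b t σ = (2 * (M : ℝ) + 1) ^ t := by
  have h := grpE a b hab M hα t (fun _ _ _ => 1)
  rw [EE_one, mul_one] at h
  rw [← h]
  simp only [HH]
  rw [sum_comm]
  refine sum_congr rfl fun r _ => ?_
  rw [sum_comm]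
  refine sum_congr rfl fun A _ => ?_
  rw [sum_comm]
  refine sum_congr rfl fun B _ => ?_
  rw [← mul_sum, sum_convo, sum_N, sum_N, mul_one]
end
end TT

namespace TT
open Equiv Finset Topology

lemma good_sizes (s η : ℝ) (hs : 0 < s) (hη : η ≤ s / 2) (K : ℕ) :
    ∀ᶠ M : ℕ in atTop, ∀ t r p q : ℕ, Good M t s η r p q → p ≤ M → q ≤ M + 1 →
      K ≤ M - p ∧ K ≤ M + 1 - q ∧ (M - p) + 2 * (M + 1 - q) + 3 ≤ M ∧ K ≤ p ∧ K ≤ q := by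
  filter_upwards [sqrt_inf.eventually_ge_atTop (5 * s + 5 + K), sqrt_inf.eventually_ge_atTop (2 * K / s)] with M h1 h2 t r p q hG hp hq
  obtain ⟨-, -, g1, g2⟩ := hG
  have hw : Real.sqrt ((M + 2 : ℕ) : ℝ) * Real.sqrt ((M + 2 : ℕ) : ℝ) = (M : ℝ) + 2 := by
    rw [Real.mul_self_sqrt (by positivity)]; push_cast; ring
  set w := Real.sqrt ((M + 2 : ℕ) : ℝ)
  rw [div_le_iff₀ hs] at h2
  rw [abs_lt] at g1 g2
  have hK : (0 : ℝ) ≤ K := by positivity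
  have hw0 : 0 < w := by linarith
  have hηw : η * w ≤ s / 2 * w := mul_le_mul_of_nonneg_right hη hw0.le
  have h3 : (5 * s + 5 + K) * w ≤ w * w := mul_le_mul_of_nonneg_right h1 hw0.le
  have hw1 : 1 ≤ w := by linarith
  have h4 : (K : ℝ) * 1 ≤ K * w := mul_le_mul_of_nonneg_left hw1 hK
  have h5 : 0 ≤ s * w := by positivity
  have hp' : ((M - p : ℕ) : ℝ) = M - p := Nat.cast_sub hp
  have hq' : ((M + 1 - q : ℕ) : ℝ) = M + 1 - q := by rw [Nat.cast_sub hq]; push_cast; ring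
  refine ⟨?_, ?_, ?_, ?_, ?_⟩
  · rw [← Nat.cast_le (α := ℝ), hp']; linarith
  · rw [← Nat.cast_le (α := ℝ), hq']; linarith
  · rw [← Nat.cast_le (α := ℝ)]; push_cast [hp', hq']; linarith
  · rw [← Nat.cast_le (α := ℝ)]; linarith
  · rw [← Nat.cast_le (α := ℝ)]; linarith

lemma good_kerr (c s η ε : ℝ) (hs : 0 < s) (hη : η ≤ s / 2) (hε : 0 < ε) :
    ∀ᶠ M : ℕ in atTop, ∀ r p q : ℕ, Good M (tt c (M + 2)) s η r p q → p ≤ M → q ≤ M + 1 →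
      2 * kerr r p ≤ ε * sj r p ∧ 2 * kerr (tt c (M + 2) - r) q ≤ ε * sj (tt c (M + 2) - r) q := by
  obtain ⟨m0, hm0⟩ := kerr_sj ε (1 / 12) hε (by norm_num)
  filter_upwards [good_sizes s η hs hη (m0 + 1), tt_big c] with M h1 h2 r p q hG hp hq
  obtain ⟨-, -, -, k1, k2⟩ := h1 _ r p q hG hp hq
  obtain ⟨g1, g2, -, -⟩ := hG
  have ht : 1 / 2 * ((M + 2 : ℕ) : ℝ) * Real.log ((M + 2 : ℕ) : ℝ) ≤ (tt c (M + 2) : ℝ) := h2.trans (Nat.le_ceil _)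
  have key : ∀ m ρ : ℕ, m0 + 1 ≤ m → m ≤ M + 2 → tt c (M + 2) ≤ 6 * ρ → 2 * kerr ρ m ≤ ε * sj ρ m := by
    intro m ρ h3 h4 h5
    refine (hm0 m (by omega) ρ ?_).2
    have h6 : (tt c (M + 2) : ℝ) ≤ 6 * ρ := by exact_mod_cast h5
    have h7 : (m : ℝ) ≤ ((M + 2 : ℕ) : ℝ) := by exact_mod_cast h4
    have h8 : (1 : ℝ) ≤ m := by exact_mod_cast (show 1 ≤ m by omega)
    have h9 : Real.log m ≤ Real.log ((M + 2 : ℕ) : ℝ) := Real.log_le_log (by linarith) h7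
    have h10 : (m : ℝ) * Real.log m ≤ ((M + 2 : ℕ) : ℝ) * Real.log ((M + 2 : ℕ) : ℝ) :=
      mul_le_mul h7 h9 (Real.log_nonneg h8) (by positivity)
    linarith
  exact ⟨key p r k1 (by omega) g1, key q _ k2 (by omega) g2⟩

lemma good_size_lb (s ε : ℝ) (hs : 0 < s) (hε : 0 < ε) (K : ℕ) : ∃ η > 0, η ≤ s / 2 ∧
    ∀ᶠ M : ℕ in atTop, ∀ t r p q : ℕ, Good M t s η r p q → p ≤ M → q ≤ M + 1 →
      ∀ (a b : Fin (M + 2)), a ≠ b → ∀ (σ : Perm (Fin (M + 2))) (e1 e2 : ℤˣ), Perm.sign σ = e1 * e2 → (Fx a b σ).card ≤ K →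
      (Real.exp (-s ^ 2) * (1 + s ^ 2) ^ (Fx a b σ).card - ε) * ((M.choose p : ℝ) * ((M + 1).choose q : ℝ) * (2 / (M + 2).factorial)) ≤
      ∑ A ∈ powersetCard p (X0 a b), ∑ B ∈ powersetCard q (Xb b), cv (insert a A) (insert b B) e1 e2 σ := by
  obtain ⟨δ, hδ, H⟩ := phi_lbK s ε hε K
  refine ⟨min δ (s / 2), lt_min hδ (by linarith), min_le_right _ _, ?_⟩
  filter_upwards [good_sizes s _ hs (min_le_right δ (s / 2)) K, sqrt_inf.eventually_gt_atTop (1 / δ)] with M h1 h2 t r p q hG hp hq a b hab σ e1 e2 hσ hk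
  obtain ⟨k1, k2, k3, -, -⟩ := h1 t r p q hG hp hq
  obtain ⟨-, -, g1, g2⟩ := hG
  have h := size_lb a b hab M (Fintype.card_fin _) σ e1 e2 hσ (M - p) (M + 1 - q) _ rfl (by omega) (by omega) k3
  rw [Nat.choose_symm hp, Nat.choose_symm hq, show M - (M - p) = p by omega, show M + 1 - (M + 1 - q) = q by omega] at h
  refine le_trans ?_ h
  refine mul_le_mul_of_nonneg_right ?_ (by positivity)
  have hw0 : 0 < Real.sqrt ((M + 2 : ℕ) : ℝ) := Real.sqrt_pos.2 (by positivity)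
  set w := Real.sqrt ((M + 2 : ℕ) : ℝ)
  have aux : ∀ x : ℝ, |x - s * w| < min δ (s / 2) * w → |x / w - s| < δ := by
    intro x hx
    have : x / w - s = (x - s * w) / w := by field_simp
    rw [this, abs_div, abs_of_pos hw0, div_lt_iff₀ hw0]
    exact hx.trans_le (mul_le_mul_of_nonneg_right (min_le_left _ _) hw0.le)
  apply H _ hk
  · rw [abs_of_pos (by positivity), div_lt_comm₀ hw0 hδ]; exact h2
  · rw [Nat.cast_sub hp]; exact aux _ g1
  · rw [Nat.cast_sub hq]; push_cast; exact aux _ g2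

theorem lower (c ε : ℝ) (hε : 0 < ε) (K : ℕ) :
    ∀ᶠ M : ℕ in atTop, ∀ (a b : Fin (M + 2)), a ≠ b → ∃ e : Perm (Fin (M + 2)) → ℝ, (∀ σ, 0 ≤ e σ) ∧ ∑ σ, e σ ≤ ε ∧
      ∀ σ : Perm (Fin (M + 2)), Perm.sign σ = (-1) ^ (tt c (M + 2)) → (Fx a b σ).card ≤ K →
        (2 / (M + 2).factorial : ℝ) * (Real.exp (-Real.exp (-c)) * (1 + Real.exp (-c)) ^ (Fx a b σ).card - ε) - e σ ≤
          HH a b (tt c (M + 2)) σ / (2 * (M : ℝ) + 1) ^ (tt c (M + 2)) := by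
  have hs : 0 < Real.exp (-c / 2) := Real.exp_pos _
  have hs2 : Real.exp (-c / 2) ^ 2 = Real.exp (-c) := by rw [← Real.exp_nat_mul]; congr 1; push_cast; ring
  obtain ⟨η, hη, hη2, H⟩ := good_size_lb (Real.exp (-c / 2)) (ε / 2) hs (by linarith) K
  rw [hs2] at H
  set s := Real.exp (-c / 2)
  set lam := Real.exp (-c)
  have hlam : 0 < lam := Real.exp_pos _
  have hF : 0 < (1 + lam) ^ K := by positivity
  have hev := (good_prob c η hη).eventually_const_lt (show 1 - ε / 2 / (1 + lam) ^ K < 1 by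
    have : 0 < ε / 2 / (1 + lam) ^ K := by positivity
    linarith)
  filter_upwards [H, hev, good_kerr c s η (ε / 2) hs hη2 (by linarith), good_sizes s η hs hη2 1] with M h1 h2 h3 h4 a b hab
  generalize tt c (M + 2) = t at h2 h3 h4 ⊢
  set Z : ℝ := (2 * (M : ℝ) + 1) ^ t with hZdef
  have hZ : 0 < Z := by positivity
  set E := EE M t (fun r p q => if Good M t s η r p q then 1 else 0)
  have hE1 : E ≤ 1 := by
    rw [← EE_one M t]
    exact EE_mono _ _ _ _ fun r _ p _ q _ => by split_ifs <;> norm_num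
  have cardA : ∀ A ∈ (X0 a b).powerset, A.card ≤ M ∧ a ∉ A := by
    intro A hA
    rw [mem_powerset] at hA
    refine ⟨?_, fun h => (mem_X0.1 (hA h)).1 rfl⟩
    have := card_le_card hA
    rw [card_X0 a b hab, Fintype.card_fin] at this; omega
  have cardB : ∀ B ∈ (Xb b).powerset, B.card ≤ M + 1 ∧ b ∉ B := by
    intro B hB
    rw [mem_powerset] at hB
    refine ⟨?_, fun h => mem_Xb.1 (hB h) rfl⟩
    have := card_le_card hB
    rw [card_Xb, Fintype.card_fin] at this; omega
  let D : ℕ → Finset (Fin (M + 2)) → Finset (Fin (M + 2)) → Perm (Fin (M + 2)) → ℝ := fun r A B σ =>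
    |∑ g, N a r A g * N b (t - r) B (g⁻¹ * σ) - sj r A.card * sj (t - r) B.card * cv (insert a A) (insert b B) ((-1) ^ r) ((-1) ^ (t - r)) σ|
  let e : Perm (Fin (M + 2)) → ℝ := fun σ => (∑ r ∈ range (t + 1), ∑ A ∈ (X0 a b).powerset, ∑ B ∈ (Xb b).powerset,
    (t.choose r : ℝ) * (if Good M t s η r A.card B.card then D r A B σ else 0)) / Z
  refine ⟨e, ?_, ?_, ?_⟩
  · intro σ
    refine div_nonneg (sum_nonneg fun r _ => sum_nonneg fun A _ => sum_nonneg fun B _ => mul_nonneg (by positivity) ?_) hZ.le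
    split_ifs
    · exact abs_nonneg _
    · exact le_rfl
  · have hg := grpE a b hab M (Fintype.card_fin _) t (fun _ _ _ => ε)
    have hEε : EE M t (fun _ _ _ => ε) = ε := by
      have := EE_smul M t ε (fun _ _ _ => 1)
      simpa [EE_one] using this
    rw [hEε] at hg
    rw [← sum_div, div_le_iff₀ hZ, mul_comm, hZdef, ← hg, sum_comm]
    refine sum_le_sum fun r _ => ?_
    rw [sum_comm]
    refine sum_le_sum fun A hA => ?_
    rw [sum_comm]
    refine sum_le_sum fun B hB => ?_
    rw [← mul_sum]
    refine mul_le_mul_of_nonneg_left ?_ (by positivity)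
    by_cases hG : Good M t s η r A.card B.card
    · simp only [if_pos hG]
      obtain ⟨cA, nA⟩ := cardA A hA
      obtain ⟨cB, nB⟩ := cardB B hB
      obtain ⟨k1, k2⟩ := h3 r _ _ hG cA cB
      obtain ⟨-, -, -, l1, l2⟩ := h4 t r _ _ hG cA cB
      have := pair_L1 a b r (t - r) A B nA nB (card_pos.1 l1) (card_pos.1 l2) (ε / 2) k1 k2
      refine this.trans (le_of_eq (by ring))
    · simp only [if_neg hG, sum_const_zero]
      have := mul_nonneg (sj_nonneg r A.card) (sj_nonneg (t - r) B.card)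
      positivity
  · intro σ hσ hk
    set fs := Real.exp (-lam) * (1 + lam) ^ (Fx a b σ).card
    have hfs : fs ≤ (1 + lam) ^ K := by
      have : Real.exp (-lam) ≤ 1 := Real.exp_le_one_iff.2 (by linarith)
      calc fs ≤ 1 * (1 + lam) ^ (Fx a b σ).card := mul_le_mul_of_nonneg_right this (by positivity)
        _ ≤ _ := by rw [one_mul]; exact pow_le_pow_right₀ (by linarith) hk
    have hn : (0 : ℝ) < 2 / (M + 2).factorial := by positivity
    -- main lower bound
    have step1 : (2 / (M + 2).factorial : ℝ) * (fs - ε) ≤ (2 / (M + 2).factorial : ℝ) * ((fs - ε / 2) * E) := by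
      refine mul_le_mul_of_nonneg_left ?_ hn.le
      have q1 : (1 - E) * (1 + lam) ^ K ≤ ε / 2 := by
        have : 1 - E ≤ ε / 2 / (1 + lam) ^ K := by linarith
        rwa [le_div_iff₀ hF] at this
      have q2 : (1 - E) * (fs - ε / 2) ≤ (1 - E) * (1 + lam) ^ K :=
        mul_le_mul_of_nonneg_left (by linarith) (by linarith)
      linarith
    have step2 : (2 / (M + 2).factorial : ℝ) * ((fs - ε / 2) * E) * Z ≤
        ∑ r ∈ range (t + 1), ∑ A ∈ (X0 a b).powerset, ∑ B ∈ (Xb b).powerset, (t.choose r : ℝ) *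
          (if Good M t s η r A.card B.card then sj r A.card * sj (t - r) B.card * cv (insert a A) (insert b B) ((-1) ^ r) ((-1) ^ (t - r)) σ else 0) := by
      rw [show (2 / (M + 2).factorial : ℝ) * ((fs - ε / 2) * E) * Z = ((2 / (M + 2).factorial : ℝ) * (fs - ε / 2) * Z) * E by ring]
      simp only [E, EE]
      rw [mul_sum]
      refine sum_le_sum fun r hr => ?_
      rw [grp a b hab M (Fintype.card_fin _), mul_sum]
      refine sum_le_sum fun p hp => ?_
      rw [mul_sum]
      refine sum_le_sum fun q hq => ?_
      rw [mem_range] at hr hp hq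
      have hc : ∀ A ∈ powersetCard p (X0 a b), ∀ B ∈ powersetCard q (Xb b), (t.choose r : ℝ) *
          (if Good M t s η r A.card B.card then sj r A.card * sj (t - r) B.card * cv (insert a A) (insert b B) ((-1) ^ r) ((-1) ^ (t - r)) σ else 0) =
          ((t.choose r : ℝ) * (if Good M t s η r p q then sj r p * sj (t - r) q else 0)) * cv (insert a A) (insert b B) ((-1) ^ r) ((-1) ^ (t - r)) σ := by
        intro A hA B hB
        rw [(mem_powersetCard.1 hA).2, (mem_powersetCard.1 hB).2]
        split_ifs <;> ring
      rw [sum_congr rfl fun A hA => sum_congr rfl fun B hB => hc A hA B hB]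
      simp only [← mul_sum]
      by_cases hG : Good M t s η r p q
      · simp only [if_pos hG]
        have hsg : Perm.sign σ = (-1) ^ r * (-1) ^ (t - r) := by rw [hσ, ← pow_add]; congr 1; omega
        have hb := h1 t r p q hG (by omega) (by omega) a b hab σ _ _ hsg hk
        change (fs - ε / 2) * _ ≤ _ at hb
        have h5 : 0 ≤ (t.choose r : ℝ) * (sj r p * sj (t - r) q) := mul_nonneg (by positivity) (mul_nonneg (sj_nonneg _ _) (sj_nonneg _ _))
        refine le_trans (le_of_eq ?_) (mul_le_mul_of_nonneg_left hb h5)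
        rw [wt, ← hZdef]
        clear_value fs
        field_simp
      · simp [if_neg hG]
    have step3 : (∑ r ∈ range (t + 1), ∑ A ∈ (X0 a b).powerset, ∑ B ∈ (Xb b).powerset, (t.choose r : ℝ) *
          (if Good M t s η r A.card B.card then sj r A.card * sj (t - r) B.card * cv (insert a A) (insert b B) ((-1) ^ r) ((-1) ^ (t - r)) σ else 0)) -
        e σ * Z ≤ HH a b t σ := by
      simp only [e]
      rw [div_mul_cancel₀ _ hZ.ne', HH]
      simp only [← sum_sub_distrib]
      refine sum_le_sum fun r _ => sum_le_sum fun A _ => sum_le_sum fun B _ => ?_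
      rw [← mul_sub]
      refine mul_le_mul_of_nonneg_left ?_ (by positivity)
      split_ifs
      · have := neg_abs_le (∑ g, N a r A g * N b (t - r) B (g⁻¹ * σ) - sj r A.card * sj (t - r) B.card * cv (insert a A) (insert b B) ((-1) ^ r) ((-1) ^ (t - r)) σ)
        simp only [D]
        linarith
      · rw [sub_zero]
        exact sum_nonneg fun g _ => mul_nonneg (N_nonneg _ _ _ _) (N_nonneg _ _ _ _)
    rw [le_div_iff₀ hZ]
    have := mul_le_mul_of_nonneg_right step1 hZ.le
    linarith
end TT

namespace TT
open Equiv Finset Topology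

lemma binv (L m k : ℕ) (hm : m ≤ L) :
    ∑ j ∈ range (L + 1), (-1 : ℝ) ^ (j + k) * (j.choose k : ℝ) * (m.choose j : ℝ) = if m = k then 1 else 0 := by
  have h0 : ∑ j ∈ range (L + 1), (-1 : ℝ) ^ (j + k) * (j.choose k : ℝ) * (m.choose j : ℝ) =
      ∑ j ∈ range (m + 1), (-1 : ℝ) ^ (j + k) * (j.choose k : ℝ) * (m.choose j : ℝ) := by
    symm
    apply sum_subset
    · intro x; simp only [mem_range]; omega
    · intro x _ hx
      rw [mem_range] at hx
      rw [Nat.choose_eq_zero_of_lt (show m < x by omega)]; simp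
  rw [h0]
  rcases Nat.lt_or_ge m k with h | h
  · rw [if_neg (by omega)]
    refine sum_eq_zero fun j hj => ?_
    rw [mem_range] at hj
    rw [Nat.choose_eq_zero_of_lt (show j < k by omega)]; simp
  · obtain ⟨d, rfl⟩ := Nat.exists_eq_add_of_le h
    rw [show k + d + 1 = k + (d + 1) by ring, sum_range_add]
    rw [sum_eq_zero (s := range k), zero_add]
    · have h1 : ∀ i ∈ range (d + 1), (-1 : ℝ) ^ (k + i + k) * ((k + i).choose k : ℝ) * ((k + d).choose (k + i) : ℝ) = ((k + d).choose k : ℝ) * (((-1) ^ i * d.choose i : ℤ) : ℝ) := by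
        intro i _
        have := Nat.choose_mul (n := k + d) (k := k + i) (s := k) (by omega)
        rw [show k + d - k = d by omega, show k + i - k = i by omega] at this
        have h2 : ((k + d).choose (k + i) : ℝ) * ((k + i).choose k : ℝ) = ((k + d).choose k : ℝ) * (d.choose i : ℝ) := by exact_mod_cast this
        rw [mul_assoc, mul_comm ((k + i).choose k : ℝ), h2, show k + i + k = 2 * k + i by ring, pow_add, pow_mul]
        push_cast
        norm_num
        ring
      rw [sum_congr rfl h1, ← mul_sum, ← Int.cast_sum, Int.alternating_sum_range_choose]
      by_cases hd : d = 0
      · subst hd; simp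
      · simp [hd]
    · intro j hj
      rw [mem_range] at hj
      rw [Nat.choose_eq_zero_of_lt hj]; simp

noncomputable def mu (M j : ℕ) : ℝ := (M.choose j : ℝ) * (M + 2 - j).factorial / (M + 2).factorial

lemma mu_nonneg (M j : ℕ) : 0 ≤ mu M j := by unfold mu; positivity

lemma mu_zero (M j : ℕ) (h : M < j) : mu M j = 0 := by
  rw [mu, Nat.choose_eq_zero_of_lt h]; simp

lemma mu_eq (M j : ℕ) (h : j ≤ M) : mu M j = (1 / j.factorial : ℝ) * (((M : ℝ) + 2 - j) * (M + 1 - j) / ((M + 2) * (M + 1))) := by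
  have h1 := Nat.choose_mul_factorial_mul_factorial h
  have h2 : (M.choose j : ℝ) * j.factorial * (M - j).factorial = M.factorial := by exact_mod_cast h1
  have h3 : ((M + 2 - j).factorial : ℝ) = ((M : ℝ) + 2 - j) * (M + 1 - j) * (M - j).factorial := by
    rw [show M + 2 - j = (M - j) + 1 + 1 by omega, Nat.factorial_succ, Nat.factorial_succ]
    push_cast [Nat.cast_sub h]; ring
  have h4 : ((M + 2).factorial : ℝ) = ((M : ℝ) + 2) * (M + 1) * M.factorial := by
    rw [Nat.factorial_succ, Nat.factorial_succ]; push_cast; ring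
  rw [mu, h3, h4, ← h2]
  have f1 : (j.factorial : ℝ) ≠ 0 := by positivity
  have f2 : ((M - j).factorial : ℝ) ≠ 0 := by positivity
  have f3 : (M.choose j : ℝ) ≠ 0 := by exact_mod_cast (Nat.choose_pos h).ne'
  field_simp

lemma mu_le (M j : ℕ) : mu M j ≤ 1 / j.factorial := by
  rcases Nat.lt_or_ge M j with h | h
  · rw [mu_zero M j h]; positivity
  · rw [mu_eq M j h]
    refine mul_le_of_le_one_right (by positivity) ?_
    rw [div_le_one (by positivity)]
    have : (j : ℝ) ≤ M := by exact_mod_cast h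
    have : (0 : ℝ) ≤ j := by positivity
    apply mul_le_mul <;> linarith

lemma mu_lim (j : ℕ) : Tendsto (fun M => mu M j) atTop (𝓝 (1 / j.factorial : ℝ)) := by
  have h1 : Tendsto (fun M : ℕ => 1 - (j : ℝ) * (1 / ((M : ℝ) + 1))) atTop (𝓝 (1 - (j : ℝ) * 0)) :=
    tendsto_const_nhds.sub (tendsto_one_div_add_atTop_nhds_zero_nat.const_mul _)
  have h2 : Tendsto (fun M : ℕ => (1 - (j : ℝ) * (1 / (((M + 1 : ℕ) : ℝ) + 1)))) atTop (𝓝 (1 - (j : ℝ) * 0)) :=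
    h1.comp (tendsto_add_atTop_nat 1)
  have h3 := (h2.mul h1).const_mul (1 / j.factorial : ℝ)
  rw [mul_zero, sub_zero, mul_one, mul_one] at h3
  refine h3.congr' ?_
  filter_upwards [eventually_ge_atTop j] with M hM
  rw [mu_eq M j hM]
  congr 1
  push_cast
  have : (M : ℝ) + 1 + 1 = M + 2 := by ring
  rw [this]
  have h5 : (M : ℝ) + 2 ≠ 0 := by positivity
  have h6 : (M : ℝ) + 1 ≠ 0 := by positivity
  field_simp

lemma moment (M : ℕ) (a b : Fin (M + 2)) (hab : a ≠ b) (e : ℤˣ) (j : ℕ) :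
    (2 / (M + 2).factorial : ℝ) * ∑ σ ∈ univ.filter (fun σ : Perm (Fin (M + 2)) => Perm.sign σ = e), ((Fx a b σ).card.choose j : ℝ) = mu M j := by
  have h1 : ∀ σ : Perm (Fin (M + 2)), ((Fx a b σ).card.choose j : ℝ) = ∑ S ∈ powersetCard j (X0 a b), if σ ∈ Sy (Sᶜ) then (1 : ℝ) else 0 := by
    intro σ
    rw [← card_powersetCard, ← sum_filter, sum_const, nsmul_eq_mul, mul_one]
    congr 2
    ext S
    simp only [mem_filter, mem_powersetCard, mem_Sy, Fx, subset_iff, mem_compl, not_not]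
    grind
  rw [sum_congr rfl fun σ _ => h1 σ, sum_comm]
  rcases Nat.lt_or_ge M j with h | h
  · rw [mu_zero M j h, powersetCard_eq_empty.2]
    · simp
    · rw [card_X0 a b hab, Fintype.card_fin]; omega
  have h2 : ∀ S ∈ powersetCard j (X0 a b), (∑ σ ∈ univ.filter (fun σ : Perm (Fin (M + 2)) => Perm.sign σ = e), if σ ∈ Sy (Sᶜ) then (1 : ℝ) else 0) = ((M + 2 - j).factorial : ℝ) / 2 := by
    intro S hS
    have hc : (Sᶜ).card = M + 2 - j := by rw [card_compl, Fintype.card_fin, (mem_powersetCard.1 hS).2]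
    have := card_Sy_sign (Sᶜ) (by omega) e
    rw [hc] at this
    rw [← this, ← sum_filter, sum_const, nsmul_eq_mul, mul_one, mul_div_cancel_left₀ _ (two_ne_zero)]
    congr 2
    ext σ; simp only [mem_filter, mem_univ, true_and]; tauto
  rw [sum_congr rfl h2, sum_const, card_powersetCard, card_X0 a b hab, Fintype.card_fin, mu, nsmul_eq_mul, show M + 2 - 2 = M by omega]
  field_simp

noncomputable def pm (M k : ℕ) : ℝ := ∑ j ∈ range (M + 1), (-1 : ℝ) ^ (j + k) * (j.choose k : ℝ) * mu M j

lemma avg_eq (M : ℕ) (a b : Fin (M + 2)) (hab : a ≠ b) (e : ℤˣ) (φ : ℕ → ℝ) :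
    (2 / (M + 2).factorial : ℝ) * ∑ σ ∈ univ.filter (fun σ : Perm (Fin (M + 2)) => Perm.sign σ = e), φ (Fx a b σ).card = ∑ k ∈ range (M + 1), pm M k * φ k := by
  have h1 : ∀ σ : Perm (Fin (M + 2)), φ (Fx a b σ).card = ∑ k ∈ range (M + 1), φ k * ∑ j ∈ range (M + 1), (-1 : ℝ) ^ (j + k) * (j.choose k : ℝ) * ((Fx a b σ).card.choose j : ℝ) := by
    intro σ
    have hm : (Fx a b σ).card ≤ M := by
      have := card_le_card (filter_subset (fun x => σ x = x) (X0 a b))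
      rw [card_X0 a b hab, Fintype.card_fin] at this
      exact this.trans (by omega)
    simp only [binv M _ _ hm]
    simp only [mul_ite, mul_one, mul_zero]
    rw [sum_ite_eq, if_pos (by rw [mem_range]; omega)]
  rw [sum_congr rfl fun σ _ => h1 σ, sum_comm, mul_sum]
  refine sum_congr rfl fun k _ => ?_
  rw [← mul_sum, sum_comm, pm, sum_mul, mul_sum, mul_sum]
  refine sum_congr rfl fun j _ => ?_
  rw [← moment M a b hab e j, ← mul_sum]
  ring

lemma pm_zero (M k : ℕ) (h : M < k) : pm M k = 0 := by
  refine sum_eq_zero fun j hj => ?_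
  rw [mem_range] at hj
  rw [Nat.choose_eq_zero_of_lt (show j < k by omega)]; simp

lemma pm_ind (M k : ℕ) (h : k ≤ M) : pm M k = (2 / (M + 2).factorial : ℝ) * ∑ σ ∈ univ.filter (fun σ : Perm (Fin (M + 2)) => Perm.sign σ = 1), (if (Fx 0 1 σ).card = k then (1 : ℝ) else 0) := by
  have := avg_eq M 0 1 (by simp) 1 (fun m => if m = k then (1 : ℝ) else 0)
  rw [this]
  simp only [mul_ite, mul_one, mul_zero]
  rw [sum_ite_eq', if_pos (by rw [mem_range]; omega)]

lemma pm_nonneg (M k : ℕ) : 0 ≤ pm M k := by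
  rcases Nat.lt_or_ge M k with h | h
  · rw [pm_zero M k h]
  · rw [pm_ind M k h]; positivity

lemma pm_le (M k : ℕ) : pm M k ≤ 1 / k.factorial := by
  rcases Nat.lt_or_ge M k with h | h
  · rw [pm_zero M k h]; positivity
  · rw [pm_ind M k h]
    refine le_trans ?_ (mu_le M k)
    rw [← moment M 0 1 (by simp) 1 k]
    refine mul_le_mul_of_nonneg_left (sum_le_sum fun σ _ => ?_) (by positivity)
    split_ifs with h
    · rw [h]; simp
    · positivity

lemma pm_lim (k : ℕ) : Tendsto (fun M => pm M k) atTop (𝓝 (Real.exp (-1) * 1 ^ k / k.factorial)) := by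
  have h1 : ∀ M, pm M k = ∑' j, (-1 : ℝ) ^ (j + k) * (j.choose k : ℝ) * mu M j := by
    intro M
    rw [tsum_eq_sum (s := range (M + 1)), pm]
    intro j hj
    rw [mem_range] at hj
    rw [mu_zero M j (by omega), mul_zero]
  have h2 : HasSum (fun j : ℕ => (-1 : ℝ) ^ (j + k) * (j.choose k : ℝ) * (1 / j.factorial : ℝ)) (Real.exp (-1) * 1 ^ k / k.factorial) := by
    rw [← (add_left_injective k).hasSum_iff]
    · have h3 : HasSum (fun i : ℕ => (-1 : ℝ) ^ i / i.factorial) (Real.exp (-1)) := by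
        rw [Real.exp_eq_exp_ℝ]; exact NormedSpace.expSeries_div_hasSum_exp (-1 : ℝ)
      have h4 := h3.mul_right (1 / k.factorial : ℝ)
      have hf : ((fun j : ℕ => (-1 : ℝ) ^ (j + k) * (j.choose k : ℝ) * (1 / j.factorial : ℝ)) ∘ fun x => x + k) = fun i : ℕ => (-1 : ℝ) ^ i / i.factorial * (1 / k.factorial : ℝ) := by
        funext i
        simp only [Function.comp]
        have h5 := Nat.add_choose_mul_factorial_mul_factorial i k
        have h6 : ((i + k).choose k : ℝ) * i.factorial * k.factorial = (i + k).factorial := by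
          exact_mod_cast h5
        rw [show i + k + k = 2 * k + i by ring, pow_add, pow_mul, ← h6]
        have : ((i + k).choose k : ℝ) ≠ 0 := by exact_mod_cast (Nat.choose_pos (by omega)).ne'
        norm_num
        field_simp
      rw [hf, show Real.exp (-1) * 1 ^ k / (k.factorial : ℝ) = Real.exp (-1) * (1 / k.factorial : ℝ) by rw [one_pow]; ring]
      exact h4
    · intro x hx
      have : x < k := by
        by_contra hh
        exact hx ⟨x - k, by simp; omega⟩
      rw [Nat.choose_eq_zero_of_lt this]; simp
  simp only [h1]
  rw [← h2.tsum_eq]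
  refine tendsto_tsum_of_dominated_convergence (bound := fun j : ℕ => (2 : ℝ) ^ j / j.factorial) (Real.summable_pow_div_factorial 2) ?_ ?_
  · intro j
    exact (mu_lim j).const_mul _
  · refine Eventually.of_forall fun M j => ?_
    rw [norm_mul, norm_mul, norm_pow, norm_neg, norm_one, one_pow, one_mul, Real.norm_of_nonneg (mu_nonneg M j), Real.norm_of_nonneg (by positivity)]
    have h5 : (j.choose k : ℝ) ≤ 2 ^ j := by exact_mod_cast Nat.choose_le_two_pow j k
    calc _ ≤ (2 : ℝ) ^ j * (1 / j.factorial) := mul_le_mul h5 (mu_le M j) (mu_nonneg M j) (by positivity)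
      _ = _ := by ring

lemma pm_avg_lim (φ : ℕ → ℝ) (x : ℝ) (hφ : ∀ k, |φ k| ≤ x ^ k) :
    Tendsto (fun M => ∑ k ∈ range (M + 1), pm M k * φ k) atTop (𝓝 (∑' k : ℕ, (Real.exp (-1) * 1 ^ k / k.factorial) * φ k)) := by
  have h1 : ∀ M, ∑ k ∈ range (M + 1), pm M k * φ k = ∑' k, pm M k * φ k := by
    intro M
    rw [tsum_eq_sum]
    intro j hj
    rw [mem_range] at hj
    rw [pm_zero M j (by omega), zero_mul]
  simp only [h1]
  refine tendsto_tsum_of_dominated_convergence (bound := fun j : ℕ => x ^ j / j.factorial) (Real.summable_pow_div_factorial x) ?_ ?_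
  · intro j
    exact (pm_lim j).mul_const _
  · refine Eventually.of_forall fun M j => ?_
    rw [norm_mul, Real.norm_of_nonneg (pm_nonneg M j), Real.norm_eq_abs]
    calc _ ≤ (1 / j.factorial : ℝ) * x ^ j := mul_le_mul (pm_le M j) (hφ j) (abs_nonneg _) (by positivity)
      _ = _ := by ring
end TT

namespace TT
open Equiv Finset Topology

lemma tail_small (x ε : ℝ) (hε : 0 < ε) :
    ∃ K : ℕ, ∑' k : ℕ, (x ^ k / k.factorial : ℝ) * (if K < k then 1 else 0) < ε := by
  have h : Tendsto (fun K : ℕ => ∑' k : ℕ, (x ^ k / k.factorial : ℝ) * (if K < k then 1 else 0)) atTop (𝓝 (∑' _ : ℕ, (0 : ℝ))) := by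
    refine tendsto_tsum_of_dominated_convergence (bound := fun j : ℕ => |x| ^ j / j.factorial) (Real.summable_pow_div_factorial _) ?_ ?_
    · intro j
      refine tendsto_const_nhds.congr' ?_
      filter_upwards [eventually_ge_atTop j] with K hK
      rw [if_neg (by omega), mul_zero]
    · refine Eventually.of_forall fun K j => ?_
      rw [norm_mul, norm_div, norm_pow, Real.norm_eq_abs, Real.norm_natCast]
      refine mul_le_of_le_one_right (by positivity) ?_
      split_ifs <;> simp
  rw [tsum_zero] at h
  exact (h.eventually_lt_const hε).exists

lemma final_bound (M : ℕ) (a b : Fin (M + 2)) (hab : a ≠ b) (e : ℤˣ) (h er : Perm (Fin (M + 2)) → ℝ) (fs : ℕ → ℝ) (ε x : ℝ) (K : ℕ)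
    (h0 : ∀ σ, 0 ≤ h σ) (h1 : ∑ σ, h σ = 1) (he : ∀ σ, 0 ≤ er σ) (hes : ∑ σ, er σ ≤ ε) (hε : 0 < ε)
    (hf0 : ∀ k, 0 ≤ fs k) (hfx : ∀ k, fs k ≤ x ^ k) (hx : 0 ≤ x)
    (hl : ∀ σ, Perm.sign σ = e → (Fx a b σ).card ≤ K → (2 / (M + 2).factorial : ℝ) * (fs (Fx a b σ).card - ε) - er σ ≤ h σ)
    (hK : ∑' k : ℕ, (x ^ k / k.factorial : ℝ) * (if K < k then 1 else 0) < ε) :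
    |(∑ σ, if Perm.sign σ = e then |h σ - 2 / (M + 2).factorial| else 0) - (∑ k ∈ range (M + 1), pm M k * |fs k - 1|)| ≤
      6 * ε + (1 - ∑ k ∈ range (M + 1), pm M k * fs k) := by
  set d : ℝ := 2 / (M + 2).factorial with hd
  have hd0 : 0 < d := by positivity
  set S := univ.filter (fun σ : Perm (Fin (M + 2)) => Perm.sign σ = e)
  have hS : ∀ F : Perm (Fin (M + 2)) → ℝ, (∀ σ, 0 ≤ F σ) → ∑ σ ∈ S, F σ ≤ ∑ σ, F σ := fun F hF =>
    sum_le_sum_of_subset_of_nonneg (subset_univ _) fun σ _ _ => hF σ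
  have avg : ∀ φ : ℕ → ℝ, ∑ σ ∈ S, d * φ (Fx a b σ).card = ∑ k ∈ range (M + 1), pm M k * φ k := by
    intro φ; rw [← mul_sum]; exact avg_eq M a b hab e φ
  have avg1 : ∑ σ ∈ S, d * ε = ε := by
    have := moment M a b hab e 0
    simp only [Nat.choose_zero_right, Nat.cast_one] at this
    have h2 : mu M 0 = 1 := by
      rw [mu, Nat.choose_zero_right, Nat.cast_one, one_mul, Nat.sub_zero, div_self (by positivity)]
    rw [h2, mul_sum] at this
    rw [← sum_mul]
    simp only [mul_one] at this
    rw [this, one_mul]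
  rw [← sum_filter, ← avg, ← avg, ← sum_sub_distrib]
  have htail : ∑ σ ∈ S, d * (fs (Fx a b σ).card * (if K < (Fx a b σ).card then 1 else 0)) ≤ ε := by
    rw [avg (fun k => fs k * (if K < k then 1 else 0))]
    have hsum : Summable (fun k : ℕ => (x ^ k / k.factorial : ℝ) * (if K < k then 1 else 0)) := by
      refine Summable.of_nonneg_of_le (fun k => ?_) (fun k => ?_) (Real.summable_pow_div_factorial x)
      · positivity
      · refine mul_le_of_le_one_right (by positivity) ?_
        split_ifs <;> norm_num
    refine le_trans ?_ ((hsum.sum_le_tsum (range (M + 1)) fun k _ => by positivity).trans hK.le)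
    refine sum_le_sum fun k _ => ?_
    rw [← mul_assoc]
    refine mul_le_mul_of_nonneg_right ?_ (by positivity)
    calc _ ≤ (1 / k.factorial : ℝ) * x ^ k := mul_le_mul (pm_le M k) (hfx k) (hf0 k) (by positivity)
      _ = _ := by ring
  have key : ∀ σ ∈ S, |h σ - d * fs (Fx a b σ).card| ≤ h σ - d * fs (Fx a b σ).card + 2 * (d * ε + er σ + d * (fs (Fx a b σ).card * (if K < (Fx a b σ).card then 1 else 0))) := by
    intro σ hσ
    have e1 := he σ
    have e2 := h0 σ
    have e3 : 0 < d * ε := by positivity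
    have e4 : 0 ≤ d * fs (Fx a b σ).card := mul_nonneg hd0.le (hf0 _)
    split_ifs with hk
    · rw [abs_le]; constructor <;> linarith
    · have := hl σ (mem_filter.1 hσ).2 (by omega)
      rw [mul_sub] at this
      rw [abs_le]; constructor <;> linarith
  have hsum := sum_le_sum key
  rw [sum_add_distrib, sum_sub_distrib, ← mul_sum S _ (2 : ℝ), sum_add_distrib, sum_add_distrib, avg1] at hsum
  have k1 := hS h h0
  have k2 := hS er he
  calc _ ≤ ∑ σ ∈ S, |h σ - d * fs (Fx a b σ).card| := by
        refine (abs_sum_le_sum_abs _ _).trans (sum_le_sum fun σ _ => ?_)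
        have : d * |fs (Fx a b σ).card - 1| = |d * fs (Fx a b σ).card - d| := by
          rw [← mul_sub_one, abs_mul, abs_of_pos hd0]
        rw [this]
        refine (abs_abs_sub_abs_le_abs_sub _ _).trans (le_of_eq ?_)
        congr 1; ring
    _ ≤ _ := by linarith

theorem main (c : ℝ) : Tendsto (fun n : ℕ => tvDist (convPow (Pmeas n) (tt c n)) (unif (alternatingGroup (Fin n)))) atTop
    (𝓝 (poissonTV (1 + Real.exp (-c)) 1)) := by
  rw [← tendsto_add_atTop_iff_nat 2]
  set lam := Real.exp (-c) with hlamdef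
  have hlam : 0 < lam := Real.exp_pos _
  let fs : ℕ → ℝ := fun k => Real.exp (-lam) * (1 + lam) ^ k
  have hf0 : ∀ k, 0 ≤ fs k := fun k => by positivity
  have hfx : ∀ k, fs k ≤ (1 + lam) ^ k := fun k =>
    mul_le_of_le_one_left (by positivity) (Real.exp_le_one_iff.2 (by linarith))
  have L1 := pm_avg_lim fs (1 + lam) (fun k => by rw [abs_of_nonneg (hf0 k)]; exact hfx k)
  have L2 := pm_avg_lim (fun k => |fs k - 1|) (1 + lam) (fun k => by
    rw [abs_abs, abs_le]
    have h1 : 1 ≤ (1 + lam) ^ k := one_le_pow₀ (by linarith)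
    have := hf0 k
    have := hfx k
    constructor <;> linarith)
  have v1 : ∑' k : ℕ, (Real.exp (-1) * 1 ^ k / k.factorial) * fs k = 1 := by
    have h3 : HasSum (fun i : ℕ => (1 + lam) ^ i / i.factorial) (Real.exp (1 + lam)) := by
      rw [Real.exp_eq_exp_ℝ]; exact NormedSpace.expSeries_div_hasSum_exp (1 + lam)
    have h4 := (h3.mul_left (Real.exp (-1) * Real.exp (-lam))).tsum_eq
    rw [← Real.exp_add, ← Real.exp_add, show -1 + -lam + (1 + lam) = 0 by ring, Real.exp_zero] at h4
    refine Eq.trans ?_ h4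
    refine tsum_congr fun k => ?_
    simp only [fs]
    rw [one_pow, Real.exp_add]; ring
  have v2 : (∑' k : ℕ, (Real.exp (-1) * 1 ^ k / k.factorial) * |fs k - 1|) = 2 * poissonTV (1 + lam) 1 := by
    rw [poissonTV, mul_div_cancel₀ _ two_ne_zero]
    refine tsum_congr fun k => ?_
    have hp : (0 : ℝ) ≤ Real.exp (-1) * 1 ^ k / k.factorial := by positivity
    rw [← abs_of_nonneg hp, ← abs_mul, abs_of_nonneg hp]
    congr 1
    simp only [fs]
    rw [neg_add, Real.exp_add]; ring
  rw [v1] at L1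
  rw [v2] at L2
  rw [Metric.tendsto_atTop']
  intro ε0 hε0
  set ε := ε0 / 8 with hεd
  have hε : 0 < ε := by positivity
  obtain ⟨K, hK⟩ := tail_small (1 + lam) ε hε
  have ev := (lower c ε hε K).and ((L1.eventually_const_lt (show 1 - ε < 1 by linarith)).and
    ((Metric.tendsto_nhds.1 L2 ε hε).and (eventually_ge_atTop 1)))
  rw [eventually_atTop] at ev
  obtain ⟨N0, hN0⟩ := ev
  refine ⟨N0, fun M hM => ?_⟩
  obtain ⟨low, l1, l2, hM1⟩ := hN0 M (le_of_lt hM)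
  let a : Fin (M + 2) := ⟨M, by omega⟩
  let b : Fin (M + 2) := ⟨M + 1, by omega⟩
  have hab : a ≠ b := by simp [a, b]
  obtain ⟨er, he, hes, hl⟩ := low a b hab
  have hZ : (0 : ℝ) < (2 * (M : ℝ) + 1) ^ (tt c (M + 2)) := by positivity
  have hb := final_bound M a b hab ((-1) ^ (tt c (M + 2))) (fun σ => HH a b (tt c (M + 2)) σ / (2 * (M : ℝ) + 1) ^ (tt c (M + 2))) er fs ε (1 + lam) K
    (fun σ => div_nonneg (sum_nonneg fun r _ => sum_nonneg fun A _ => sum_nonneg fun B _ => mul_nonneg (by positivity)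
      (sum_nonneg fun g _ => mul_nonneg (N_nonneg _ _ _ _) (N_nonneg _ _ _ _))) hZ.le)
    (by rw [← sum_div, sum_HH a b hab M (Fintype.card_fin _), div_self hZ.ne'])
    he hes hε hf0 hfx (by linarith) hl hK
  have htv := tv_formula (M + 2) (by omega) (tt c (M + 2)) a b rfl rfl
  rw [show 2 * ((M + 2 : ℕ) : ℝ) - 3 = 2 * (M : ℝ) + 1 by push_cast; ring] at htv
  rw [Real.dist_eq] at l2 ⊢
  rw [eq_div_iff two_ne_zero] at htv
  rw [← htv] at hb
  have := abs_sub_lt_iff.1 l2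
  rw [abs_le] at hb
  rw [abs_lt]
  constructor <;> linarith [hb.1, hb.2, this.1, this.2]
end TT

theorem stmt0 (c : ℝ) :
    Filter.Tendsto (fun n : ℕ =>
      tvDist (convPow (Pmeas n) ⌈((n : ℝ) - 3 / 2) * Real.log n + c * n⌉₊)
        (unif (alternatingGroup (Fin n))))
      Filter.atTop (nhds (poissonTV (1 + Real.exp (-c)) 1)) := TT.main c
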